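/- Every jointly completely bounded bilinear form u : A × B → ℂ on C*-algebras A and B decomposes as a sum u = u₁ + u₂ of completely bounded bilinear forms on A × B such that ‖u₁‖_cb + ‖u₂ᵗ‖_cb ≤ 2 ‖u‖_jcb. (Blecher's inequality with constant K = 2, due to Haagerup–Musat.) -/

import Mathlib

open scoped ComplexOrder

/-- A state on a C*-algebra: a positive continuous linear functional of norm one. -/
def IsState {A : Type*} [NonUnitalCStarAlgebra A] (f : A →L[ℂ] ℂ) : Prop :=
  ‖f‖ = 1 ∧ ∀ a : A, 0 ≤ f (star a * a)

/-- The (unique) C*-norm of a matrix over a C*-algebra, computed via the action on the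
standard Hilbert C*-module `Aⁿ` (whose norm is `‖v‖ = ‖∑ᵢ vᵢ* vᵢ‖^{1/2}`). -/
noncomputable def matCNorm {A : Type*} [NonUnitalCStarAlgebra A]
    {n : Type*} [Fintype n] (x : Matrix n n A) : ℝ :=
  sSup {r : ℝ | ∃ v : n → A, ‖∑ i, star (v i) * v i‖ ≤ 1 ∧
    r = Real.sqrt ‖∑ i, star (x.mulVec v i) * x.mulVec v i‖}

/-- The `n`-th amplification `u_n : M_n(A) × M_n(B) → M_{n²}(ℂ)` of a bilinear form,
with entries `u_n(x,y)_{(i,k),(j,l)} = u(x_{ij}, y_{kl})`. -/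
def jcbAmp {A B : Type*} [NonUnitalCStarAlgebra A] [NonUnitalCStarAlgebra B]
    (u : A →ₗ[ℂ] B →ₗ[ℂ] ℂ) (n : ℕ) (x : Matrix (Fin n) (Fin n) A)
    (y : Matrix (Fin n) (Fin n) B) : Matrix (Fin n × Fin n) (Fin n × Fin n) ℂ :=
  fun p q => u (x p.1 q.1) (y p.2 q.2)

/-- The set of values `‖u_n(x,y)‖` over all `n` and all matrices `x, y` of norm at most one;
its supremum is the jointly completely bounded norm `‖u‖_jcb = sup_n ‖u_n‖`. -/
def jcbNormSet {A B : Type*} [NonUnitalCStarAlgebra A] [NonUnitalCStarAlgebra B]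
    (u : A →ₗ[ℂ] B →ₗ[ℂ] ℂ) : Set ℝ :=
  {r : ℝ | ∃ (n : ℕ) (x : Matrix (Fin n) (Fin n) A) (y : Matrix (Fin n) (Fin n) B),
    matCNorm x ≤ 1 ∧ matCNorm y ≤ 1 ∧ r = matCNorm (jcbAmp u n x y)}

/-- A bilinear form is jointly completely bounded if `sup_n ‖u_n‖ < ∞`. -/
def JointlyCompletelyBounded {A B : Type*} [NonUnitalCStarAlgebra A] [NonUnitalCStarAlgebra B]
    (u : A →ₗ[ℂ] B →ₗ[ℂ] ℂ) : Prop :=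
  BddAbove (jcbNormSet u)

/-- The jointly completely bounded norm `‖u‖_jcb`. -/
noncomputable def jcbNorm {A B : Type*} [NonUnitalCStarAlgebra A] [NonUnitalCStarAlgebra B]
    (u : A →ₗ[ℂ] B →ₗ[ℂ] ℂ) : ℝ :=
  sSup (jcbNormSet u)

/-- The `n`-th Christensen–Sinclair amplification `u_{(n)} : M_n(A) × M_n(B) → M_n(ℂ)` of a
bilinear form, with entries `u_{(n)}(x,y)_{ij} = ∑ₖ u(x_{ik}, y_{kj})`. -/
noncomputable def cbAmp {A B : Type*} [NonUnitalCStarAlgebra A] [NonUnitalCStarAlgebra B]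
    (u : A →ₗ[ℂ] B →ₗ[ℂ] ℂ) (n : ℕ) (x : Matrix (Fin n) (Fin n) A)
    (y : Matrix (Fin n) (Fin n) B) : Matrix (Fin n) (Fin n) ℂ :=
  fun i j => ∑ k, u (x i k) (y k j)

/-- The set of values `‖u_{(n)}(x,y)‖` over all `n` and all matrices `x, y` of norm at most
one; its supremum is the completely bounded norm `‖u‖_cb = sup_n ‖u_{(n)}‖`. -/
def cbNormSet {A B : Type*} [NonUnitalCStarAlgebra A] [NonUnitalCStarAlgebra B]
    (u : A →ₗ[ℂ] B →ₗ[ℂ] ℂ) : Set ℝ :=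
  {r : ℝ | ∃ (n : ℕ) (x : Matrix (Fin n) (Fin n) A) (y : Matrix (Fin n) (Fin n) B),
    matCNorm x ≤ 1 ∧ matCNorm y ≤ 1 ∧ r = matCNorm (cbAmp u n x y)}

/-- A bilinear form is completely bounded (in the Christensen–Sinclair sense) if
`sup_n ‖u_{(n)}‖ < ∞`. -/
def CompletelyBounded {A B : Type*} [NonUnitalCStarAlgebra A] [NonUnitalCStarAlgebra B]
    (u : A →ₗ[ℂ] B →ₗ[ℂ] ℂ) : Prop :=
  BddAbove (cbNormSet u)

/-- The completely bounded norm `‖u‖_cb`. -/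
noncomputable def cbNorm {A B : Type*} [NonUnitalCStarAlgebra A] [NonUnitalCStarAlgebra B]
    (u : A →ₗ[ℂ] B →ₗ[ℂ] ℂ) : ℝ :=
  sSup (cbNormSet u)

section CStarLemmas

variable {𝒜 : Type*} [CStarAlgebra 𝒜] [PartialOrder 𝒜] [StarOrderedRing 𝒜]

omit [PartialOrder 𝒜] [StarOrderedRing 𝒜] in
lemma cstar_norm_one_le : ‖(1 : 𝒜)‖ ≤ 1 := by
  rcases subsingleton_or_nontrivial 𝒜 with h | h
  · rw [Subsingleton.elim (1 : 𝒜) 0]; simp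
  · exact CStarRing.norm_one.le

lemma norm_le_one_iff_star_mul_le_one {x : 𝒜} : ‖x‖ ≤ 1 ↔ star x * x ≤ 1 := by
  rw [← CStarAlgebra.norm_le_one_iff_of_nonneg _ (star_mul_self_nonneg x),
    CStarRing.norm_star_mul_self]
  constructor
  · intro h; nlinarith [norm_nonneg x]
  · intro h; by_contra! h'; nlinarith [norm_nonneg x]

lemma norm_le_one_iff_mul_star_le_one {x : 𝒜} : ‖x‖ ≤ 1 ↔ x * star x ≤ 1 := by
  rw [← norm_star x, norm_le_one_iff_star_mul_le_one, star_star]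

/-- `a * w * c + b * g * d` is a contraction if `(a, b)` is a row contraction, `(c, d)` is a
column contraction and `w`, `g` are contractions. -/
lemma norm_sandwich_add_sandwich_le_one {a b c d w g : 𝒜} (hab : a * star a + b * star b ≤ 1)
    (hcd : star c * c + star d * d ≤ 1) (hw : ‖w‖ ≤ 1) (hg : ‖g‖ ≤ 1) :
    ‖a * w * c + b * g * d‖ ≤ 1 := by
  rw [norm_le_one_iff_star_mul_le_one] at *
  set p := w * c with hp
  set q := g * d with hq
  have hpc : star p * p ≤ star c * c := by
    have := star_left_conjugate_le_conjugate hw c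
    simpa [hp, mul_assoc] using this
  have hqd : star q * q ≤ star d * d := by
    have := star_left_conjugate_le_conjugate hg d
    simpa [hq, mul_assoc] using this
  set m := a * p + b * q with hm
  have hmm : a * w * c + b * g * d = m := by simp [hm, hp, hq, mul_assoc]
  rw [hmm]
  have e1 := star_mul_self_nonneg (p - star a * m)
  have e2 := star_mul_self_nonneg (q - star b * m)
  have e3 := star_left_conjugate_le_conjugate hab m
  have key : star m * m = (star p * p + star q * q)
      - (star (p - star a * m) * (p - star a * m) + star (q - star b * m) * (q - star b * m))
      - (star m * 1 * m - star m * (a * star a + b * star b) * m) := by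
    simp only [star_sub, star_mul, star_star]
    have : star m = star p * star a + star q * star b := by simp [hm]
    have h1 : star m * m = star m * (a * p + b * q) := rfl
    have h2 : star m * m = (star p * star a + star q * star b) * m := by rw [this]
    have h3 : star m * m + star m * m = (star p * star a + star q * star b) * m
      + star m * (a * p + b * q) := by rw [← h2, ← h1]
    linear_combination (norm := noncomm_ring) h3
  calc star m * m ≤ star p * p + star q * q := by
        rw [key]
        exact (sub_le_self _ (sub_nonneg.2 e3)).trans (sub_le_self _ (add_nonneg e1 e2))
    _ ≤ _ := add_le_add hpc hqd
    _ ≤ 1 := hcd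

lemma norm_perturb_sq_le {V H : 𝒜} (hV : ‖V‖ ≤ 1) (hH : ‖H‖ ≤ 1) (σ : ℝ) :
    ‖V + σ • (H - V * star H * V)‖ ^ 2 ≤ 1 + 5 * σ ^ 2 := by
  have hV' := norm_le_one_iff_star_mul_le_one.1 hV
  set G := H - V * star H * V with hG
  set D := 1 - star V * V with hD
  have hD0 : 0 ≤ D := sub_nonneg.2 hV'
  have hD1 : ‖D‖ ≤ 1 := (CStarAlgebra.norm_le_one_iff_of_nonneg _ hD0).2
    (sub_le_self _ (star_mul_self_nonneg V))
  have hstar : star D = D := (IsSelfAdjoint.of_nonneg hD0).star_eq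
  have hGn : ‖G‖ ≤ 2 := by
    calc ‖G‖ ≤ ‖H‖ + ‖V * star H * V‖ := norm_sub_le _ _
      _ ≤ 1 + 1 * 1 * 1 := by
        gcongr
        refine (norm_mul_le _ _).trans ?_
        gcongr
        refine (norm_mul_le _ _).trans ?_
        gcongr
        rwa [norm_star]
      _ = 2 := by norm_num
  have e1 := star_left_conjugate_nonneg hD0 (1 - σ • (star H * V))
  have key : star (V + σ • G) * (V + σ • G) = 1 + σ ^ 2 • (star V * H * D * (star H * V))
      + σ ^ 2 • (star G * G) - star (1 - σ • (star H * V)) * D * (1 - σ • (star H * V)) := by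
    simp only [hG, hD, star_add, star_smul, star_sub, star_mul, star_star, star_one, star_trivial,
      mul_add, add_mul, mul_sub, sub_mul, smul_mul_assoc, mul_smul_comm, smul_add, smul_sub,
      mul_one, one_mul, mul_assoc, pow_two, smul_smul]
    module
  rw [pow_two, ← CStarRing.norm_star_mul_self]
  calc ‖star (V + σ • G) * (V + σ • G)‖
      ≤ ‖1 + σ ^ 2 • (star V * H * D * (star H * V)) + σ ^ 2 • (star G * G)‖ := by
        refine CStarAlgebra.norm_le_norm_of_nonneg_of_le (star_mul_self_nonneg _) ?_
        rw [key]; exact sub_le_self _ e1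
    _ ≤ 1 + σ ^ 2 * (1 * 1 * 1 * (1 * 1)) + σ ^ 2 * (2 * 2) := by
        refine (norm_add_le _ _).trans (add_le_add ((norm_add_le _ _).trans
          (add_le_add cstar_norm_one_le ?_)) ?_)
        · rw [norm_smul, Real.norm_of_nonneg (sq_nonneg σ)]
          gcongr
          refine (norm_mul_le _ _).trans ?_
          gcongr
          · refine (norm_mul_le _ _).trans ?_
            gcongr
            refine (norm_mul_le _ _).trans ?_
            gcongr
            rwa [norm_star]
          · refine (norm_mul_le _ _).trans ?_
            gcongr
            rwa [norm_star]
        · rw [norm_smul, Real.norm_of_nonneg (sq_nonneg σ)]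
          gcongr
          refine (norm_mul_le _ _).trans ?_
          gcongr
          rwa [norm_star]
    _ = _ := by ring

/-- The resolvent `(1 + T)⁻¹`. -/
noncomputable def resolv (T : 𝒜) : 𝒜 := Ring.inverse (1 + T)

lemma isUnit_one_add_of_nonneg {T : 𝒜} (hT : 0 ≤ T) : IsUnit (1 + T) :=
  CStarAlgebra.isUnit_of_le 1 (le_add_of_nonneg_right hT)

lemma resolv_mul_cancel {T : 𝒜} (hT : 0 ≤ T) : resolv T * (1 + T) = 1 :=
  Ring.inverse_mul_cancel _ (isUnit_one_add_of_nonneg hT)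

lemma mul_resolv_cancel {T : 𝒜} (hT : 0 ≤ T) : (1 + T) * resolv T = 1 :=
  Ring.mul_inverse_cancel _ (isUnit_one_add_of_nonneg hT)

lemma commute_resolv {T c : 𝒜} (hT : 0 ≤ T) (h : Commute c T) : Commute c (resolv T) := by
  obtain ⟨w, hw⟩ := isUnit_one_add_of_nonneg hT
  rw [resolv, ← hw, Ring.inverse_unit]
  refine Commute.units_inv_right ?_
  rw [hw]
  exact (Commute.one_right c).add_right h

lemma resolv_nonneg {T : 𝒜} (hT : 0 ≤ T) : 0 ≤ resolv T := by
  have h : 0 ≤ 1 + T := add_nonneg zero_le_one hT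
  obtain ⟨w, hw⟩ := isUnit_one_add_of_nonneg hT
  rw [resolv, ← hw, Ring.inverse_unit]
  have : (0 : 𝒜) ≤ w := hw ▸ h
  exact CFC.inv_nonneg_of_nonneg w

lemma resolv_le_one {T : 𝒜} (hT : 0 ≤ T) : resolv T ≤ 1 := by
  obtain ⟨w, hw⟩ := isUnit_one_add_of_nonneg hT
  rw [resolv, ← hw, Ring.inverse_unit]
  have h1 : 1 ≤ (w : 𝒜) := by rw [hw]; exact le_add_of_nonneg_right hT
  exact CStarAlgebra.inv_le_one (a := w) h1

lemma star_resolv {T : 𝒜} (hT : 0 ≤ T) : star (resolv T) = resolv T :=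
  (IsSelfAdjoint.of_nonneg (resolv_nonneg hT)).star_eq

lemma norm_resolv_le {T : 𝒜} (hT : 0 ≤ T) : ‖resolv T‖ ≤ 1 :=
  (CStarAlgebra.norm_le_one_iff_of_nonneg _ (resolv_nonneg hT)).2 (resolv_le_one hT)

lemma one_sub_resolv {T : 𝒜} (hT : 0 ≤ T) : 1 - resolv T = T * resolv T := by
  have := mul_resolv_cancel hT
  rw [add_mul, one_mul] at this
  rw [← this]; abel

lemma one_sub_resolv_le {T : 𝒜} (hT : 0 ≤ T) : 1 - resolv T ≤ T := by
  have hs := (IsSelfAdjoint.of_nonneg hT).star_eq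
  have h1 : T - (1 - resolv T) = star T * resolv T * T := by
    have hc : Commute T (resolv T) := commute_resolv hT (Commute.refl T)
    have h2 : T * (1 - resolv T) = T * resolv T * T := by
      rw [one_sub_resolv hT, mul_assoc, hc.eq]
    rw [hs, ← h2, mul_sub, mul_one, one_sub_resolv hT]
  rw [← sub_nonneg, h1]
  exact star_left_conjugate_nonneg (resolv_nonneg hT) T

lemma exists_eq_star_mul_self_of_nonneg {T : 𝒜} (hT : 0 ≤ T) : ∃ N, T = star N * N :=
  CStarAlgebra.nonneg_iff_eq_star_mul_self.1 hT

end CStarLemmas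

section Weighted

variable {A B : Type*} [CStarAlgebra A] [PartialOrder A] [StarOrderedRing A]
  [CStarAlgebra B] [PartialOrder B] [StarOrderedRing B]
  {ι κ : Type} [Fintype ι] [DecidableEq ι] [Fintype κ] [DecidableEq κ]

/-- The matrix over a C*-algebra with given entries. -/
def cmat {m n R : Type*} (f : m → n → R) : CStarMatrix m n R := f

@[simp] lemma cmat_apply {m n R : Type*} (f : m → n → R) (i : m) (j : n) :
    cmat f i j = f i j := rfl

/-- The weighted amplification `∑ᵢⱼ sᵢ sⱼ u(Xᵢⱼ, Yᵢⱼ)` of a bilinear form. -/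
noncomputable def wform (u : A →ₗ[ℂ] B →ₗ[ℂ] ℂ) (s : ι → ℝ) :
    CStarMatrix ι ι A →ₗ[ℂ] CStarMatrix ι ι B →ₗ[ℂ] ℂ :=
  LinearMap.mk₂ ℂ (fun X Y => ∑ i, ∑ j, ((s i : ℂ) * (s j : ℂ)) * u (X i j) (Y i j))
    (by intro X X' Y; simp [mul_add, Finset.sum_add_distrib])
    (by intro c X Y; simp [Finset.mul_sum]; congr! 2; ring)
    (by intro X Y Y'; simp [mul_add, Finset.sum_add_distrib])
    (by intro c X Y; simp [Finset.mul_sum]; congr! 2; ring)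

omit [DecidableEq ι] [PartialOrder A] [StarOrderedRing A] [PartialOrder B] [StarOrderedRing B] in
lemma wform_apply (u : A →ₗ[ℂ] B →ₗ[ℂ] ℂ) (s : ι → ℝ) (X : CStarMatrix ι ι A)
    (Y : CStarMatrix ι ι B) :
    wform u s X Y = ∑ i, ∑ j, ((s i : ℂ) * (s j : ℂ)) * u (X i j) (Y i j) := rfl

/-- The weighted diagonal sum `∑ᵢ sᵢ² Mᵢᵢ`. -/
noncomputable def wdiag (s : ι → ℝ) : CStarMatrix ι ι A →ₗ[ℂ] A where
  toFun M := ∑ i, ((s i : ℂ) ^ 2) • M i i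
  map_add' M N := by simp [Finset.sum_add_distrib]
  map_smul' c M := by simp [Finset.smul_sum, smul_comm c]

omit [DecidableEq ι] [PartialOrder A] [StarOrderedRing A] in
lemma wdiag_apply (s : ι → ℝ) (M : CStarMatrix ι ι A) :
    wdiag s M = ∑ i, ((s i : ℂ) ^ 2) • M i i := rfl

/-- The amplification `v ↦ v ⊗ 1`. -/
noncomputable def ampL (κ : Type) [Fintype κ] [DecidableEq κ] :
    CStarMatrix ι ι A →⋆ₐ[ℂ] CStarMatrix (ι × κ) (ι × κ) A where
  toFun v := cmat fun p q => if p.2 = q.2 then v p.1 q.1 else 0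
  map_one' := by
    ext ⟨a, b⟩ ⟨c, d⟩
    simp [CStarMatrix.one_apply, Prod.ext_iff]
    split_ifs <;> simp_all
  map_mul' v w := by
    ext ⟨a, b⟩ ⟨c, d⟩
    simp [CStarMatrix.mul_apply, Fintype.sum_prod_type]
  map_zero' := by ext ⟨a, b⟩ ⟨c, d⟩; simp
  map_add' v w := by
    ext ⟨a, b⟩ ⟨c, d⟩
    simp only [cmat_apply, CStarMatrix.add_apply]
    split_ifs <;> simp
  commutes' r := by
    ext ⟨a, b⟩ ⟨c, d⟩
    simp [CStarMatrix.algebraMap_apply, Prod.ext_iff]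
    split_ifs <;> simp_all
  map_star' v := by
    ext ⟨a, b⟩ ⟨c, d⟩
    simp only [cmat_apply, CStarMatrix.star_apply, eq_comm (a := b)]
    split_ifs <;> simp

/-- The amplification `h ↦ 1 ⊗ h`. -/
noncomputable def ampR (κ : Type) [Fintype κ] [DecidableEq κ] :
    CStarMatrix ι ι A →⋆ₐ[ℂ] CStarMatrix (κ × ι) (κ × ι) A where
  toFun v := cmat fun p q => if p.1 = q.1 then v p.2 q.2 else 0
  map_one' := by
    ext ⟨a, b⟩ ⟨c, d⟩
    simp [CStarMatrix.one_apply, Prod.ext_iff]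
    split_ifs <;> simp_all
  map_mul' v w := by
    ext ⟨a, b⟩ ⟨c, d⟩
    simp [CStarMatrix.mul_apply, Fintype.sum_prod_type]
  map_zero' := by ext ⟨a, b⟩ ⟨c, d⟩; simp
  map_add' v w := by
    ext ⟨a, b⟩ ⟨c, d⟩
    simp only [cmat_apply, CStarMatrix.add_apply]
    split_ifs <;> simp
  commutes' r := by
    ext ⟨a, b⟩ ⟨c, d⟩
    simp [CStarMatrix.algebraMap_apply, Prod.ext_iff]
    split_ifs <;> simp_all
  map_star' v := by
    ext ⟨a, b⟩ ⟨c, d⟩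
    simp only [cmat_apply, CStarMatrix.star_apply, eq_comm (a := a)]
    split_ifs <;> simp

/-- The diagonal amplification `m ↦ m ⊗ 1`. -/
noncomputable def ampD (ι : Type) [Fintype ι] [DecidableEq ι] :
    A →⋆ₐ[ℂ] CStarMatrix ι ι A where
  toFun m := cmat fun p q => if p = q then m else 0
  map_one' := by ext a b; simp [CStarMatrix.one_apply]
  map_mul' v w := by ext a b; simp [CStarMatrix.mul_apply]
  map_zero' := by ext a b; simp
  map_add' v w := by
    ext a b
    simp only [cmat_apply, CStarMatrix.add_apply]
    split_ifs <;> simp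
  commutes' r := by
    ext a b
    simp [CStarMatrix.algebraMap_apply]
  map_star' v := by
    ext a b
    simp only [cmat_apply, CStarMatrix.star_apply, eq_comm (a := a)]
    split_ifs <;> simp

omit [PartialOrder A] [StarOrderedRing A] in
lemma ampL_apply (v : CStarMatrix ι ι A) (p q : ι × κ) :
    ampL κ v p q = if p.2 = q.2 then v p.1 q.1 else 0 := rfl

omit [PartialOrder A] [StarOrderedRing A] in
lemma ampR_apply (v : CStarMatrix ι ι A) (p q : κ × ι) :
    ampR κ v p q = if p.1 = q.1 then v p.2 q.2 else 0 := rfl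

omit [PartialOrder A] [StarOrderedRing A] in
lemma ampD_apply (m : A) (p q : ι) : ampD ι m p q = if p = q then m else 0 := rfl

omit [PartialOrder A] [StarOrderedRing A] in
lemma ampD_mul_apply (m : A) (M : CStarMatrix ι ι A) (i j : ι) :
    (ampD ι m * M) i j = m * M i j := by
  simp [CStarMatrix.mul_apply, ampD_apply]

omit [PartialOrder A] [StarOrderedRing A] in
lemma mul_ampD_apply (m : A) (M : CStarMatrix ι ι A) (i j : ι) :
    (M * ampD ι m) i j = M i j * m := by
  simp [CStarMatrix.mul_apply, ampD_apply]

omit [PartialOrder A] [StarOrderedRing A] [PartialOrder B] [StarOrderedRing B] in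
lemma wform_ampL_ampL (u : A →ₗ[ℂ] B →ₗ[ℂ] ℂ) (s : ι → ℝ) (t : κ → ℝ) (ht : ∑ k, t k ^ 2 = 1)
    (v : CStarMatrix ι ι A) (w : CStarMatrix ι ι B) :
    wform u (fun p : ι × κ => s p.1 * t p.2) (ampL κ v) (ampL κ w) = wform u s v w := by
  have ht' : ∑ k, (t k : ℂ) ^ 2 = 1 := by exact_mod_cast ht
  simp only [wform_apply, Fintype.sum_prod_type, ampL_apply]
  refine Finset.sum_congr rfl fun i _ => ?_
  rw [Finset.sum_comm]
  refine Finset.sum_congr rfl fun j _ => ?_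
  rw [← one_mul (_ * _ * _), ← ht', Finset.sum_mul]
  refine Finset.sum_congr rfl fun k _ => ?_
  rw [Finset.sum_eq_single k]
  · simp; ring
  · intro l _ hl; simp [hl.symm]
  · simp

omit [PartialOrder A] [StarOrderedRing A] [PartialOrder B] [StarOrderedRing B] in
lemma wform_ampR_ampR (u : A →ₗ[ℂ] B →ₗ[ℂ] ℂ) (s : ι → ℝ) (t : κ → ℝ) (ht : ∑ k, t k ^ 2 = 1)
    (v : CStarMatrix ι ι A) (w : CStarMatrix ι ι B) :
    wform u (fun p : κ × ι => t p.1 * s p.2) (ampR κ v) (ampR κ w) = wform u s v w := by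
  have ht' : ∑ k, (t k : ℂ) ^ 2 = 1 := by exact_mod_cast ht
  simp only [wform_apply, Fintype.sum_prod_type, ampR_apply]
  rw [Finset.sum_comm]
  refine Finset.sum_congr rfl fun i _ => ?_
  have h1 : ∀ k : κ, ∑ l : κ, ∑ j : ι, ((t k * s i : ℝ) : ℂ) * ((t l * s j : ℝ) : ℂ) *
      u (if k = l then v i j else 0) (if k = l then w i j else 0)
      = (t k : ℂ) ^ 2 * ∑ j, (s i : ℂ) * (s j : ℂ) * u (v i j) (w i j) := by
    intro k
    rw [Finset.sum_eq_single k, Finset.mul_sum]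
    · refine Finset.sum_congr rfl fun j _ => ?_
      simp; ring
    · intro l _ hl; simp [hl.symm]
    · simp
  simp only [h1]
  rw [← Finset.sum_mul, ht', one_mul]

omit [PartialOrder A] [StarOrderedRing A] [PartialOrder B] [StarOrderedRing B] in
lemma wform_ampL_ampR_mul (u : A →ₗ[ℂ] B →ₗ[ℂ] ℂ) (s : ι → ℝ) (t : κ → ℝ)
    (v : CStarMatrix ι ι A) (w : CStarMatrix ι ι B) (p : CStarMatrix κ κ B) :
    wform u (fun p : ι × κ => s p.1 * t p.2) (ampL κ v) (ampR ι p * ampL κ w)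
      = wform u s v (ampD ι (wdiag t p) * w) := by
  have e1 : ∀ x y : ι × κ, (ampR ι p * ampL κ w) x y = p x.2 y.2 * w x.1 y.1 := by
    rintro ⟨a, b⟩ ⟨c, d⟩
    simp [CStarMatrix.mul_apply, Fintype.sum_prod_type, ampR_apply, ampL_apply]
  have e2 : ∀ i j : ι, (ampD ι (wdiag t p) * w) i j = ∑ k, ((t k : ℂ) ^ 2) • (p k k * w i j) := by
    intro i j
    rw [ampD_mul_apply, wdiag_apply, Finset.sum_mul]
    simp
  simp only [wform_apply, Fintype.sum_prod_type, ampL_apply, e1, e2, map_sum, map_smul,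
    smul_eq_mul, Finset.mul_sum]
  refine Finset.sum_congr rfl fun i _ => ?_
  rw [Finset.sum_comm]
  refine Finset.sum_congr rfl fun j _ => ?_
  refine Finset.sum_congr rfl fun k _ => ?_
  rw [Finset.sum_eq_single k]
  · simp; ring
  · intro l _ hl; simp [hl.symm]
  · simp

omit [PartialOrder A] [StarOrderedRing A] [PartialOrder B] [StarOrderedRing B] in
lemma wform_ampL_mul_ampR (u : A →ₗ[ℂ] B →ₗ[ℂ] ℂ) (s : ι → ℝ) (t : κ → ℝ)
    (v : CStarMatrix ι ι A) (w : CStarMatrix ι ι B) (p : CStarMatrix κ κ B) :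
    wform u (fun p : ι × κ => s p.1 * t p.2) (ampL κ v) (ampL κ w * ampR ι p)
      = wform u s v (w * ampD ι (wdiag t p)) := by
  have e1 : ∀ x y : ι × κ, (ampL κ w * ampR ι p) x y = w x.1 y.1 * p x.2 y.2 := by
    rintro ⟨a, b⟩ ⟨c, d⟩
    simp [CStarMatrix.mul_apply, Fintype.sum_prod_type, ampR_apply, ampL_apply]
  have e2 : ∀ i j : ι, (w * ampD ι (wdiag t p)) i j = ∑ k, ((t k : ℂ) ^ 2) • (w i j * p k k) := by
    intro i j
    rw [mul_ampD_apply, wdiag_apply, Finset.mul_sum]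
    simp
  simp only [wform_apply, Fintype.sum_prod_type, ampL_apply, e1, e2, map_sum, map_smul,
    smul_eq_mul, Finset.mul_sum]
  refine Finset.sum_congr rfl fun i _ => ?_
  rw [Finset.sum_comm]
  refine Finset.sum_congr rfl fun j _ => ?_
  refine Finset.sum_congr rfl fun k _ => ?_
  rw [Finset.sum_eq_single k]
  · simp; ring
  · intro l _ hl; simp [hl.symm]
  · simp

end Weighted

section Sandwich

variable {A B : Type*} [CStarAlgebra A] [PartialOrder A] [StarOrderedRing A]
  [CStarAlgebra B] [PartialOrder B] [StarOrderedRing B]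
  {ι κ : Type} [Fintype ι] [DecidableEq ι] [Fintype κ] [DecidableEq κ]

lemma wdiag_nonneg (s : ι → ℝ) {M : CStarMatrix ι ι A} (hM : 0 ≤ M) : 0 ≤ wdiag s M := by
  obtain ⟨N, rfl⟩ := exists_eq_star_mul_self_of_nonneg hM
  rw [wdiag_apply]
  refine Finset.sum_nonneg fun i _ => ?_
  rw [CStarMatrix.mul_apply, Finset.smul_sum]
  refine Finset.sum_nonneg fun j _ => ?_
  have : ((s i : ℂ) ^ 2) • (star N i j * N j i)
      = star ((s i : ℂ) • N j i) * ((s i : ℂ) • N j i) := by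
    rw [star_smul, smul_mul_smul_comm, CStarMatrix.star_apply, pow_two]
    simp
  rw [this]
  exact star_mul_self_nonneg _

lemma wdiag_mono (s : ι → ℝ) {M N : CStarMatrix ι ι A} (h : M ≤ N) : wdiag s M ≤ wdiag s N := by
  rw [← sub_nonneg, ← map_sub]
  exact wdiag_nonneg s (sub_nonneg.2 h)

lemma norm_wdiag_mono (s : ι → ℝ) {M N : CStarMatrix ι ι A} (h0 : 0 ≤ M) (h : M ≤ N) :
    ‖wdiag s M‖ ≤ ‖wdiag s N‖ :=
  CStarAlgebra.norm_le_norm_of_nonneg_of_le (wdiag_nonneg s h0) (wdiag_mono s h)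

/-- All weighted amplifications of `u` with unit weights are bounded by `J`. -/
def WBound (u : A →ₗ[ℂ] B →ₗ[ℂ] ℂ) (J : ℝ) : Prop :=
  ∀ (ι : Type) [Fintype ι] [DecidableEq ι] (s : ι → ℝ), ∑ i, s i ^ 2 = 1 →
    ∀ (X : CStarMatrix ι ι A) (Y : CStarMatrix ι ι B), ‖wform u s X Y‖ ≤ J * ‖X‖ * ‖Y‖

/-- `J` is the supremum of the real parts of weighted amplifications at contractions. -/
def IsWSup (u : A →ₗ[ℂ] B →ₗ[ℂ] ℂ) (J : ℝ) : Prop :=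
  WBound u J ∧ ∀ ε > 0, ∃ (ι : Type) (_ : Fintype ι) (_ : DecidableEq ι) (s : ι → ℝ)
    (X : CStarMatrix ι ι A) (Y : CStarMatrix ι ι B), ∑ i, s i ^ 2 = 1 ∧ ‖X‖ ≤ 1 ∧ ‖Y‖ ≤ 1 ∧
      J - ε < (wform u s X Y).re

lemma exists_phase (z : ℂ) : ∃ c : ℂ, ‖c‖ = 1 ∧ c * z = ‖z‖ := by
  by_cases hz : z = 0
  · exact ⟨1, by simp [hz]⟩
  · refine ⟨(‖z‖ : ℂ) / z, ?_, ?_⟩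
    · rw [norm_div]
      simp [hz]
    · field_simp

lemma WBound.exists_isWSup {u : A →ₗ[ℂ] B →ₗ[ℂ] ℂ} {J : ℝ} (hJ0 : 0 ≤ J) (hJ : WBound u J) :
    ∃ J₀, 0 ≤ J₀ ∧ J₀ ≤ J ∧ IsWSup u J₀ := by
  set S : Set ℝ := {K | 0 ≤ K ∧ WBound u K} with hS
  have hbdd : BddBelow S := ⟨0, fun K hK => hK.1⟩
  have hne : S.Nonempty := ⟨J, hJ0, hJ⟩
  have h0 : 0 ≤ sInf S := le_csInf hne fun K hK => hK.1
  refine ⟨sInf S, h0, csInf_le hbdd ⟨hJ0, hJ⟩, ?_, ?_⟩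
  · intro ι _ _ s hs X Y
    rw [mul_assoc]
    refine le_of_forall_pos_le_add fun ε hε => ?_
    have hpos : 0 < ‖X‖ * ‖Y‖ + 1 := by positivity
    obtain ⟨K, hK, hlt⟩ := exists_lt_of_csInf_lt hne
      (lt_add_of_pos_right (sInf S) (div_pos hε hpos))
    have h1 := hK.2 ι s hs X Y
    rw [mul_assoc] at h1
    refine h1.trans ?_
    calc K * (‖X‖ * ‖Y‖) ≤ (sInf S + ε / (‖X‖ * ‖Y‖ + 1)) * (‖X‖ * ‖Y‖) := by gcongr
      _ = sInf S * (‖X‖ * ‖Y‖) + ε * ((‖X‖ * ‖Y‖) / (‖X‖ * ‖Y‖ + 1)) := by ring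
      _ ≤ sInf S * (‖X‖ * ‖Y‖) + ε * 1 := by
        gcongr
        rw [div_le_one hpos]
        linarith
      _ = _ := by ring
  · intro ε hε
    by_cases hc : sInf S - ε < 0
    · refine ⟨Unit, inferInstance, inferInstance, fun _ => 1, 0, 0, by simp, by simp, by simp, ?_⟩
      simpa using hc
    · push Not at hc
      have hnot : ¬ WBound u (sInf S - ε) := fun h => by
        have := csInf_le hbdd (show sInf S - ε ∈ S from ⟨hc, h⟩)
        linarith
      simp only [WBound, not_forall, not_le] at hnot
      obtain ⟨ι, i1, i2, s, hs, X, Y, h⟩ := hnot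
      have hX : X ≠ 0 := by rintro rfl; simp at h
      have hY : Y ≠ 0 := by rintro rfl; simp at h
      have hX' : 0 < ‖X‖ := norm_pos_iff.2 hX
      have hY' : 0 < ‖Y‖ := norm_pos_iff.2 hY
      obtain ⟨c, hc1, hc2⟩ := exists_phase (wform u s X Y)
      refine ⟨ι, i1, i2, s, (c * (‖X‖ : ℂ)⁻¹) • X, ((‖Y‖ : ℂ)⁻¹) • Y, hs, ?_, ?_, ?_⟩
      · rw [norm_smul, norm_mul, hc1]
        simp [hX'.ne']
      · rw [norm_smul]
        simp [hY'.ne']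
      · have : wform u s ((c * (‖X‖ : ℂ)⁻¹) • X) (((‖Y‖ : ℂ)⁻¹) • Y)
            = ((‖X‖⁻¹ * ‖Y‖⁻¹ * ‖wform u s X Y‖ : ℝ) : ℂ) := by
          simp only [map_smul, LinearMap.smul_apply, smul_eq_mul]
          push_cast
          rw [← hc2]; ring
        rw [this, Complex.ofReal_re]
        rw [← mul_inv, ← div_eq_inv_mul, lt_div_iff₀ (by positivity), ← mul_assoc]
        exact h

omit [DecidableEq ι] [DecidableEq κ] in
lemma sum_prod_sq_eq_one {s : ι → ℝ} {t : κ → ℝ} (hs : ∑ i, s i ^ 2 = 1) (ht : ∑ k, t k ^ 2 = 1) :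
    ∑ p : ι × κ, (s p.1 * t p.2) ^ 2 = 1 := by
  simp only [Fintype.sum_prod_type, mul_pow, ← Finset.mul_sum, ht, mul_one, hs]

lemma norm_one_sub_smul_le {𝒜 : Type*} [CStarAlgebra 𝒜] [PartialOrder 𝒜] [StarOrderedRing 𝒜]
    {p : 𝒜} (h0 : 0 ≤ p) (h1 : p ≤ 1) {ω : ℂ} (hω : ω + star ω = 1) (hω' : ω * star ω = 1) :
    ‖1 - ω • p‖ ≤ 1 := by
  have hs := (IsSelfAdjoint.of_nonneg h0).star_eq
  rw [norm_le_one_iff_star_mul_le_one]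
  have key : star (1 - ω • p) * (1 - ω • p) = 1 - p * (1 - p) := by
    have e : star ω • p = p - ω • p := by
      rw [eq_sub_iff_add_eq, ← add_smul, add_comm, hω, one_smul]
    have e' : (p * p - ω • (p * p)) = star ω • (p * p) := by
      rw [sub_eq_iff_eq_add, ← add_smul, add_comm, hω, one_smul]
    have e'' : ω • (p * p) - ω • ω • (p * p) = p * p := by
      rw [← smul_sub, e', smul_smul, hω', one_smul]
    rw [star_sub, star_smul, star_one, hs, e]
    simp only [mul_sub, sub_mul, mul_one, one_mul, smul_mul_assoc, mul_smul_comm, smul_sub]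
    nth_rw 3 [← e'']
    abel
  rw [key]
  refine sub_le_self _ ?_
  have h2 := star_left_conjugate_nonneg h0 (1 - p)
  have h3 := star_left_conjugate_nonneg (sub_nonneg.2 h1) p
  have h4 : p * (1 - p) = star (1 - p) * p * (1 - p) + star p * (1 - p) * p := by
    simp only [star_sub, star_one, hs]; noncomm_ring
  rw [h4]
  exact add_nonneg h2 h3

end Sandwich

section AbstractForms

variable {𝒜 ℬ : Type*} [CStarAlgebra 𝒜] [PartialOrder 𝒜] [StarOrderedRing 𝒜]
  [CStarAlgebra ℬ] [PartialOrder ℬ] [StarOrderedRing ℬ]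

lemma re_functional_corner_ge {f : ℬ →ₗ[ℂ] ℂ} {J : ℝ} (hf : ∀ y, ‖y‖ ≤ 1 → ‖f y‖ ≤ J) {W p r : ℬ}
    (hW : ‖W‖ ≤ 1) (hp0 : 0 ≤ p) (hp1 : p ≤ 1) (hr0 : 0 ≤ r) (hr1 : r ≤ 1) :
    3 * (f W).re - 2 * J - 2 * ‖f (p * W)‖ - 2 * ‖f (W * r)‖ ≤ (f ((1 - p) * W * (1 - r))).re := by
  set ω : ℂ := ⟨1 / 2, √3 / 2⟩ with hω
  have h3 : √3 * √3 = 3 := Real.mul_self_sqrt (by norm_num)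
  have w1 : ω + star ω = 1 := by apply Complex.ext <;> simp [hω]; norm_num
  have w2 : ω * star ω = 1 := by
    apply Complex.ext <;> simp [hω]
    · nlinarith
    · ring
  have w1' : star ω + star (star ω) = 1 := by rw [star_star, add_comm, w1]
  have w2' : star ω * star (star ω) = 1 := by rw [star_star, mul_comm, w2]
  have w3 : ω ^ 2 + star ω ^ 2 = -1 := by
    linear_combination (ω + star ω + 1) * w1 - 2 * w2
  have hb : ∀ ν : ℂ, ν + star ν = 1 → ν * star ν = 1 →
      ‖f ((1 - ν • p) * W * (1 - ν • r))‖ ≤ J := by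
    intro ν h1 h2
    refine hf _ ((norm_mul_le _ _).trans ?_)
    refine mul_le_one₀ ((norm_mul_le _ _).trans ?_) (norm_nonneg _)
      (norm_one_sub_smul_le hr0 hr1 h1 h2)
    exact mul_le_one₀ (norm_one_sub_smul_le hp0 hp1 h1 h2) (norm_nonneg _) hW
  have e : ∀ ν : ℂ, f ((1 - ν • p) * W * (1 - ν • r))
      = f W - ν * (f (p * W) + f (W * r)) + ν ^ 2 * f (p * W * r) := by
    intro ν
    simp only [sub_mul, mul_sub, one_mul, mul_one, smul_mul_assoc, mul_smul_comm, map_sub,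
      map_smul, smul_eq_mul]
    ring
  have hsum : f ((1 - ω • p) * W * (1 - ω • r)) + f ((1 - star ω • p) * W * (1 - star ω • r))
      = 2 * f W - (f (p * W) + f (W * r)) - f (p * W * r) := by
    rw [e, e]
    linear_combination -(f (p * W) + f (W * r)) * w1 + f (p * W * r) * w3
  have hle : (2 * f W - (f (p * W) + f (W * r)) - f (p * W * r)).re ≤ 2 * J := by
    rw [← hsum]
    refine (Complex.re_le_norm _).trans ((norm_add_le _ _).trans ?_)
    have := hb ω w1 w2
    have := hb (star ω) w1' w2'
    linarith
  have e1 : f ((1 - p) * W * (1 - r)) = f W - (f (p * W) + f (W * r)) + f (p * W * r) := by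
    have := e 1
    simpa using this
  rw [e1]
  have hB := Complex.re_le_norm (f (p * W))
  have hC := Complex.re_le_norm (f (W * r))
  simp only [Complex.sub_re, Complex.add_re, Complex.mul_re, Complex.re_ofNat,
    Complex.im_ofNat] at *
  linarith

omit [PartialOrder ℬ] [StarOrderedRing ℬ] in
lemma norm_form_average_le {Ω : 𝒜 →ₗ[ℂ] ℬ →ₗ[ℂ] ℂ} {J : ℝ}
    (hΩ : ∀ x y, ‖Ω x y‖ ≤ J * ‖x‖ * ‖y‖) (hJ : 0 ≤ J) {V H : 𝒜} {M K : ℬ} (hV : ‖V‖ ≤ 1)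
    (hH : ‖H‖ ≤ 1) (hMK : ∀ ζ : ℂ, ‖ζ‖ = 1 → ‖M + ζ • K‖ ≤ 1) (σ : ℝ) :
    ‖Ω V M + σ * Ω H K‖ ≤ J * (1 + 5 / 2 * σ ^ 2) := by
  set G := V * star H * V with hG
  have hx : ∀ ζ : ℂ, ‖ζ‖ = 1 → ‖V + (σ : ℂ) • (star ζ • H - ζ • G)‖ ≤ 1 + 5 / 2 * σ ^ 2 := by
    intro ζ hζ
    have h1 := norm_perturb_sq_le hV (H := star ζ • H)
      (by rw [norm_smul, norm_star, hζ, one_mul]; exact hH) σ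
    have h2 : V + σ • (star ζ • H - V * star (star ζ • H) * V)
        = V + (σ : ℂ) • (star ζ • H - ζ • G) := by
      rw [star_smul, star_star, mul_smul_comm, smul_mul_assoc, hG, Complex.coe_smul]
    rw [h2] at h1
    refine abs_le_of_sq_le_sq' ?_ (by positivity) |>.2
    nlinarith [sq_nonneg (σ ^ 2)]
  have hb : ∀ ζ : ℂ, ‖ζ‖ = 1 → ‖Ω (V + (σ : ℂ) • (star ζ • H - ζ • G)) (M + ζ • K)‖
      ≤ J * (1 + 5 / 2 * σ ^ 2) := by
    intro ζ hζ
    refine (hΩ _ _).trans ?_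
    calc J * ‖V + (σ : ℂ) • (star ζ • H - ζ • G)‖ * ‖M + ζ • K‖
        ≤ J * (1 + 5 / 2 * σ ^ 2) * 1 := by gcongr; exacts [hx ζ hζ, hMK ζ hζ]
      _ = _ := mul_one _
  have e : ∀ ζ : ℂ, Ω (V + (σ : ℂ) • (star ζ • H - ζ • G)) (M + ζ • K)
      = Ω V M + ζ * Ω V K + σ * star ζ * Ω H M + σ * (ζ * star ζ) * Ω H K - σ * ζ * Ω G M
        - σ * ζ ^ 2 * Ω G K := by
    intro ζ
    simp only [map_add, map_sub, map_smul, LinearMap.add_apply, LinearMap.sub_apply,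
      LinearMap.smul_apply, smul_eq_mul]
    ring
  have hsum : (4 : ℂ) * (Ω V M + σ * Ω H K)
      = Ω (V + (σ : ℂ) • (star (1 : ℂ) • H - (1 : ℂ) • G)) (M + (1 : ℂ) • K)
      + Ω (V + (σ : ℂ) • (star (-1 : ℂ) • H - (-1 : ℂ) • G)) (M + (-1 : ℂ) • K)
      + Ω (V + (σ : ℂ) • (star Complex.I • H - Complex.I • G)) (M + Complex.I • K)
      + Ω (V + (σ : ℂ) • (star (-Complex.I) • H - (-Complex.I) • G)) (M + (-Complex.I) • K) := by
    rw [e, e, e, e]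
    have hI : star Complex.I = -Complex.I := Complex.conj_I
    simp only [star_one, star_neg, hI]
    linear_combination (2 * σ * Ω H K + 2 * σ * Ω G K) * Complex.I_sq
  have hn : 4 * ‖Ω V M + σ * Ω H K‖ ≤ 4 * (J * (1 + 5 / 2 * σ ^ 2)) := by
    have : 4 * ‖Ω V M + σ * Ω H K‖ = ‖(4 : ℂ) * (Ω V M + σ * Ω H K)‖ := by simp
    rw [this, hsum]
    refine (norm_add_le _ _).trans ?_
    have h1 := (norm_add₃_le (a := Ω (V + (σ : ℂ) • (star (1 : ℂ) • H - (1 : ℂ) • G))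
            (M + (1 : ℂ) • K))
      (b := Ω (V + (σ : ℂ) • (star (-1 : ℂ) • H - (-1 : ℂ) • G)) (M + (-1 : ℂ) • K))
      (c := Ω (V + (σ : ℂ) • (star Complex.I • H - Complex.I • G)) (M + Complex.I • K)))
    have b1 := hb 1 (by simp)
    have b2 := hb (-1) (by simp)
    have b3 := hb Complex.I (by simp)
    have b4 := hb (-Complex.I) (by simp)
    linarith
  linarith

end AbstractForms

section Sandwich

variable {A B : Type*} [CStarAlgebra A] [PartialOrder A] [StarOrderedRing A]
  [CStarAlgebra B] [PartialOrder B] [StarOrderedRing B]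
  {ι : Type} [Fintype ι] [DecidableEq ι]

theorem IsWSup.wform_sandwich_le {u : A →ₗ[ℂ] B →ₗ[ℂ] ℂ} {J : ℝ} (hJ0 : 0 ≤ J) (hJ : IsWSup u J)
    {s : ι → ℝ} (hs : ∑ i, s i ^ 2 = 1) {h : CStarMatrix ι ι A} (hh : ‖h‖ ≤ 1)
    {g P Q : CStarMatrix ι ι B} (hg : ‖g‖ ≤ 1) (hP : IsSelfAdjoint P) (hQ : IsSelfAdjoint Q)
    {σ : ℝ} (hσ0 : 0 < σ) (hσ : ‖wdiag s (P * P)‖ + ‖wdiag s (Q * Q)‖ ≤ σ ^ 2) :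
    ‖wform u s h (P * resolv (P * P) * g * (Q * resolv (Q * Q)))‖ ≤ 5 * J * σ := by
  have hPP : 0 ≤ P * P := by simpa [hP.star_eq] using star_mul_self_nonneg P
  have hQQ : 0 ≤ Q * Q := by simpa [hQ.star_eq] using star_mul_self_nonneg Q
  set a := resolv (P * P) with ha
  set c := resolv (Q * Q) with hc
  have hac : Commute P a := commute_resolv hPP ((Commute.refl P).mul_right (Commute.refl P))
  have hsa : star a = a := star_resolv hPP
  have hsc : star c = c := star_resolv hQQ
  have hcc : Commute Q c := commute_resolv hQQ ((Commute.refl Q).mul_right (Commute.refl Q))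
  have hab : a * star a + (P * a) * star (P * a) ≤ 1 := by
    have : a * star a + (P * a) * star (P * a) = a := by
      rw [star_mul, hsa, hP.star_eq]
      calc a * a + P * a * (a * P) = (a + P * P * a) * a := by
            rw [mul_assoc P a, ← hac.eq, add_mul, ← mul_assoc a P a, ← hac.eq]
            simp only [mul_assoc]
        _ = (1 + P * P) * a * a := by noncomm_ring
        _ = a := by rw [mul_resolv_cancel hPP, one_mul]
    rw [this]; exact resolv_le_one hPP
  have hcd : star c * c + star (Q * c) * (Q * c) ≤ 1 := by
    have : star c * c + star (Q * c) * (Q * c) = c := by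
      rw [star_mul, hsc, hQ.star_eq]
      calc c * c + c * Q * (Q * c) = c * ((1 + Q * Q) * c) := by noncomm_ring
        _ = c := by rw [mul_resolv_cancel hQQ, mul_one]
    rw [this]; exact resolv_le_one hQQ
  set k := P * a * g * (Q * c) with hk
  -- choose the phase of `h`
  obtain ⟨θ, hθ1, hθ2⟩ := exists_phase (wform u s h k)
  suffices hsuff : ∀ ε > 0, σ * ‖wform u s h k‖ ≤ 9 / 2 * J * σ ^ 2 + 3 * ε by
    have h1 : σ * ‖wform u s h k‖ ≤ 9 / 2 * J * σ ^ 2 := by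
      refine le_of_forall_pos_le_add fun ε hε => ?_
      have := hsuff (ε / 3) (by positivity)
      linarith
    have h2 : σ * ‖wform u s h k‖ ≤ σ * (5 * J * σ) := by nlinarith [mul_nonneg hJ0 (sq_nonneg σ)]
    exact le_of_mul_le_mul_left h2 hσ0
  intro ε hε
  obtain ⟨ι₀, _, _, s₀, v, w, hs₀, hv, hw, hvw⟩ := hJ.2 ε hε
  set Ω := wform u (fun p : ι₀ × ι => s₀ p.1 * s p.2) with hΩdef
  have hΩ : ∀ x y, ‖Ω x y‖ ≤ J * ‖x‖ * ‖y‖ := hJ.1 _ _ (sum_prod_sq_eq_one hs₀ hs)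
  set V := ampL (A := A) ι v
  set W := ampL (A := B) ι w
  set R := ampR (ι := ι) (A := B) ι₀ with hR
  have hV : ‖V‖ ≤ 1 := (NonUnitalStarAlgHom.norm_apply_le _ v).trans hv
  have hW : ‖W‖ ≤ 1 := (NonUnitalStarAlgHom.norm_apply_le _ w).trans hw
  have hH : ‖ampR ι₀ (θ • h)‖ ≤ 1 := by
    refine (NonUnitalStarAlgHom.norm_apply_le _ _).trans ?_
    rw [norm_smul, hθ1, one_mul]; exact hh
  have hRmono : ∀ {x y : CStarMatrix ι ι B}, x ≤ y → R x ≤ R y := fun hxy =>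
    OrderHomClass.mono R hxy
  have hMK : ∀ ζ : ℂ, ‖ζ‖ = 1 → ‖R a * W * R c + ζ • R k‖ ≤ 1 := by
    intro ζ hζ
    have e : ζ • R k = R (P * a) * (ζ • R g) * R (Q * c) := by
      simp only [hk, map_mul, mul_smul_comm, smul_mul_assoc]
    rw [e]
    refine norm_sandwich_add_sandwich_le_one ?_ ?_ hW ?_
    · have := hRmono hab
      simpa only [map_add, map_mul, map_star, map_one] using this
    · have := hRmono hcd
      simpa only [map_add, map_mul, map_star, map_one] using this
    · rw [norm_smul, hζ, one_mul]
      exact (NonUnitalStarAlgHom.norm_apply_le _ g).trans hg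
  have key := norm_form_average_le hΩ hJ0 hV hH hMK σ
  have hHK : Ω (ampR ι₀ (θ • h)) (R k) = (‖wform u s h k‖ : ℂ) := by
    rw [hΩdef, wform_ampR_ampR u s s₀ hs₀, map_smul, LinearMap.smul_apply, smul_eq_mul, hθ2]
  rw [hHK] at key
  have ha1 : R a = 1 - R (1 - a) := by rw [map_sub, map_one]; abel
  have hc1 : R c = 1 - R (1 - c) := by rw [map_sub, map_one]; abel
  have corner := re_functional_corner_ge (f := Ω V) (J := J) (W := W) (p := R (1 - a))
    (r := R (1 - c)) (fun y hy => (hΩ V y).trans (by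
      calc J * ‖V‖ * ‖y‖ ≤ J * 1 * 1 := by gcongr
        _ = J := by ring)) hW
    (by have := hRmono (sub_nonneg.2 (resolv_le_one hPP)); rwa [map_zero] at this)
    (by have := hRmono (sub_le_self 1 (resolv_nonneg hPP)); rwa [map_one] at this)
    (by have := hRmono (sub_nonneg.2 (resolv_le_one hQQ)); rwa [map_zero] at this)
    (by have := hRmono (sub_le_self 1 (resolv_nonneg hQQ)); rwa [map_one] at this)
  rw [← ha1, ← hc1] at corner
  have hA : Ω V W = wform u s₀ v w := wform_ampL_ampL u s₀ s hs v w
  have hB : ‖Ω V (R (1 - a) * W)‖ ≤ J * ‖wdiag s (P * P)‖ := by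
    rw [hΩdef, wform_ampL_ampR_mul]
    refine (hJ.1 _ s₀ hs₀ _ _).trans ?_
    calc J * ‖v‖ * ‖ampD ι₀ (wdiag s (1 - a)) * w‖ ≤ J * 1 * (‖wdiag s (P * P)‖ * 1) := by
          gcongr
          refine (norm_mul_le _ _).trans ?_
          gcongr
          refine (NonUnitalStarAlgHom.norm_apply_le _ _).trans ?_
          exact norm_wdiag_mono s (sub_nonneg.2 (resolv_le_one hPP)) (one_sub_resolv_le hPP)
      _ = _ := by ring
  have hC : ‖Ω V (W * R (1 - c))‖ ≤ J * ‖wdiag s (Q * Q)‖ := by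
    rw [hΩdef, wform_ampL_mul_ampR]
    refine (hJ.1 _ s₀ hs₀ _ _).trans ?_
    calc J * ‖v‖ * ‖w * ampD ι₀ (wdiag s (1 - c))‖ ≤ J * 1 * (1 * ‖wdiag s (Q * Q)‖) := by
          gcongr
          refine (norm_mul_le _ _).trans ?_
          gcongr
          refine (NonUnitalStarAlgHom.norm_apply_le _ _).trans ?_
          exact norm_wdiag_mono s (sub_nonneg.2 (resolv_le_one hQQ)) (one_sub_resolv_le hQQ)
      _ = _ := by ring
  have hre := (Complex.re_le_norm _).trans key
  rw [Complex.add_re, ← Complex.ofReal_mul, Complex.ofReal_re] at hre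
  rw [hA] at corner
  have := mul_le_mul_of_nonneg_left hσ hJ0
  linarith

end Sandwich

section Blocks

variable {A B : Type*} [CStarAlgebra A] [PartialOrder A] [StarOrderedRing A]
  [CStarAlgebra B] [PartialOrder B] [StarOrderedRing B]
  {ι : Type} [Fintype ι] [DecidableEq ι]

/-- A two-by-two block matrix. -/
def blk (P Q R S : CStarMatrix ι ι A) : CStarMatrix (ι ⊕ ι) (ι ⊕ ι) A :=
  cmat (Sum.elim (fun i => Sum.elim (P i) (Q i)) (fun i => Sum.elim (R i) (S i)))

omit [CStarAlgebra A] [PartialOrder A] [StarOrderedRing A] [DecidableEq ι] [Fintype ι] in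
lemma eq_blk (Z : CStarMatrix (ι ⊕ ι) (ι ⊕ ι) A) :
    ∃ P Q R S, Z = blk P Q R S :=
  ⟨cmat fun i j => Z (.inl i) (.inl j), cmat fun i j => Z (.inl i) (.inr j),
    cmat fun i j => Z (.inr i) (.inl j), cmat fun i j => Z (.inr i) (.inr j), by
      ext (i | i) (j | j) <;> rfl⟩

omit [PartialOrder A] [StarOrderedRing A] [DecidableEq ι] in
lemma blk_mul_blk (P Q R S P' Q' R' S' : CStarMatrix ι ι A) :
    blk P Q R S * blk P' Q' R' S' =
      blk (P * P' + Q * R') (P * Q' + Q * S') (R * P' + S * R') (R * Q' + S * S') := by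
  ext (i | i) (j | j) <;> simp [blk, CStarMatrix.mul_apply]

omit [PartialOrder A] [StarOrderedRing A] [DecidableEq ι] [Fintype ι] in
lemma star_blk (P Q R S : CStarMatrix ι ι A) :
    star (blk P Q R S) = blk (star P) (star R) (star Q) (star S) := by
  ext (i | i) (j | j) <;> simp [blk, CStarMatrix.star_apply]

omit [PartialOrder A] [StarOrderedRing A] in
lemma ampD_sum (c : A) : ampD (ι ⊕ ι) c = blk (ampD ι c) 0 0 (ampD ι c) := by
  ext (i | i) (j | j) <;> simp [blk, ampD_apply]

/-- The weights of a block matrix. -/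
def blkWeight (l m : ℝ) (s : ι → ℝ) : ι ⊕ ι → ℝ :=
  Sum.elim (fun i => l * s i) (fun i => m * s i)

omit [DecidableEq ι] in
lemma sum_blkWeight_sq {l m : ℝ} (h : l ^ 2 + m ^ 2 = 1) {s : ι → ℝ} (hs : ∑ i, s i ^ 2 = 1) :
    ∑ i, blkWeight l m s i ^ 2 = 1 := by
  simp only [blkWeight, Fintype.sum_sum_type, Sum.elim_inl, Sum.elim_inr, mul_pow,
    ← Finset.mul_sum, hs]
  linarith

omit [PartialOrder A] [StarOrderedRing A] [DecidableEq ι] in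
lemma wdiag_blk (l m : ℝ) (s : ι → ℝ) (P Q R S : CStarMatrix ι ι A) :
    wdiag (blkWeight l m s) (blk P Q R S)
      = ((l : ℂ) ^ 2) • wdiag s P + ((m : ℂ) ^ 2) • wdiag s S := by
  simp [wdiag_apply, blk, blkWeight, mul_pow, Finset.smul_sum, smul_smul]

omit [PartialOrder A] [StarOrderedRing A] [PartialOrder B] [StarOrderedRing B] [DecidableEq ι] in
lemma wform_blk (u : A →ₗ[ℂ] B →ₗ[ℂ] ℂ) (l m : ℝ) (s : ι → ℝ) (P Q R S : CStarMatrix ι ι A)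
    (P' Q' R' S' : CStarMatrix ι ι B) :
    wform u (blkWeight l m s) (blk P Q R S) (blk P' Q' R' S')
      = (l : ℂ) ^ 2 * wform u s P P' + (l * m : ℂ) * (wform u s Q Q' + wform u s R R')
        + (m : ℂ) ^ 2 * wform u s S S' := by
  simp only [wform_apply, blk, blkWeight, Fintype.sum_sum_type, Finset.mul_sum,
    Finset.sum_add_distrib, cmat_apply, Sum.elim_inl, Sum.elim_inr, mul_add]
  simp only [← Finset.sum_add_distrib]
  push_cast
  simp only [← add_assoc]
  refine Finset.sum_congr rfl fun i _ => ?_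
  exact Finset.sum_congr rfl fun j _ => by ring

omit [PartialOrder A] [StarOrderedRing A] in
lemma wdiag_ampD {s : ι → ℝ} (hs : ∑ i, s i ^ 2 = 1) (c : A) : wdiag s (ampD ι c) = c := by
  have hs' : ∑ k, (s k : ℂ) ^ 2 = 1 := by exact_mod_cast hs
  simp only [wdiag_apply, ampD_apply, if_true, ← Finset.sum_smul, hs', one_smul]

omit [PartialOrder A] [StarOrderedRing A] in
lemma wdiag_mul_ampD (s : ι → ℝ) (M : CStarMatrix ι ι A) (c : A) :
    wdiag s (M * ampD ι c) = wdiag s M * c := by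
  simp only [wdiag_apply, mul_ampD_apply, Finset.sum_mul, smul_mul_assoc]

omit [PartialOrder A] [StarOrderedRing A] in
lemma wdiag_mul_mul_ampD (s : ι → ℝ) (M N : CStarMatrix ι ι A) (c : A) :
    wdiag s (M * (N * ampD ι c)) = wdiag s (M * N) * c := by
  rw [← mul_assoc, wdiag_mul_ampD]

omit [PartialOrder A] [StarOrderedRing A] in
lemma wdiag_ampD_mul (s : ι → ℝ) (M : CStarMatrix ι ι A) (c : A) :
    wdiag s (ampD ι c * M) = c * wdiag s M := by
  simp only [wdiag_apply, ampD_mul_apply, Finset.mul_sum, mul_smul_comm]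

omit [PartialOrder A] [StarOrderedRing A] [DecidableEq ι] in
lemma star_wdiag (s : ι → ℝ) (M : CStarMatrix ι ι A) : star (wdiag s M) = wdiag s (star M) := by
  simp [wdiag_apply, CStarMatrix.star_apply]

omit [PartialOrder A] [StarOrderedRing A] [PartialOrder B] [StarOrderedRing B] in
lemma wform_ampD_right (u : A →ₗ[ℂ] B →ₗ[ℂ] ℂ) (s : ι → ℝ) (Z : CStarMatrix ι ι A) (c : B) :
    wform u s Z (ampD ι c) = u (wdiag s Z) c := by
  simp only [wform_apply, ampD_apply, wdiag_apply, map_sum, map_smul, LinearMap.sum_apply,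
    LinearMap.smul_apply, smul_eq_mul]
  refine Finset.sum_congr rfl fun i _ => ?_
  rw [Finset.sum_eq_single i]
  · rw [if_pos rfl]; ring
  · intro j _ hj; simp [hj.symm]
  · simp

lemma wdiag_mul_star_wdiag_le {s : ι → ℝ} (hs : ∑ i, s i ^ 2 = 1) (Z : CStarMatrix ι ι A) :
    wdiag s Z * star (wdiag s Z) ≤ wdiag s (Z * star Z) := by
  have h := wdiag_nonneg s (mul_star_self_nonneg (Z - ampD ι (wdiag s Z)))
  rw [star_sub, mul_sub, sub_mul, sub_mul, ← map_star (ampD ι), ← map_mul, map_sub, map_sub,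
    map_sub, wdiag_ampD hs, wdiag_mul_ampD, wdiag_ampD_mul, ← star_wdiag] at h
  rw [← sub_nonneg]
  convert h using 1
  abel

lemma star_wdiag_mul_wdiag_le {s : ι → ℝ} (hs : ∑ i, s i ^ 2 = 1) (Z : CStarMatrix ι ι A) :
    star (wdiag s Z) * wdiag s Z ≤ wdiag s (star Z * Z) := by
  have := wdiag_mul_star_wdiag_le hs (star Z)
  rwa [← star_wdiag, star_star, star_star] at this

end Blocks

section Car

variable {A B : Type*} [CStarAlgebra A] [PartialOrder A] [StarOrderedRing A]
  [CStarAlgebra B] [PartialOrder B] [StarOrderedRing B]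
  {ι : Type} [Fintype ι] [DecidableEq ι]

/-- `X` has the second and fourth moments of a sum of independent weighted anticommuting matrix
units with coefficients `α`. -/
structure CarMoments (s : ι → ℝ) (X : CStarMatrix ι ι A) (n : ℕ) (α : ℕ → A) (l m : ℕ → ℝ) :
    Prop where
  row : ∀ c, wdiag s (X * ampD ι c * star X)
    = ∑ k ∈ Finset.range n, ((l k : ℂ) ^ 2) • (α k * c * star (α k))
  col : ∀ c, wdiag s (star X * ampD ι c * X)
    = ∑ k ∈ Finset.range n, ((m k : ℂ) ^ 2) • (star (α k) * c * α k)
  row_four : wdiag s (X * star X * (X * star X)) = wdiag s (X * star X) * wdiag s (X * star X)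
    + wdiag s (X * ampD ι (wdiag s (star X * X)) * star X)
  col_four : wdiag s (star X * X * (star X * X)) = wdiag s (star X * X) * wdiag s (star X * X)
    + wdiag s (star X * ampD ι (wdiag s (X * star X)) * X)

omit [PartialOrder A] [StarOrderedRing A] in
lemma CarMoments.succ {s : ι → ℝ} (hs : ∑ i, s i ^ 2 = 1) {X : CStarMatrix ι ι A} {n : ℕ}
    {α : ℕ → A} {l m : ℕ → ℝ} (hlm : l n ^ 2 + m n ^ 2 = 1) (h : CarMoments s X n α l m) :
    CarMoments (blkWeight (l n) (m n) s) (blk X (ampD ι (α n)) 0 (-X)) (n + 1) α l m := by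
  have hm : (m n : ℂ) ^ 2 = 1 - (l n : ℂ) ^ 2 := by
    rw [eq_sub_iff_add_eq, add_comm]; exact_mod_cast hlm
  have hrow : ∀ c, wdiag (blkWeight (l n) (m n) s) (blk X (ampD ι (α n)) 0 (-X) * ampD (ι ⊕ ι) c
      * star (blk X (ampD ι (α n)) 0 (-X))) = wdiag s (X * ampD ι c * star X)
        + ((l n : ℂ) ^ 2) • (α n * c * star (α n)) := by
    intro c
    simp only [ampD_sum, star_blk, blk_mul_blk, wdiag_blk, star_zero, mul_zero, zero_mul, add_zero,
      zero_add, ← map_star, ← map_mul, map_add, wdiag_ampD hs, neg_mul, star_neg, mul_neg, neg_neg,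
      hm]
    module
  have hcol : ∀ c, wdiag (blkWeight (l n) (m n) s) (star (blk X (ampD ι (α n)) 0 (-X))
      * ampD (ι ⊕ ι) c * (blk X (ampD ι (α n)) 0 (-X))) = wdiag s (star X * ampD ι c * X)
        + ((m n : ℂ) ^ 2) • (star (α n) * c * α n) := by
    intro c
    simp only [ampD_sum, star_blk, blk_mul_blk, wdiag_blk, star_zero, mul_zero, zero_mul, add_zero,
      zero_add, ← map_star, ← map_mul, map_add, wdiag_ampD hs, neg_mul, star_neg, mul_neg, neg_neg,
      hm]
    module
  have hrow1 : wdiag (blkWeight (l n) (m n) s) (blk X (ampD ι (α n)) 0 (-X)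
      * star (blk X (ampD ι (α n)) 0 (-X))) = wdiag s (X * star X)
        + ((l n : ℂ) ^ 2) • (α n * star (α n)) := by
    simpa using hrow 1
  have hcol1 : wdiag (blkWeight (l n) (m n) s) (star (blk X (ampD ι (α n)) 0 (-X))
      * (blk X (ampD ι (α n)) 0 (-X))) = wdiag s (star X * X)
        + ((m n : ℂ) ^ 2) • (star (α n) * α n) := by
    simpa using hcol 1
  refine ⟨fun c => ?_, fun c => ?_, ?_, ?_⟩
  · rw [hrow, h.row, Finset.sum_range_succ]
  · rw [hcol, h.col, Finset.sum_range_succ]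
  · rw [hrow1, hcol1, hrow]
    set R := wdiag s (X * star X) with hR
    set C := wdiag s (star X * X) with hC
    set a := α n
    have e1 : ampD ι a * star X * (X * ampD ι (star a))
        = ampD ι a * (star X * X) * ampD ι (star a) := by
      simp only [mul_assoc]
    have e2 : X * ampD ι (star a) * (ampD ι a * star X) = X * ampD ι (star a * a) * star X := by
      simp only [mul_assoc, map_mul]
    simp only [star_blk, blk_mul_blk, wdiag_blk, star_zero, mul_zero, zero_mul, zero_add,
      ← map_star, map_add, neg_mul, star_neg, mul_neg, neg_neg, e1, e2, mul_add, add_mul,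
      h.row_four, wdiag_ampD_mul, wdiag_mul_ampD, map_smul,
      smul_mul_assoc, mul_smul_comm]
    simp only [← map_mul, wdiag_ampD hs, wdiag_ampD_mul, wdiag_mul_mul_ampD, ← hR, ← hC,
      hm, mul_assoc]
    module
  · rw [hrow1, hcol1, hcol]
    set R := wdiag s (X * star X) with hR
    set C := wdiag s (star X * X) with hC
    set a := α n
    have e1 : ampD ι (star a) * X * (star X * ampD ι a)
        = ampD ι (star a) * (X * star X) * ampD ι a := by
      simp only [mul_assoc]
    have e2 : star X * ampD ι a * (ampD ι (star a) * X) = star X * ampD ι (a * star a) * X := by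
      simp only [mul_assoc, map_mul]
    simp only [star_blk, blk_mul_blk, wdiag_blk, star_zero, mul_zero, zero_mul, add_zero,
      ← map_star, map_add, neg_mul, star_neg, mul_neg, neg_neg, neg_zero, e1, e2,
      mul_add, add_mul, h.col_four, wdiag_ampD_mul, wdiag_mul_ampD, map_smul,
      smul_mul_assoc, mul_smul_comm]
    simp only [← map_mul, wdiag_ampD hs, wdiag_ampD_mul, wdiag_mul_mul_ampD, ← hR, ← hC,
      hm, mul_assoc]
    module

end Car

section CarExists

variable {A B : Type*} [CStarAlgebra A] [PartialOrder A] [StarOrderedRing A]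
  [CStarAlgebra B] [PartialOrder B] [StarOrderedRing B]
  {ι : Type} [Fintype ι] [DecidableEq ι]

lemma sq_smul_nonneg (l : ℝ) {a : A} (ha : 0 ≤ a) : 0 ≤ ((l : ℂ) ^ 2) • a := by
  obtain ⟨x, rfl⟩ := exists_eq_star_mul_self_of_nonneg ha
  have : ((l : ℂ) ^ 2) • (star x * x) = star ((l : ℂ) • x) * ((l : ℂ) • x) := by
    rw [star_smul, smul_mul_smul_comm, pow_two]
    simp
  rw [this]
  exact star_mul_self_nonneg _

lemma sq_smul_mono (l : ℝ) {a b : A} (h : a ≤ b) : ((l : ℂ) ^ 2) • a ≤ ((l : ℂ) ^ 2) • b := by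
  rw [← sub_nonneg, ← smul_sub]
  exact sq_smul_nonneg l (sub_nonneg.2 h)

lemma convex_mul_star_le {l m : ℝ} (h : l ^ 2 + m ^ 2 = 1) (P Q : A) :
    (((l : ℂ) ^ 2) • P - ((m : ℂ) ^ 2) • Q) * star (((l : ℂ) ^ 2) • P - ((m : ℂ) ^ 2) • Q) ≤
      ((l : ℂ) ^ 2) • (P * star P) + ((m : ℂ) ^ 2) • (Q * star Q) := by
  have hm : (m : ℂ) ^ 2 = 1 - (l : ℂ) ^ 2 := by
    rw [eq_sub_iff_add_eq, add_comm]; exact_mod_cast h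
  have h0 := sq_smul_nonneg l (sq_smul_nonneg m (mul_star_self_nonneg (P + Q)))
  rw [← sub_nonneg]
  convert h0 using 1
  simp only [star_sub, star_add, star_smul, hm, mul_add, add_mul, mul_sub, sub_mul, smul_mul_assoc,
    mul_smul_comm, star_pow, RCLike.star_def, Complex.conj_ofReal, map_one]
  module

lemma convex_star_mul_le {l m : ℝ} (h : l ^ 2 + m ^ 2 = 1) (P Q : A) :
    star (((l : ℂ) ^ 2) • P - ((m : ℂ) ^ 2) • Q) * (((l : ℂ) ^ 2) • P - ((m : ℂ) ^ 2) • Q) ≤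
      ((l : ℂ) ^ 2) • (star P * P) + ((m : ℂ) ^ 2) • (star Q * Q) := by
  have := convex_mul_star_le h (star P) (star Q)
  simpa [star_smul] using this

/-- Pairing with `Y` factors through the coefficients `β`, with Bessel inequalities. -/
def CarBessel (u : A →ₗ[ℂ] B →ₗ[ℂ] ℂ) (s : ι → ℝ) (Y : CStarMatrix ι ι B) (n : ℕ) (β : ℕ → B)
    (l m : ℕ → ℝ) : Prop :=
  ∀ Z : CStarMatrix ι ι A, ∃ E : ℕ → A,
    wform u s Z Y = ∑ k ∈ Finset.range n, (l k * m k : ℂ) * u (E k) (β k) ∧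
    ∑ k ∈ Finset.range n, ((l k : ℂ) ^ 2) • (E k * star (E k)) ≤ wdiag s (Z * star Z) ∧
    ∑ k ∈ Finset.range n, ((m k : ℂ) ^ 2) • (star (E k) * E k) ≤ wdiag s (star Z * Z)

omit [PartialOrder B] [StarOrderedRing B] in
lemma CarBessel.succ {u : A →ₗ[ℂ] B →ₗ[ℂ] ℂ} {s : ι → ℝ} (hs : ∑ i, s i ^ 2 = 1)
    {Y : CStarMatrix ι ι B} {n : ℕ} {β : ℕ → B} {l m : ℕ → ℝ} (hlm : l n ^ 2 + m n ^ 2 = 1)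
    (h : CarBessel u s Y n β l m) :
    CarBessel u (blkWeight (l n) (m n) s) (blk Y (ampD ι (β n)) 0 (-Y)) (n + 1) β l m := by
  intro Z
  obtain ⟨P, Q, R, S, rfl⟩ := eq_blk Z
  obtain ⟨E, h1, h2, h3⟩ := h (((l n : ℂ) ^ 2) • P - ((m n : ℂ) ^ 2) • S)
  obtain ⟨E', hn, hE'⟩ : ∃ E' : ℕ → A, E' n = wdiag s Q ∧ ∀ k ∈ Finset.range n, E' k = E k :=
    ⟨Function.update E n (wdiag s Q), by simp, fun k hk =>
      Function.update_of_ne (Finset.mem_range.1 hk).ne _ _⟩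
  refine ⟨E', ?_, ?_, ?_⟩
  · rw [Finset.sum_range_succ, wform_blk, hn, wform_ampD_right, map_zero, add_zero, map_neg]
    have : ∑ k ∈ Finset.range n, (l k * m k : ℂ) * u (E' k) (β k)
        = ∑ k ∈ Finset.range n, (l k * m k : ℂ) * u (E k) (β k) :=
      Finset.sum_congr rfl fun k hk => by rw [hE' k hk]
    rw [this, ← h1, map_sub, map_smul, map_smul, LinearMap.sub_apply, LinearMap.smul_apply,
      LinearMap.smul_apply, smul_eq_mul, smul_eq_mul]
    ring
  · rw [Finset.sum_range_succ, hn]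
    have : ∑ k ∈ Finset.range n, ((l k : ℂ) ^ 2) • ((E' k) *
        star (E' k))
        = ∑ k ∈ Finset.range n, ((l k : ℂ) ^ 2) • (E k * star (E k)) :=
      Finset.sum_congr rfl fun k hk => by rw [hE' k hk]
    rw [this, star_blk, blk_mul_blk, wdiag_blk, map_add, map_add, smul_add, smul_add]
    have e1 := h2.trans (wdiag_mono s (convex_mul_star_le hlm P S))
    rw [map_add, map_smul, map_smul] at e1
    have e2 := sq_smul_mono (l n) (wdiag_mul_star_wdiag_le hs Q)
    have e3 := sq_smul_nonneg (m n) (wdiag_nonneg s (mul_star_self_nonneg R))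
    calc _ ≤ _ := add_le_add e1 e2
      _ ≤ _ + _ := le_add_of_nonneg_right e3
      _ = _ := by abel
  · rw [Finset.sum_range_succ, hn]
    have : ∑ k ∈ Finset.range n, ((m k : ℂ) ^ 2) • (star (E' k) *
        (E' k))
        = ∑ k ∈ Finset.range n, ((m k : ℂ) ^ 2) • (star (E k) * E k) :=
      Finset.sum_congr rfl fun k hk => by rw [hE' k hk]
    rw [this, star_blk, blk_mul_blk, wdiag_blk, map_add, map_add, smul_add, smul_add]
    have e1 := h3.trans (wdiag_mono s (convex_star_mul_le hlm P S))
    rw [map_add, map_smul, map_smul] at e1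
    have e2 := sq_smul_mono (m n) (star_wdiag_mul_wdiag_le hs Q)
    have e3 := sq_smul_nonneg (l n) (wdiag_nonneg s (star_mul_self_nonneg R))
    calc _ ≤ _ := add_le_add e1 e2
      _ ≤ _ + _ := le_add_of_nonneg_right e3
      _ = _ := by abel

omit [PartialOrder B] [StarOrderedRing B] in
lemma exists_car (u : A →ₗ[ℂ] B →ₗ[ℂ] ℂ) (α : ℕ → A) (β : ℕ → B) {l m : ℕ → ℝ}
    (hl : ∀ k, 0 < l k) (hm : ∀ k, 0 < m k) (hlm : ∀ k, l k ^ 2 + m k ^ 2 = 1) (n : ℕ) :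
    ∃ (ι : Type) (_ : Fintype ι) (_ : DecidableEq ι) (s : ι → ℝ) (X : CStarMatrix ι ι A)
      (Y : CStarMatrix ι ι B), ∑ i, s i ^ 2 = 1 ∧ (∀ i, 0 < s i) ∧ CarMoments s X n α l m ∧
      CarMoments s Y n β l m ∧
      wform u s X Y = ∑ k ∈ Finset.range n, (l k * m k : ℂ) * u (α k) (β k) ∧
      CarBessel u s Y n β l m := by
  induction n with
  | zero =>
    refine ⟨Unit, inferInstance, inferInstance, fun _ => 1, 0, 0, by simp, by simp,
      ⟨by simp, by simp, by simp, by simp⟩, ⟨by simp, by simp, by simp, by simp⟩, by simp, ?_⟩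
    intro Z
    exact ⟨0, by simp, by simpa using wdiag_nonneg _ (mul_star_self_nonneg Z),
      by simpa using wdiag_nonneg _ (star_mul_self_nonneg Z)⟩
  | succ n ih =>
    obtain ⟨ι, _, _, s, X, Y, hs, hs0, hX, hY, hu, hB⟩ := ih
    refine ⟨ι ⊕ ι, inferInstance, inferInstance, blkWeight (l n) (m n) s, _, _,
      sum_blkWeight_sq (hlm n) hs, ?_, hX.succ hs (hlm n), hY.succ hs (hlm n), ?_,
      hB.succ hs (hlm n)⟩
    · rintro (i | i)
      · exact mul_pos (hl n) (hs0 i)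
      · exact mul_pos (hm n) (hs0 i)
    · have hmn : (m n : ℂ) ^ 2 = 1 - (l n : ℂ) ^ 2 := by
        rw [eq_sub_iff_add_eq, add_comm]; exact_mod_cast hlm n
      rw [Finset.sum_range_succ, ← hu, wform_blk, wform_ampD_right, wdiag_ampD hs, map_zero,
        map_neg, map_neg, LinearMap.neg_apply, neg_neg, hmn, add_zero]
      ring

end CarExists

section Truncation

variable {𝒜 : Type*} [CStarAlgebra 𝒜] [PartialOrder 𝒜] [StarOrderedRing 𝒜]

lemma resolv_intertwine {T T' Y : 𝒜} (hT : 0 ≤ T) (hT' : 0 ≤ T') (h : T * Y = Y * T') :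
    resolv T * Y = Y * resolv T' := by
  have h1 : (1 + T) * Y = Y * (1 + T') := by rw [add_mul, mul_add, h, one_mul, mul_one]
  calc resolv T * Y = resolv T * (Y * ((1 + T') * resolv T')) := by
        rw [mul_resolv_cancel hT', mul_one]
    _ = resolv T * ((1 + T) * Y) * resolv T' := by rw [h1]; simp only [mul_assoc]
    _ = Y * resolv T' := by rw [← mul_assoc, resolv_mul_cancel hT, one_mul]

/-- Compressing by the resolvent of a positive element kills `(1 + T) ^ 2`. -/
lemma resolv_conj_le_one {S T : 𝒜} (hT : 0 ≤ T) (h : S ≤ (1 + T) * (1 + T)) :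
    resolv T * S * resolv T ≤ 1 := by
  have h1 := star_left_conjugate_le_conjugate h (resolv T)
  rw [star_resolv hT] at h1
  refine h1.trans (le_of_eq ?_)
  rw [← mul_assoc, resolv_mul_cancel hT, one_mul, mul_resolv_cancel hT]

lemma norm_mul_resolv_le_one {Y T : 𝒜} (hT : 0 ≤ T) (h : star Y * Y ≤ (1 + T) * (1 + T)) :
    ‖Y * resolv T‖ ≤ 1 := by
  rw [norm_le_one_iff_star_mul_le_one, star_mul, star_resolv hT]
  have := resolv_conj_le_one hT h
  simpa only [mul_assoc] using this

lemma exists_truncation (X : 𝒜) : ∃ Xb Xr : 𝒜, X = Xb + Xr ∧ ‖Xb‖ ≤ 1 ∧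
    16 * (star Xr * Xr) ≤ star X * X * (star X * X) ∧
    16 * (Xr * star Xr) ≤ X * star X * (X * star X) := by
  set Q : 𝒜 := (1 / 2 : ℂ) • X with hQ
  have hX : X = 2 * Q := by rw [hQ, ← one_add_one_eq_two, add_mul, one_mul]; module
  set T := star Q * Q with hTdef
  have hT : 0 ≤ T := star_mul_self_nonneg Q
  set r := resolv T with hr
  have hb : ‖X * r‖ ≤ 1 := by
    refine norm_mul_resolv_le_one hT ?_
    have h0 : 0 ≤ star (1 - T) * (1 - T) := star_mul_self_nonneg _
    rw [← sub_nonneg]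
    convert h0 using 1
    rw [hX, star_sub, (IsSelfAdjoint.of_nonneg hT).star_eq, star_mul, star_one, star_ofNat]
    have : star Q * 2 * (2 * Q) = 4 * T := by
      rw [hTdef]; noncomm_ring
    rw [this]; noncomm_ring
  have hXb := hb
  rw [norm_le_one_iff_star_mul_le_one] at hXb
  have hXb' := hb
  rw [norm_le_one_iff_mul_star_le_one] at hXb'
  have h1r : 1 - r = T * r := one_sub_resolv hT
  have hcomm : T * r = r * T := (commute_resolv hT (Commute.refl T)).eq
  have hXX : star X * X = 4 * T := by
    rw [hX, hTdef, star_mul, star_ofNat]; noncomm_ring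
  have hXXs : IsSelfAdjoint (star X * X) := IsSelfAdjoint.star_mul_self X
  have hXXs' : IsSelfAdjoint (X * star X) := IsSelfAdjoint.mul_star_self X
  have e1 : 4 * (X * (1 - r)) = X * r * (star X * X) := by
    rw [hXX, h1r, hcomm]; noncomm_ring
  have e2 : 4 * (X * (1 - r)) = X * star X * (X * r) := by
    calc 4 * (X * (1 - r)) = X * (4 * T) * r := by rw [h1r]; noncomm_ring
      _ = X * star X * (X * r) := by rw [← hXX]; simp only [mul_assoc]
  refine ⟨X * r, X * (1 - r), by noncomm_ring, hb, ?_, ?_⟩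
  · have := star_left_conjugate_le_conjugate hXb (star X * X)
    rw [hXXs.star_eq, mul_one] at this
    refine (le_of_eq ?_).trans this
    calc _ = star (4 * (X * (1 - r))) * (4 * (X * (1 - r))) := by
          rw [star_mul 4, star_ofNat]; noncomm_ring
      _ = _ := by rw [e1, star_mul _ (star X * X), hXXs.star_eq]; simp only [mul_assoc]
  · have := star_left_conjugate_le_conjugate hXb' (X * star X)
    rw [hXXs'.star_eq, mul_one] at this
    refine (le_of_eq ?_).trans this
    calc _ = 4 * (X * (1 - r)) * star (4 * (X * (1 - r))) := by
          rw [star_mul 4, star_ofNat]; noncomm_ring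
      _ = _ := by rw [e2, star_mul (X * star X), hXXs'.star_eq]; simp only [mul_assoc]

lemma norm_mul_resolv_sq_le_one (z : 𝒜) : ‖z * resolv (star z * z * (star z * z))‖ ≤ 1 := by
  set S := star z * z with hS
  have hSs : star S = S := (IsSelfAdjoint.star_mul_self z).star_eq
  have hSS : 0 ≤ S * S := by have := star_mul_self_nonneg S; rwa [hSs] at this
  refine norm_mul_resolv_le_one hSS ?_
  have h0 : 0 ≤ star (1 - S) * (1 - S) := star_mul_self_nonneg _
  have h1 : 0 ≤ star (S * S) * (S * S) := star_mul_self_nonneg _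
  have h2 : 0 ≤ star z * z := star_mul_self_nonneg _
  rw [← sub_nonneg]
  convert add_nonneg (add_nonneg (add_nonneg h0 h1) (star_mul_self_nonneg S)) h2 using 1
  rw [← hS, star_sub, star_one, hSs, star_mul, hSs]
  noncomm_ring

/-- The telescoping step between two resolvent truncations. -/
lemma exists_sandwich_resolv_sub (z : 𝒜) : ∃ g : 𝒜, ‖g‖ ≤ 1 ∧
    (2 * z) * (resolv (star z * z * (star z * z)) * resolv (star z * z * (star z * z))) -
      (2 * z) * (resolv (star (2 * z) * (2 * z) * (star (2 * z) * (2 * z))) *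
        resolv (star (2 * z) * (2 * z) * (star (2 * z) * (2 * z)))) =
    (60 : ℂ) • ((2 * z) * star (2 * z) * resolv ((2 * z) * star (2 * z) * ((2 * z) * star (2 * z)))
      * g *
      (star (2 * z) * (2 * z) * resolv (star (2 * z) * (2 * z) * (star (2 * z) * (2 * z))))) := by
  set y := 2 * z with hy
  set S := star z * z with hS
  set Q := star y * y with hQ
  set P := y * star y with hP
  have hSs : star S = S := (IsSelfAdjoint.star_mul_self z).star_eq
  have hQs : star Q = Q := (IsSelfAdjoint.star_mul_self y).star_eq
  have hPs : star P = P := (IsSelfAdjoint.mul_star_self y).star_eq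
  have hSS : 0 ≤ S * S := by have := star_mul_self_nonneg S; rwa [hSs] at this
  have hQQ : 0 ≤ Q * Q := by have := star_mul_self_nonneg Q; rwa [hQs] at this
  have hPP : 0 ≤ P * P := by have := star_mul_self_nonneg P; rwa [hPs] at this
  have hQS : Q = 4 * S := by rw [hQ, hS, hy, star_mul, star_ofNat]; noncomm_ring
  have hQS2 : Q * Q = 16 * (S * S) := by rw [hQS]; noncomm_ring
  set r := resolv (Q * Q) with hr
  set r' := resolv (S * S) with hr'
  have cQr : Q * r = r * Q := (commute_resolv hQQ ((Commute.refl Q).mul_right (Commute.refl Q))).eq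
  have cQr' : Q * r' = r' * Q := by
    refine (commute_resolv hSS ?_).eq
    rw [hQS]
    have h4 : Commute (4 : 𝒜) S := Nat.cast_commute 4 S
    exact ((h4.mul_right h4).mul_left ((Commute.refl S).mul_right (Commute.refl S)))
  have crr' : r' * r = r * r' := by
    refine (commute_resolv hQQ ?_).eq
    exact (Commute.mul_right cQr'.symm cQr'.symm)
  -- the basic linear relation between the two resolvents
  have rel : r * r' = (16 / 15 : ℂ) • r - (1 / 15 : ℂ) • r' := by
    have a1 : 1 - r = 16 * (S * S) * r := by rw [hr, one_sub_resolv hQQ, hQS2]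
    have a2 : 1 - r' = S * S * r' := one_sub_resolv hSS
    have a3 : r' - r * r' = (16 : ℂ) • (r - r * r') := by
      calc r' - r * r' = (1 - r) * r' := by noncomm_ring
        _ = 16 * (S * S) * (r * r') := by rw [a1]; simp only [mul_assoc]
        _ = 16 * (S * S * r') * r := by rw [← crr']; simp only [mul_assoc]
        _ = (16 : ℂ) • (r - r' * r) := by
          rw [← a2]
          have : (16 : 𝒜) = (16 : ℂ) • 1 := by
            rw [← Algebra.algebraMap_eq_smul_one, map_ofNat]
          rw [this, smul_mul_assoc, one_mul, smul_mul_assoc, sub_mul, one_mul]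
        _ = _ := by rw [crr']
    have a4 : (15 : ℂ) • (r * r') = (16 : ℂ) • r - r' := by
      have a6 : (15 : ℂ) • (r * r') - ((16 : ℂ) • r - r')
          = r' - r * r' - (16 : ℂ) • (r - r * r') := by module
      rw [← sub_eq_zero, a6, a3, sub_self]
    have a5 : r * r' = (1 / 15 : ℂ) • ((15 : ℂ) • (r * r')) := by module
    rw [a5, a4]; module
  have hzr : ‖z * r'‖ ≤ 1 := norm_mul_resolv_sq_le_one z
  refine ⟨(1 / 60 : ℂ) • (y * ((15 / 16 : ℂ) • ((17 : ℂ) • r' - (15 : ℂ) • (r' * r')))), ?_, ?_⟩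
  · have e : (1 / 60 : ℂ) • (y * ((15 / 16 : ℂ) • ((17 : ℂ) • r' - (15 : ℂ) • (r' * r'))))
        = (17 / 32 : ℂ) • (z * r') - (15 / 32 : ℂ) • (z * r' * r') := by
      have : (2 : 𝒜) = (2 : ℂ) • 1 := by
        rw [← Algebra.algebraMap_eq_smul_one, map_ofNat]
      rw [hy, this]
      simp only [smul_mul_assoc, one_mul, mul_smul_comm, mul_sub, smul_sub, ← mul_assoc]
      module
    rw [e]
    refine (norm_sub_le _ _).trans ?_
    rw [norm_smul, norm_smul]
    have hz2 : ‖z * r' * r'‖ ≤ 1 := by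
      refine (norm_mul_le _ _).trans ?_
      have := norm_resolv_le hSS
      nlinarith [norm_nonneg (z * r'), norm_nonneg r']
    norm_num
    linarith
  · have hint : P * resolv (P * P) * y = y * (Q * r) := by
      have h1 : P * y = y * Q := by simp only [hP, hQ, mul_assoc]
      rw [mul_assoc, resolv_intertwine (T' := Q * Q) hPP hQQ, ← mul_assoc, h1, mul_assoc]
      rw [mul_assoc, h1, ← mul_assoc, h1, mul_assoc]
    have hq : Q * (Q * r) = 1 - r := by rw [← mul_assoc, ← one_sub_resolv hQQ]
    have cm : Commute ((15 / 16 : ℂ) • ((17 : ℂ) • r' - (15 : ℂ) • (r' * r'))) Q := by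
      have c1 : Commute r' Q := cQr'.symm
      exact (((c1.smul_left _).sub_left ((c1.mul_left c1).smul_left _)).smul_left _)
    set mm := (15 / 16 : ℂ) • ((17 : ℂ) • r' - (15 : ℂ) • (r' * r')) with hmm
    have e1 : (60 : ℂ) • (P * resolv (P * P) * ((1 / 60 : ℂ) • (y * mm)) * (Q * r))
        = y * ((1 - r) * (r * mm)) := by
      calc _ = P * resolv (P * P) * y * mm * (Q * r) := by
            simp only [mul_smul_comm, smul_mul_assoc, smul_smul, ← mul_assoc]; norm_num
        _ = y * (r * Q * mm * (Q * r)) := by rw [hint, cQr]; simp only [mul_assoc]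
        _ = y * (r * (mm * (Q * (Q * r)))) := by
          rw [mul_assoc r, ← cm.eq]; simp only [mul_assoc]
        _ = y * (r * (mm * (1 - r))) := by rw [hq]
        _ = _ := by
          have c2 : Commute r mm := by
            have c1 : Commute r r' := crr'.symm
            exact (((c1.smul_right _).sub_right ((c1.mul_right c1).smul_right _)).smul_right _)
          congr 1
          rw [mul_sub, mul_sub, sub_mul, mul_one, one_mul, ← c2.eq]
    rw [e1, ← mul_sub]
    congr 1
    have k1 : ∀ x, r * (r' * x) = (16 / 15 : ℂ) • (r * x) - (1 / 15 : ℂ) • (r' * x) := fun x => by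
      rw [← mul_assoc, rel, sub_mul, smul_mul_assoc, smul_mul_assoc]
    rw [hmm]
    simp only [sub_mul, one_mul, mul_sub, mul_smul_comm, rel, k1, smul_sub, smul_smul]
    module

end Truncation

section CarTuple

variable {A B : Type*} [CStarAlgebra A] [PartialOrder A] [StarOrderedRing A]
  [CStarAlgebra B] [PartialOrder B] [StarOrderedRing B]
  {ι : Type} [Fintype ι] [DecidableEq ι]

lemma norm_wdiag_sandwich_le (s : ι → ℝ) (X : CStarMatrix ι ι A) (c : A) (hc : 0 ≤ c) :
    ‖wdiag s (X * ampD ι c * star X)‖ ≤ ‖c‖ * ‖wdiag s (X * star X)‖ := by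
  have hD : 0 ≤ ampD ι c := by
    have := OrderHomClass.mono (ampD ι) hc
    rwa [map_zero] at this
  have h1 : X * ampD ι c * star X ≤ ‖ampD ι c‖ • (X * star X) :=
    CStarAlgebra.star_right_conjugate_le_norm_smul (IsSelfAdjoint.of_nonneg hD)
  have h2 : ‖ampD ι c‖ • (X * star X) = ((‖ampD ι c‖ : ℝ) : ℂ) • (X * star X) :=
    (Complex.coe_smul _ _).symm
  have h3 := norm_wdiag_mono s (star_right_conjugate_nonneg hD X) h1
  rw [h2, map_smul, norm_smul, Complex.norm_real, norm_norm] at h3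
  exact h3.trans (mul_le_mul_of_nonneg_right (NonUnitalStarAlgHom.norm_apply_le _ c)
    (norm_nonneg _))

/-- Second and fourth moment data for a weighted matrix. -/
structure TupleMoments (s : ι → ℝ) (X : CStarMatrix ι ι A) (R C : A) : Prop where
  row : wdiag s (X * star X) = R
  col : wdiag s (star X * X) = C
  row_four : ‖wdiag s (X * star X * (X * star X))‖ ≤ ‖R‖ * (‖R‖ + ‖C‖)
  col_four : ‖wdiag s (star X * X * (star X * X))‖ ≤ ‖C‖ * (‖R‖ + ‖C‖)

lemma CarMoments.tupleMoments {s : ι → ℝ} {X : CStarMatrix ι ι A} {n : ℕ}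
    {α : ℕ → A} {l m : ℕ → ℝ} (h : CarMoments s X n α l m) :
    TupleMoments s X (∑ k ∈ Finset.range n, ((l k : ℂ) ^ 2) • (α k * star (α k)))
      (∑ k ∈ Finset.range n, ((m k : ℂ) ^ 2) • (star (α k) * α k)) := by
  have hr : wdiag s (X * star X) = ∑ k ∈ Finset.range n, ((l k : ℂ) ^ 2) • (α k * star (α k)) := by
    simpa only [map_one, mul_one] using h.row 1
  have hc : wdiag s (star X * X) = ∑ k ∈ Finset.range n, ((m k : ℂ) ^ 2) • (star (α k) * α k) := by
    simpa only [map_one, mul_one] using h.col 1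
  refine ⟨hr, hc, ?_, ?_⟩
  · rw [← hr, ← hc, h.row_four]
    refine (norm_add_le _ _).trans ?_
    have h1 := norm_mul_le (wdiag s (X * star X)) (wdiag s (X * star X))
    have h2 := norm_wdiag_sandwich_le s X _ (wdiag_nonneg s (star_mul_self_nonneg X))
    nlinarith
  · rw [← hr, ← hc, h.col_four]
    refine (norm_add_le _ _).trans ?_
    have h1 := norm_mul_le (wdiag s (star X * X)) (wdiag s (star X * X))
    have h2 := norm_wdiag_sandwich_le s (star X) _ (wdiag_nonneg s (mul_star_self_nonneg X))
    rw [star_star] at h2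
    nlinarith

lemma exists_nat_extension {κ E : Type*} {N : ℕ} (e : κ ≃ Fin N) (f : κ → E) (d : E)
    {p : E → Prop} (hf : ∀ i, p (f i)) (hd : p d) :
    ∃ g : ℕ → E, (∀ i, g (e i) = f i) ∧ ∀ k, p (g k) := by
  classical
  refine ⟨fun k => if h : k < N then f (e.symm ⟨k, h⟩) else d, fun i => by simp, fun k => ?_⟩
  dsimp only
  split_ifs
  exacts [hf _, hd]

lemma sum_range_eq_sum_equiv {κ M : Type*} [Fintype κ] [AddCommMonoid M] {N : ℕ} (e : κ ≃ Fin N)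
    (f : ℕ → M) : ∑ k ∈ Finset.range N, f k = ∑ i, f (e i) := by
  rw [Finset.sum_range, ← Equiv.sum_comp e]

lemma exists_car_tuple (u : A →ₗ[ℂ] B →ₗ[ℂ] ℂ) {κ : Type} [Fintype κ] (a : κ → A) (b : κ → B)
    (t : κ → ℝ) (ht : ∀ k, 0 < t k) :
    ∃ (ι : Type) (_ : Fintype ι) (_ : DecidableEq ι) (s : ι → ℝ) (X : CStarMatrix ι ι A)
      (Y : CStarMatrix ι ι B), ∑ i, s i ^ 2 = 1 ∧ (∀ i, 0 < s i) ∧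
      TupleMoments s X (∑ k, a k * star (a k)) (∑ k, (t k : ℂ) • (star (a k) * a k)) ∧
      TupleMoments s Y (∑ k, (t k : ℂ)⁻¹ • (b k * star (b k))) (∑ k, star (b k) * b k) ∧
      wform u s X Y = ∑ k, u (a k) (b k) ∧
      ∀ Z : CStarMatrix ι ι A, ∃ E : κ → A,
        wform u s Z Y = ∑ k, u (E k) (b k) ∧
        ∑ k, E k * star (E k) ≤ wdiag s (Z * star Z) ∧
        ∑ k, (t k : ℂ) • (star (E k) * E k) ≤ wdiag s (star Z * Z) := by
  set N := Fintype.card κ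
  set e : κ ≃ Fin N := Fintype.equivFin κ
  obtain ⟨T, hT, hT0⟩ := exists_nat_extension e t 1 ht one_pos
  set l : ℕ → ℝ := fun k => Real.sqrt (1 / (1 + T k)) with hl
  set m : ℕ → ℝ := fun k => Real.sqrt (T k / (1 + T k)) with hm
  have hT1 : ∀ k, 0 < 1 + T k := fun k => by linarith [hT0 k]
  have hl0 : ∀ k, 0 < l k := fun k => Real.sqrt_pos.2 (div_pos one_pos (hT1 k))
  have hm0 : ∀ k, 0 < m k := fun k => Real.sqrt_pos.2 (div_pos (hT0 k) (hT1 k))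
  have hl2 : ∀ k, l k ^ 2 = 1 / (1 + T k) := fun k =>
    Real.sq_sqrt (div_pos one_pos (hT1 k)).le
  have hm2 : ∀ k, m k ^ 2 = T k / (1 + T k) := fun k =>
    Real.sq_sqrt (div_pos (hT0 k) (hT1 k)).le
  have hlm : ∀ k, l k ^ 2 + m k ^ 2 = 1 := fun k => by
    rw [hl2, hm2, ← add_div, div_self (hT1 k).ne']
  have hmt : ∀ k, m k ^ 2 = T k * l k ^ 2 := fun k => by rw [hl2, hm2]; ring
  have hlc : ∀ k, (l k : ℂ) ≠ 0 := fun k => by exact_mod_cast (hl0 k).ne'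
  have hmc : ∀ k, (m k : ℂ) ≠ 0 := fun k => by exact_mod_cast (hm0 k).ne'
  have hTc : ∀ k, (T k : ℂ) ≠ 0 := fun k => by exact_mod_cast (hT0 k).ne'
  have hmtc : ∀ k, (m k : ℂ) ^ 2 = T k * (l k : ℂ) ^ 2 := fun k => by exact_mod_cast hmt k
  obtain ⟨α, hα, -⟩ := exists_nat_extension e a 0 (p := fun _ => True) (fun _ => trivial) trivial
  obtain ⟨β, hβ, -⟩ := exists_nat_extension e b 0 (p := fun _ => True) (fun _ => trivial) trivial
  obtain ⟨ι, _, _, s, X, Y, hs, hs0, hX, hY, hu, hB⟩ := exists_car u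
    (fun k => (l k : ℂ)⁻¹ • α k) (fun k => (m k : ℂ)⁻¹ • β k) hl0 hm0 hlm N
  refine ⟨ι, inferInstance, inferInstance, s, X, Y, hs, hs0, ?_, ?_, ?_, ?_⟩
  · convert hX.tupleMoments using 1
    · rw [sum_range_eq_sum_equiv e]
      refine Finset.sum_congr rfl fun k _ => ?_
      simp only [hα, star_smul, smul_mul_smul_comm, smul_smul]
      rw [show ((l (e k) : ℂ) ^ 2 * ((l (e k) : ℂ)⁻¹ * star (l (e k) : ℂ)⁻¹)) = 1 by
        have := hlc (e k); simp; field_simp, one_smul]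
    · rw [sum_range_eq_sum_equiv e]
      refine Finset.sum_congr rfl fun k _ => ?_
      simp only [hα, star_smul, smul_mul_smul_comm, smul_smul, ← hT]
      congr 1
      have := hlc (e k)
      rw [hmtc]; simp; field_simp
  · convert hY.tupleMoments using 1
    · rw [sum_range_eq_sum_equiv e]
      refine Finset.sum_congr rfl fun k _ => ?_
      simp only [hβ, star_smul, smul_mul_smul_comm, smul_smul, ← hT]
      congr 1
      have h1 := hmc (e k)
      have h2 := hlc (e k)
      have h3 := hTc (e k)
      have h4 := hmtc (e k)
      simp only [star_inv₀, RCLike.star_def, Complex.conj_ofReal]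
      rw [← mul_inv, ← pow_two, h4]
      field_simp
    · rw [sum_range_eq_sum_equiv e]
      refine Finset.sum_congr rfl fun k _ => ?_
      simp only [hβ, star_smul, smul_mul_smul_comm, smul_smul]
      rw [show ((m (e k) : ℂ) ^ 2 * (star (m (e k) : ℂ)⁻¹ * (m (e k) : ℂ)⁻¹)) = 1 by
        have := hmc (e k); simp; field_simp, one_smul]
  · rw [hu, sum_range_eq_sum_equiv e]
    refine Finset.sum_congr rfl fun k _ => ?_
    have h1 := hmc (e k)
    have h2 := hlc (e k)
    simp only [map_smul, LinearMap.smul_apply, smul_eq_mul, hα, hβ]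
    field_simp
  · intro Z
    obtain ⟨E, h1, h2, h3⟩ := hB Z
    refine ⟨fun k => (l (e k) : ℂ) • E (e k), ?_, ?_, ?_⟩
    · rw [h1, sum_range_eq_sum_equiv e]
      refine Finset.sum_congr rfl fun k _ => ?_
      have h1 := hmc (e k)
      simp only [map_smul, LinearMap.smul_apply, smul_eq_mul, hβ]
      field_simp
    · refine (le_of_eq ?_).trans h2
      rw [sum_range_eq_sum_equiv e]
      refine Finset.sum_congr rfl fun k _ => ?_
      simp only [star_smul, smul_mul_smul_comm, pow_two, RCLike.star_def, Complex.conj_ofReal]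
    · refine (le_of_eq ?_).trans h3
      rw [sum_range_eq_sum_equiv e]
      refine Finset.sum_congr rfl fun k _ => ?_
      simp only [hmtc, hT]
      simp only [star_smul, smul_mul_smul_comm, pow_two, smul_smul, RCLike.star_def,
        Complex.conj_ofReal]

end CarTuple

section Telescope

variable {𝒜 : Type*} [CStarAlgebra 𝒜] [PartialOrder 𝒜] [StarOrderedRing 𝒜]

lemma exists_telescope (Y : 𝒜) : ∃ V : ℕ → 𝒜, ‖V 0‖ ≤ 1 ∧
    Filter.Tendsto V Filter.atTop (nhds Y) ∧ ∀ l : ℕ, ∃ g P Q : 𝒜, ‖g‖ ≤ 1 ∧ IsSelfAdjoint P ∧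
      IsSelfAdjoint Q ∧ P * P = ((1 / 16 : ℂ) ^ l) • (Y * star Y * (Y * star Y)) ∧
      Q * Q = ((1 / 16 : ℂ) ^ l) • (star Y * Y * (star Y * Y)) ∧
      V (l + 1) - V l = ((60 : ℂ) * 2 ^ l) • (P * resolv (P * P) * g * (Q * resolv (Q * Q))) := by
  set y : ℕ → 𝒜 := fun l => ((1 / 2 : ℂ) ^ l) • Y with hy
  have h2 : (2 : 𝒜) = (2 : ℂ) • 1 := by
    rw [← Algebra.algebraMap_eq_smul_one, map_ofNat]
  have hyy : ∀ l, 2 * y (l + 1) = y l := fun l => by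
    simp only [hy, h2, smul_mul_assoc, one_mul, pow_succ]; module
  have hYy : ∀ l, (2 ^ l : ℂ) • y l = Y := fun l => by
    simp only [hy, smul_smul, ← mul_pow]; norm_num
  have hQQ : ∀ l, star (y l) * y l * (star (y l) * y l)
      = ((1 / 16 : ℂ) ^ l) • (star Y * Y * (star Y * Y)) := fun l => by
    simp only [hy, star_smul, smul_mul_smul_comm]
    congr 1
    simp only [star_pow, ← mul_pow]
    norm_num
  have hPP : ∀ l, y l * star (y l) * (y l * star (y l))
      = ((1 / 16 : ℂ) ^ l) • (Y * star Y * (Y * star Y)) := fun l => by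
    simp only [hy, star_smul, smul_mul_smul_comm]
    congr 1
    simp only [star_pow, ← mul_pow]
    norm_num
  set T : ℕ → 𝒜 := fun l => star (y l) * y l * (star (y l) * y l) with hTdef
  have hT : ∀ l, 0 ≤ T l := fun l => by
    have := star_mul_self_nonneg (star (y l) * y l)
    rwa [(IsSelfAdjoint.star_mul_self (y l)).star_eq] at this
  refine ⟨fun l => (2 ^ l : ℂ) • (y l * (resolv (T l) * resolv (T l))), ?_, ?_, fun l => ?_⟩
  · have h1 := norm_mul_resolv_sq_le_one (y 0)
    have h3 := norm_resolv_le (hT 0)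
    simp only [pow_zero, one_smul, ← mul_assoc]
    refine (norm_mul_le _ _).trans ?_
    exact mul_le_one₀ h1 (norm_nonneg _) h3
  · have hT0 : Filter.Tendsto T Filter.atTop (nhds 0) := by
      have h1 : Filter.Tendsto (fun l : ℕ => (1 / 16 : ℂ) ^ l) Filter.atTop (nhds 0) :=
        tendsto_pow_atTop_nhds_zero_of_norm_lt_one (by norm_num)
      have := h1.smul_const (star Y * Y * (star Y * Y))
      rw [zero_smul] at this
      exact this.congr fun l => (hQQ l).symm
    have hr : Filter.Tendsto (fun l => resolv (T l)) Filter.atTop (nhds 1) := by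
      rw [tendsto_iff_norm_sub_tendsto_zero]
      refine squeeze_zero (fun _ => norm_nonneg _) (fun l => ?_) (tendsto_norm_zero.comp hT0)
      rw [← norm_neg, neg_sub, one_sub_resolv (hT l)]
      refine (norm_mul_le _ _).trans ?_
      exact mul_le_of_le_one_right (norm_nonneg _) (norm_resolv_le (hT l))
    have := (tendsto_const_nhds (x := Y)).mul (hr.mul hr)
    rw [mul_one, mul_one] at this
    refine this.congr fun l => ?_
    rw [← smul_mul_assoc, hYy]
  · obtain ⟨g, hg, hgg⟩ := exists_sandwich_resolv_sub (y (l + 1))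
    rw [hyy] at hgg
    refine ⟨g, y l * star (y l), star (y l) * y l, hg, IsSelfAdjoint.mul_star_self _,
      IsSelfAdjoint.star_mul_self _, hPP l, hQQ l, ?_⟩
    rw [mul_comm (60 : ℂ), ← smul_smul, ← hgg, smul_sub]
    congr 1
    change (2 ^ (l + 1) : ℂ) • (y (l + 1) * (resolv (T (l + 1)) * resolv (T (l + 1))))
      = (2 ^ l : ℂ) • (y l * (resolv (T (l + 1)) * resolv (T (l + 1))))
    rw [← smul_mul_assoc, ← smul_mul_assoc, hYy, hYy]

end Telescope

section FiniteBound

variable {A B : Type*} [CStarAlgebra A] [PartialOrder A] [StarOrderedRing A]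
  [CStarAlgebra B] [PartialOrder B] [StarOrderedRing B]
  {ι : Type} [Fintype ι] [DecidableEq ι]

lemma IsWSup.wform_contraction_le {u : A →ₗ[ℂ] B →ₗ[ℂ] ℂ} {J : ℝ} (hJ0 : 0 ≤ J) (hJ : IsWSup u J)
    {s : ι → ℝ} (hs : ∑ i, s i ^ 2 = 1) {h : CStarMatrix ι ι A} (hh : ‖h‖ ≤ 1)
    {Y : CStarMatrix ι ι B} {R C : B} (hY : TupleMoments s Y R C) (hRC : ‖R‖ + ‖C‖ ≤ 1) :
    ‖wform u s h Y‖ ≤ 601 * J := by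
  obtain ⟨V, hV0, hVlim, hV⟩ := exists_telescope Y
  have hb : ∀ x, ‖wform u s h x‖ ≤ J * ‖x‖ := fun x => by
    refine (hJ.1 ι s hs h x).trans ?_
    have := mul_le_mul_of_nonneg_left hh (mul_nonneg hJ0 (norm_nonneg x))
    nlinarith
  have hstep : ∀ l, ‖wform u s h (V (l + 1) - V l)‖ ≤ 300 * J * (1 / 2) ^ l := fun l => by
    obtain ⟨g, P, Q, hg, hP, hQ, hPP, hQQ, e⟩ := hV l
    have hσ : ‖wdiag s (P * P)‖ + ‖wdiag s (Q * Q)‖ ≤ ((1 / 4 : ℝ) ^ l) ^ 2 := by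
      rw [hPP, hQQ, map_smul, map_smul, norm_smul, norm_smul, norm_pow]
      have h1 := hY.row_four
      have h2 := hY.col_four
      have h3 : ‖wdiag s (Y * star Y * (Y * star Y))‖
          + ‖wdiag s (star Y * Y * (star Y * Y))‖ ≤ 1 := by
        nlinarith [norm_nonneg R, norm_nonneg C]
      have h4 : ((1 / 4 : ℝ) ^ l) ^ 2 = (1 / 16) ^ l := by
        rw [← pow_mul, mul_comm, pow_mul]
        norm_num
      rw [h4, ← mul_add]
      have h5 : ‖(1 / 16 : ℂ)‖ = 1 / 16 := by norm_num
      rw [h5]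
      exact mul_le_of_le_one_right (by positivity) h3
    have := hJ.wform_sandwich_le hJ0 hs hh hg hP hQ (by positivity) hσ
    rw [e, map_smul, norm_smul]
    calc _ ≤ (60 * 2 ^ l) * (5 * J * (1 / 4) ^ l) := by
          gcongr
          rw [norm_mul, norm_pow]; norm_num
      _ = 300 * J * (2 ^ l * (1 / 4) ^ l) := by ring
      _ = _ := by rw [← mul_pow]; norm_num
  have hind : ∀ l, ‖wform u s h (V l)‖ ≤ J * (601 - 600 * (1 / 2) ^ l) := fun l => by
    induction l with
    | zero => exact (hb _).trans (by nlinarith)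
    | succ l ih =>
      have e : wform u s h (V (l + 1)) = wform u s h (V l) + wform u s h (V (l + 1) - V l) := by
        rw [← map_add]; congr 1; abel
      rw [e, pow_succ]
      have := hstep l
      refine (norm_add_le _ _).trans ?_
      nlinarith
  have hlim : Filter.Tendsto (fun l => J * ‖Y - V l‖) Filter.atTop (nhds 0) := by
    have := (tendsto_const_nhds (x := Y)).sub hVlim
    rw [sub_self] at this
    simpa using this.norm.const_mul J
  refine le_of_forall_pos_le_add fun ε hε => ?_
  obtain ⟨l, hl⟩ := (hlim.eventually (gt_mem_nhds hε)).exists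
  have e : wform u s h Y = wform u s h (V l) + wform u s h (Y - V l) := by
    rw [← map_add]; congr 1; abel
  rw [e]
  refine (norm_add_le _ _).trans ?_
  have h1 := hind l
  have h2 := hb (Y - V l)
  have h3 : 0 ≤ J * (600 * (1 / 2) ^ l) := by positivity
  nlinarith

/-- Normalised tuples for the one-parameter interpolated row and column norms. -/
structure IsNormalTuple {κ : Type} [Fintype κ] (a : κ → A) (b : κ → B) (t : κ → ℝ) (p q : ℝ) :
    Prop where
  pos : ∀ k, 0 < t k
  add_eq : p + q = 1
  row : ‖∑ k, a k * star (a k)‖ ≤ p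
  col : ‖∑ k, star (b k) * b k‖ ≤ p
  col' : ‖∑ k, (t k : ℂ) • (star (a k) * a k)‖ ≤ q
  row' : ‖∑ k, (t k : ℂ)⁻¹ • (b k * star (b k))‖ ≤ q

/-- `K` bounds the form on all normalised tuples indexed by `κ`. -/
def TupleBound (u : A →ₗ[ℂ] B →ₗ[ℂ] ℂ) (κ : Type) [Fintype κ] (K : ℝ) : Prop :=
  ∀ (a : κ → A) (b : κ → B) (t : κ → ℝ) (p q : ℝ), IsNormalTuple a b t p q →
    ‖∑ k, u (a k) (b k)‖ ≤ K

lemma WBound.norm_apply_le {u : A →ₗ[ℂ] B →ₗ[ℂ] ℂ} {J : ℝ} (hJ0 : 0 ≤ J) (hJ : WBound u J)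
    (a : A) (b : B) : ‖u a b‖ ≤ J * ‖a‖ * ‖b‖ := by
  have hs : ∑ i : Unit, (fun _ => (1 : ℝ)) i ^ 2 = 1 := by simp
  have := hJ Unit (fun _ => 1) hs (ampD Unit a) (ampD Unit b)
  rw [wform_ampD_right, wdiag_ampD hs] at this
  refine this.trans ?_
  gcongr <;> exact NonUnitalStarAlgHom.norm_apply_le _ _

lemma norm_le_one_of_norm_sum_mul_star_le_one {κ : Type} [Fintype κ] {a : κ → A}
    (h : ‖∑ k, a k * star (a k)‖ ≤ 1) (k : κ) : ‖a k‖ ≤ 1 := by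
  have h1 : a k * star (a k) ≤ ∑ k, a k * star (a k) :=
    Finset.single_le_sum (f := fun k => a k * star (a k)) (fun k _ => mul_star_self_nonneg (a k))
      (Finset.mem_univ k)
  have h2 := CStarAlgebra.norm_le_norm_of_nonneg_of_le (mul_star_self_nonneg (a k)) h1
  rw [CStarRing.norm_self_mul_star] at h2
  nlinarith [norm_nonneg (a k)]

lemma WBound.tupleBound_card {u : A →ₗ[ℂ] B →ₗ[ℂ] ℂ} {J : ℝ} (hJ0 : 0 ≤ J) (hJ : WBound u J)
    (κ : Type) [Fintype κ] : TupleBound u κ (Fintype.card κ * J) := by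
  intro a b t p q h
  have hq : 0 ≤ q := (norm_nonneg _).trans h.col'
  have hp : p ≤ 1 := by linarith [h.add_eq]
  have ha := norm_le_one_of_norm_sum_mul_star_le_one (h.row.trans hp)
  have hb := norm_le_one_of_norm_sum_mul_star_le_one (a := fun k => star (b k))
    (by simpa using h.col.trans hp)
  refine (norm_sum_le _ _).trans ?_
  rw [← nsmul_eq_mul, ← Finset.card_univ]
  refine Finset.sum_le_card_nsmul _ _ _ fun k _ => (hJ.norm_apply_le hJ0 _ _).trans ?_
  have hb' : ‖b k‖ ≤ 1 := by simpa using hb k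
  calc J * ‖a k‖ * ‖b k‖ ≤ J * 1 * 1 := by gcongr; exact ha k
    _ = J := by ring

lemma norm_sixteen_wdiag_le {s : ι → ℝ} {M N : CStarMatrix ι ι A} {x : A} (hx : 0 ≤ x)
    (hxM : x ≤ wdiag s M) (h : 16 * M ≤ N) : 16 * ‖x‖ ≤ ‖wdiag s N‖ := by
  have h16 : (16 : CStarMatrix ι ι A) * M = (16 : ℂ) • M := by
    rw [Algebra.smul_def, map_ofNat]
  have h1 : ((4 : ℝ) : ℂ) ^ 2 • x ≤ ((4 : ℝ) : ℂ) ^ 2 • wdiag s M := sq_smul_mono 4 hxM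
  have e : ((4 : ℝ) : ℂ) ^ 2 = 16 := by norm_num
  rw [e, ← map_smul, ← h16] at h1
  have h0 := sq_smul_nonneg 4 hx
  rw [e] at h0
  have := CStarAlgebra.norm_le_norm_of_nonneg_of_le h0 (h1.trans (wdiag_mono s h))
  rw [norm_smul] at this
  simpa using this

lemma IsWSup.tupleBound_step {u : A →ₗ[ℂ] B →ₗ[ℂ] ℂ} {J K : ℝ} (hJ0 : 0 ≤ J) (hJ : IsWSup u J)
    {κ : Type} [Fintype κ] (hK : TupleBound u κ K) : TupleBound u κ (601 * J + K / 4) := by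
  intro a b t p q h
  have hq0 : 0 ≤ q := (norm_nonneg _).trans h.col'
  have hp0 : 0 ≤ p := (norm_nonneg _).trans h.row
  have hpq := h.add_eq
  have hrow := h.row
  have hcol := h.col
  have hrow' := h.row'
  have hcol' := h.col'
  obtain ⟨ι, _, _, s, X, Y, hs, -, hX, hY, hu, hB⟩ := exists_car_tuple u a b t h.pos
  obtain ⟨Xb, Xr, hXe, hXb, hr1, hr2⟩ := exists_truncation X
  obtain ⟨E, hE1, hE2, hE3⟩ := hB Xr
  have hn1 : 16 * ‖∑ k, E k * star (E k)‖ ≤ p := by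
    refine (norm_sixteen_wdiag_le (Finset.sum_nonneg fun k _ => mul_star_self_nonneg _) hE2
      hr2).trans (hX.row_four.trans ?_)
    nlinarith [norm_nonneg (∑ k, a k * star (a k)),
      norm_nonneg (∑ k, (t k : ℂ) • (star (a k) * a k))]
  have hn2 : 16 * ‖∑ k, (t k : ℂ) • (star (E k) * E k)‖ ≤ q := by
    refine (norm_sixteen_wdiag_le (Finset.sum_nonneg fun k _ => ?_) hE3
      hr1).trans (hX.col_four.trans ?_)
    · have := sq_smul_nonneg (Real.sqrt (t k)) (star_mul_self_nonneg (E k))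
      rwa [← Complex.ofReal_pow, Real.sq_sqrt (h.pos k).le] at this
    nlinarith [norm_nonneg (∑ k, a k * star (a k)),
      norm_nonneg (∑ k, (t k : ℂ) • (star (a k) * a k))]
  have hnt : IsNormalTuple (fun k => (4 : ℂ) • E k) b t p q := by
    refine ⟨h.pos, hpq, ?_, hcol, ?_, hrow'⟩
    · simp only [star_smul, smul_mul_smul_comm, ← Finset.smul_sum, norm_smul]
      norm_num; exact hn1
    · simp only [star_smul, smul_mul_smul_comm, smul_comm _ (star (4 : ℂ) * 4), ← Finset.smul_sum,
        norm_smul]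
      norm_num; exact hn2
  have h1 := hK _ _ _ _ _ hnt
  simp only [map_smul, LinearMap.smul_apply, ← Finset.smul_sum, norm_smul] at h1
  rw [← hu]
  have e : wform u s X Y = wform u s Xb Y + wform u s Xr Y := by
    rw [← LinearMap.add_apply, ← map_add, ← hXe]
  rw [e, hE1]
  refine (norm_add_le _ _).trans (add_le_add
    (hJ.wform_contraction_le hJ0 hs hXb hY (by linarith)) ?_)
  norm_num at h1
  linarith

lemma WBound.tupleBound {u : A →ₗ[ℂ] B →ₗ[ℂ] ℂ} {J : ℝ} (hJ0 : 0 ≤ J) (hJ : WBound u J)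
    (κ : Type) [Fintype κ] : TupleBound u κ (802 * J) := by
  obtain ⟨J₀, hJ₀0, hJ₀J, hJ₀⟩ := hJ.exists_isWSup hJ0
  have hind : ∀ n : ℕ, TupleBound u κ (802 * J + Fintype.card κ * J * (1 / 4) ^ n) := fun n => by
    induction n with
    | zero =>
      intro a b t p q h
      refine (hJ.tupleBound_card hJ0 κ a b t p q h).trans ?_
      rw [pow_zero, mul_one]; linarith
    | succ n ih =>
      intro a b t p q h
      refine (hJ₀.tupleBound_step hJ₀0 ih a b t p q h).trans ?_
      rw [pow_succ]; linarith
  intro a b t p q h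
  have hlim : Filter.Tendsto (fun n : ℕ => 802 * J + Fintype.card κ * J * (1 / 4) ^ n) Filter.atTop
      (nhds (802 * J + Fintype.card κ * J * 0)) :=
    ((tendsto_pow_atTop_nhds_zero_of_lt_one (by norm_num) (by norm_num)).const_mul _).const_add _
  rw [mul_zero, add_zero] at hlim
  exact ge_of_tendsto' hlim fun n => hind n a b t p q h

end FiniteBound

section ComplexPowers

variable {𝒜 : Type*} [CStarAlgebra 𝒜] [PartialOrder 𝒜] [StarOrderedRing 𝒜]

lemma exists_exp_eq_star_mul_self_add (X : 𝒜) {δ : ℝ} (hδ : 0 < δ) :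
    ∃ L : 𝒜, IsSelfAdjoint L ∧ NormedSpace.exp L = star X * X + (δ : ℂ) • 1 := by
  have h1 : ((δ : ℂ) • (1 : 𝒜)) = algebraMap ℝ 𝒜 δ := by
    rw [Complex.coe_smul, Algebra.algebraMap_eq_smul_one]
  have h2 : IsStrictlyPositive (algebraMap ℝ 𝒜 δ) := by
    rcases subsingleton_or_nontrivial 𝒜 with h | h
    · exact ⟨(Subsingleton.elim _ _).le, isUnit_of_subsingleton _⟩
    · exact isStrictlyPositive_algebraMap hδ
  have h3 : algebraMap ℝ 𝒜 δ ≤ star X * X + algebraMap ℝ 𝒜 δ :=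
    le_add_of_nonneg_left (star_mul_self_nonneg X)
  have h4 : IsStrictlyPositive (star X * X + algebraMap ℝ 𝒜 δ) :=
    ⟨h2.nonneg.trans h3, CStarAlgebra.isUnit_of_le _ h3⟩
  rw [h1]
  exact ⟨CFC.log _, IsSelfAdjoint.log, CFC.exp_log _ h4⟩

/-- The analytic family `w ↦ X (X* X + δ)^w`. -/
lemma exists_analytic_family (X : 𝒜) {δ : ℝ} (hδ : 0 < δ) :
    ∃ f : ℂ → 𝒜, Differentiable ℂ f ∧ f 0 = X ∧ (∃ C, ∀ w : ℂ, |w.re| ≤ 1 / 2 → ‖f w‖ ≤ C) ∧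
      (∀ w : ℂ, w.re = -1 / 2 → ‖f w‖ ≤ 1) ∧
      ∀ w : ℂ, w.re = 1 / 2 →
        f w * star (f w) = X * star X * (X * star X) + (δ : ℂ) • (X * star X) ∧
        star (f w) * f w = star X * X * (star X * X) + (δ : ℂ) • (star X * X) := by
  obtain ⟨L, hL, hT⟩ := exists_exp_eq_star_mul_self_add X hδ
  set E : ℂ → 𝒜 := fun w => NormedSpace.exp (w • L) with hE
  have hE0 : E 0 = 1 := by simp [hE]
  have hE1 : E 1 = star X * X + (δ : ℂ) • 1 := by simp [hE, hT]
  have hadd : ∀ z w, E (z + w) = E z * E w := fun z w => by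
    simp only [hE, add_smul]
    let _ : NormedAlgebra ℚ 𝒜 := NormedAlgebra.restrictScalars ℚ ℂ 𝒜
    refine NormedSpace.exp_add_of_commute ?_
    exact ((Commute.refl L).smul_left z).smul_right w
  have hstar : ∀ z, star (E z) = E (star z) := fun z => by
    simp only [hE]
    rw [NormedSpace.star_exp, star_smul, hL.star_eq]
  have hre : ∀ z : ℂ, z + star z = ((2 * z.re : ℝ) : ℂ) := fun z => by
    apply Complex.ext <;> simp; ring
  have hre' : ∀ z : ℂ, star z + z = ((2 * z.re : ℝ) : ℂ) := fun z => by rw [add_comm, hre]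
  have hXX : star X * X = E 1 - (δ : ℂ) • 1 := by rw [hE1]; abel
  have hdE : Differentiable ℂ E := fun w => (hasDerivAt_exp_smul_const L w).differentiableAt
  have hcomm : ∀ z, E z * (star X * X) = star X * X * E z := fun z => by
    rw [hXX, mul_sub, sub_mul, ← hadd, ← hadd, add_comm]
    simp
  have hsf : ∀ w, star (X * E w) * (X * E w) = star X * X * E ((2 * w.re : ℝ) : ℂ) := fun w => by
    rw [← hre', hadd, star_mul, hstar]
    calc _ = E (star w) * (star X * X) * E w := by simp only [mul_assoc]
      _ = _ := by rw [hcomm, mul_assoc]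
  have hfs : ∀ w, (X * E w) * star (X * E w) = X * E ((2 * w.re : ℝ) : ℂ) * star X := fun w => by
    rw [← hre, hadd, star_mul, hstar]
    simp only [mul_assoc]
  refine ⟨fun w => X * E w, hdE.const_mul X, by simp only [hE0, mul_one], ?_, ?_, ?_⟩
  · have hc : Continuous fun x : ℝ => E x := hdE.continuous.comp Complex.continuous_ofReal
    obtain ⟨C, hC⟩ := isCompact_Icc.exists_bound_of_continuousOn
      (s := Set.Icc (-1 : ℝ) 1) hc.continuousOn
    refine ⟨‖X‖ * Real.sqrt C, fun w hw => (norm_mul_le _ _).trans ?_⟩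
    gcongr
    apply Real.le_sqrt_of_sq_le
    rw [pow_two, ← CStarRing.norm_star_mul_self, hstar, ← hadd, hre']
    refine hC _ ?_
    rw [abs_le] at hw
    constructor <;> linarith [hw.1, hw.2]
  · intro w hw
    rw [norm_le_one_iff_star_mul_le_one, hsf, hw, hXX]
    have e : ((2 * (-1 / 2) : ℝ) : ℂ) = -1 := by norm_num
    rw [e, sub_mul, ← hadd, add_neg_cancel, hE0, smul_mul_assoc, one_mul]
    have h1 : E (-1) = star (E (-(1 / 2))) * E (-(1 / 2)) := by
      rw [hstar, ← hadd]; congr 1; simp; norm_num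
    have h2 := sq_smul_nonneg (Real.sqrt δ) (star_mul_self_nonneg (E (-(1 / 2))))
    rw [← h1, ← Complex.ofReal_pow, Real.sq_sqrt hδ.le] at h2
    exact sub_le_self _ h2
  · intro w hw
    rw [hfs, hsf, hw]
    have e : ((2 * (1 / 2) : ℝ) : ℂ) = 1 := by norm_num
    rw [e, hE1]
    constructor
    · rw [mul_add, add_mul]; simp [mul_assoc]
    · rw [mul_add]; simp [mul_assoc]

end ComplexPowers

section ThreeLines

variable {A B : Type*} [CStarAlgebra A] [PartialOrder A] [StarOrderedRing A]
  [CStarAlgebra B] [PartialOrder B] [StarOrderedRing B]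
  {ι : Type} [Fintype ι] [DecidableEq ι]

omit [DecidableEq ι] [PartialOrder A] [StarOrderedRing A] [PartialOrder B] [StarOrderedRing B] in
/-- A tuple bound controls weighted amplifications through their second moments. -/
lemma TupleBound.wform_le {u : A →ₗ[ℂ] B →ₗ[ℂ] ℂ} {K : ℝ}
    (hK : TupleBound u (ι × ι) K) {s : ι → ℝ} (hs0 : ∀ i, 0 < s i) {X : CStarMatrix ι ι A}
    {Y : CStarMatrix ι ι B} {p q r : ℝ} (hr : 0 < r) (hpq : p + q = 1)
    (h1 : ‖wdiag s (X * star X)‖ ≤ r * p) (h2 : ‖wdiag s (star Y * Y)‖ ≤ r * p)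
    (h3 : ‖wdiag s (star X * X)‖ ≤ r * q) (h4 : ‖wdiag s (Y * star Y)‖ ≤ r * q) :
    ‖wform u s X Y‖ ≤ r * K := by
  set ρ : ℂ := (((Real.sqrt r)⁻¹ : ℝ) : ℂ) with hρ
  have hρ2 : ρ * ρ = (r : ℂ)⁻¹ := by
    rw [hρ, ← Complex.ofReal_mul, ← mul_inv, Real.mul_self_sqrt hr.le, Complex.ofReal_inv]
  have hρs : star ρ = ρ := Complex.conj_ofReal _
  have hρn : ‖(r : ℂ)⁻¹‖ = r⁻¹ := by
    rw [norm_inv, Complex.norm_real, Real.norm_of_nonneg hr.le]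
  have hsc : ∀ i, (s i : ℂ) ≠ 0 := fun i => by exact_mod_cast (hs0 i).ne'
  have key : ∀ {x p : ℝ}, x ≤ r * p → r⁻¹ * x ≤ p := fun h => by
    rwa [inv_mul_le_iff₀ hr]
  have hn : IsNormalTuple (fun k : ι × ι => (ρ * s k.1) • X k.1 k.2)
      (fun k : ι × ι => (ρ * s k.2) • Y k.1 k.2) (fun k => s k.2 ^ 2 / s k.1 ^ 2) p q := by
    refine ⟨fun k => div_pos (pow_pos (hs0 _) 2) (pow_pos (hs0 _) 2), hpq, ?_, ?_, ?_, ?_⟩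
    · convert key h1
      rw [← hρn, ← norm_smul, wdiag_apply, Fintype.sum_prod_type, Finset.smul_sum]
      congr 1
      refine Finset.sum_congr rfl fun i _ => ?_
      rw [CStarMatrix.mul_apply, Finset.smul_sum, Finset.smul_sum]
      refine Finset.sum_congr rfl fun j _ => ?_
      simp only [star_smul, star_mul', hρs, RCLike.star_def, Complex.conj_ofReal,
        smul_mul_smul_comm, CStarMatrix.star_apply, smul_smul, ← hρ2]
      congr 1; ring
    · convert key h2
      rw [← hρn, ← norm_smul, wdiag_apply, Fintype.sum_prod_type_right, Finset.smul_sum]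
      congr 1
      refine Finset.sum_congr rfl fun i _ => ?_
      rw [CStarMatrix.mul_apply, Finset.smul_sum, Finset.smul_sum]
      refine Finset.sum_congr rfl fun j _ => ?_
      simp only [star_smul, star_mul', hρs, RCLike.star_def, Complex.conj_ofReal,
        smul_mul_smul_comm, CStarMatrix.star_apply, smul_smul, ← hρ2]
      congr 1; ring
    · convert key h3
      rw [← hρn, ← norm_smul, wdiag_apply, Fintype.sum_prod_type_right, Finset.smul_sum]
      congr 1
      refine Finset.sum_congr rfl fun i _ => ?_
      rw [CStarMatrix.mul_apply, Finset.smul_sum, Finset.smul_sum]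
      refine Finset.sum_congr rfl fun j _ => ?_
      simp only [star_smul, star_mul', hρs, RCLike.star_def, Complex.conj_ofReal,
        smul_mul_smul_comm, CStarMatrix.star_apply, smul_smul, ← hρ2]
      congr 1; push_cast; have := hsc j; field_simp
    · convert key h4
      rw [← hρn, ← norm_smul, wdiag_apply, Fintype.sum_prod_type, Finset.smul_sum]
      congr 1
      refine Finset.sum_congr rfl fun i _ => ?_
      rw [CStarMatrix.mul_apply, Finset.smul_sum, Finset.smul_sum]
      refine Finset.sum_congr rfl fun j _ => ?_
      simp only [star_smul, star_mul', hρs, RCLike.star_def, Complex.conj_ofReal,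
        smul_mul_smul_comm, CStarMatrix.star_apply, smul_smul, ← hρ2]
      congr 1; push_cast; have := hsc j; field_simp
  have := hK _ _ _ _ _ hn
  rw [← inv_mul_le_iff₀ hr]
  refine le_trans (le_of_eq ?_) this
  rw [← hρn, ← norm_mul, wform_apply, Fintype.sum_prod_type, Finset.mul_sum]
  congr 1
  refine Finset.sum_congr rfl fun i _ => ?_
  rw [Finset.mul_sum]
  refine Finset.sum_congr rfl fun j _ => ?_
  simp only [map_smul, LinearMap.smul_apply, smul_eq_mul, ← hρ2]
  ring

omit [DecidableEq ι] [PartialOrder A] [StarOrderedRing A] in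
lemma TupleMoments.shift_le {s : ι → ℝ} {X : CStarMatrix ι ι A} {R C : A} {p q δ : ℝ}
    (h : TupleMoments s X R C) (hδ : 0 < δ) (hR : ‖R‖ ≤ p) (hC : ‖C‖ ≤ q) (hpq : p + q = 1) :
    ‖wdiag s (X * star X * (X * star X) + (δ : ℂ) • (X * star X))‖ ≤ (1 + δ) * p ∧
    ‖wdiag s (star X * X * (star X * X) + (δ : ℂ) • (star X * X))‖ ≤ (1 + δ) * q := by
  have hδn : ‖(δ : ℂ)‖ = δ := by rw [Complex.norm_real, Real.norm_of_nonneg hδ.le]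
  have h1 := h.row_four
  have h2 := h.col_four
  have h3 := norm_nonneg R
  have h4 := norm_nonneg C
  constructor
  · rw [map_add, map_smul, h.row, add_mul, one_mul]
    refine (norm_add_le _ _).trans (add_le_add ?_ ?_)
    · nlinarith
    · rw [norm_smul, hδn]; gcongr
  · rw [map_add, map_smul, h.col, add_mul, one_mul]
    refine (norm_add_le _ _).trans (add_le_add ?_ ?_)
    · nlinarith
    · rw [norm_smul, hδn]; gcongr

lemma WBound.norm_wform_le_interp {u : A →ₗ[ℂ] B →ₗ[ℂ] ℂ} {J K : ℝ} (hJ0 : 0 ≤ J)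
    (hJ : WBound u J) (hK : TupleBound u (ι × ι) K) {s : ι → ℝ} (hs : ∑ i, s i ^ 2 = 1)
    (hs0 : ∀ i, 0 < s i) {X : CStarMatrix ι ι A} {Y : CStarMatrix ι ι B} {R C : A} {R' C' : B}
    (hX : TupleMoments s X R C) (hY : TupleMoments s Y R' C') {p q δ : ℝ} (hδ : 0 < δ)
    (hpq : p + q = 1) (hR : ‖R‖ ≤ p) (hC : ‖C‖ ≤ q) (hR' : ‖R'‖ ≤ q) (hC' : ‖C'‖ ≤ p) :
    ‖wform u s X Y‖ ≤ J ^ (1 / 2 : ℝ) * ((1 + δ) * K) ^ (1 / 2 : ℝ) := by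
  obtain ⟨f, hf, hf0, ⟨Cf, hCf⟩, hfl, hfr⟩ := exists_analytic_family X hδ
  obtain ⟨g, hg, hg0, ⟨Cg, hCg⟩, hgl, hgr⟩ := exists_analytic_family Y hδ
  let Φ := LinearMap.mkContinuous₂ (wform u s) J (hJ ι s hs)
  have hΦ : ∀ x y, Φ x y = wform u s x y := fun x y => rfl
  set F : ℂ → ℂ := fun z => Φ (f (z - 1 / 2)) (g (z - 1 / 2)) with hF
  have hsub : Differentiable ℂ fun z : ℂ => z - 1 / 2 := differentiable_id.sub_const _
  have hdF : Differentiable ℂ F :=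
    (Φ.differentiable.comp (hf.comp hsub)).clm_apply (hg.comp hsub)
  have hb : ∀ x y, ‖Φ x y‖ ≤ J * ‖x‖ * ‖y‖ := hJ ι s hs
  have hbd : BddAbove ((norm ∘ F) '' Complex.HadamardThreeLines.verticalClosedStrip 0 1) := by
    refine ⟨J * Cf * Cg, ?_⟩
    rintro _ ⟨z, hz, rfl⟩
    have hz' : |(z - 1 / 2).re| ≤ 1 / 2 := by
      have h1 : 0 ≤ z.re ∧ z.re ≤ 1 := hz
      rw [abs_le]
      constructor <;> simp <;> norm_num <;> linarith [h1.1, h1.2]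
    have h1 := hCf _ hz'
    have h2 := hCg _ hz'
    refine (hb _ _).trans ?_
    have := (norm_nonneg _).trans h1
    gcongr
  have hmain := Complex.HadamardThreeLines.norm_le_interp_of_mem_verticalClosedStrip₀₁' F
    (z := 1 / 2) (a := J) (b := (1 + δ) * K) ?_ hdF.diffContOnCl hbd ?_ ?_
  · rw [hF] at hmain
    norm_num at hmain
    rw [hf0, hg0, hΦ] at hmain
    convert hmain using 3
  · change _ ∧ _
    norm_num
  · intro z hz
    have hz' : (z - 1 / 2).re = -1 / 2 := by
      have : z.re = 0 := hz
      simp [this]; norm_num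
    refine (hb _ _).trans ?_
    have h1 := hfl _ hz'
    have h2 := hgl _ hz'
    calc _ ≤ J * 1 * 1 := by gcongr
      _ = J := by ring
  · intro z hz
    have hz' : (z - 1 / 2).re = 1 / 2 := by
      have : z.re = 1 := hz
      simp [this]; norm_num
    obtain ⟨h1, h2⟩ := hfr _ hz'
    obtain ⟨h3, h4⟩ := hgr _ hz'
    obtain ⟨m1, m2⟩ := hX.shift_le hδ hR hC hpq
    obtain ⟨m3, m4⟩ := hY.shift_le hδ hR' hC' (by linarith)
    exact hK.wform_le hs0 (by linarith) hpq (by rwa [h1]) (by rwa [h4]) (by rwa [h2]) (by rwa [h3])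

lemma WBound.tupleBound_sqrt {u : A →ₗ[ℂ] B →ₗ[ℂ] ℂ} {J K : ℝ} (hJ0 : 0 ≤ J) (hK0 : 0 ≤ K)
    (hJ : WBound u J) (hK : ∀ (κ : Type) [Fintype κ], TupleBound u κ K)
    (κ : Type) [Fintype κ] : TupleBound u κ (Real.sqrt (J * K)) := by
  intro a b t p q h
  obtain ⟨ι, _, _, s, X, Y, hs, hs0, hX, hY, hu, -⟩ := exists_car_tuple u a b t h.pos
  have hle : ∀ δ : ℝ, 0 < δ → ‖∑ k, u (a k) (b k)‖ ≤ Real.sqrt (J * ((1 + δ) * K)) := fun δ hδ => by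
    rw [← hu, Real.sqrt_eq_rpow, Real.mul_rpow hJ0 (by positivity)]
    exact hJ.norm_wform_le_interp hJ0 (hK _) hs hs0 hX hY hδ h.add_eq h.row h.col' h.row' h.col
  have hc : Filter.Tendsto (fun δ : ℝ => Real.sqrt (J * ((1 + δ) * K))) (nhdsWithin 0 (Set.Ioi 0))
      (nhds (Real.sqrt (J * ((1 + 0) * K)))) :=
    (Continuous.tendsto (by fun_prop) 0).mono_left nhdsWithin_le_nhds
  rw [add_zero, one_mul] at hc
  exact ge_of_tendsto hc (by filter_upwards [self_mem_nhdsWithin] with δ hδ using hle δ hδ)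

/-- The sharp bound on normalised tuples. -/
lemma WBound.tupleBound_sharp {u : A →ₗ[ℂ] B →ₗ[ℂ] ℂ} {J : ℝ} (hJ0 : 0 ≤ J) (hJ : WBound u J)
    (κ : Type) [Fintype κ] : TupleBound u κ J := by
  have hind : ∀ n : ℕ, ∀ (κ : Type) [Fintype κ], TupleBound u κ (J * (1 + 801 * (1 / 2) ^ n)) := by
    intro n
    induction n with
    | zero =>
      intro κ _
      convert hJ.tupleBound hJ0 κ using 1
      ring
    | succ n ih =>
      intro κ _ a b t p q h
      refine (hJ.tupleBound_sqrt hJ0 (by positivity) ih κ a b t p q h).trans ?_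
      have h2 : (0 : ℝ) ≤ (1 / 2) ^ n := by positivity
      rw [Real.sqrt_le_left (by positivity), pow_succ (1 / 2 : ℝ) n]
      have h3 : 0 ≤ J * J := mul_nonneg hJ0 hJ0
      nlinarith [mul_nonneg h3 h2, mul_nonneg h3 (mul_nonneg h2 h2)]
  intro a b t p q h
  have hlim : Filter.Tendsto (fun n : ℕ => J * (1 + 801 * (1 / 2 : ℝ) ^ n)) Filter.atTop
      (nhds (J * (1 + 801 * 0))) :=
    (((tendsto_pow_atTop_nhds_zero_of_lt_one (by norm_num) (by norm_num)).const_mul _).const_add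
      _).const_mul _
  rw [mul_zero, add_zero, mul_one] at hlim
  exact ge_of_tendsto' hlim fun n => hind n κ a b t p q h

end ThreeLines

section MatrixNorm

variable {𝒜 : Type*} [CStarAlgebra 𝒜] [PartialOrder 𝒜] [StarOrderedRing 𝒜]
  {ι : Type} [Fintype ι] [DecidableEq ι]

/-- The embedding of an algebra into its matrix algebra at a diagonal position. -/
noncomputable def cornerHom (i₀ : ι) : 𝒜 →⋆ₙₐ[ℂ] CStarMatrix ι ι 𝒜 where
  toFun c := cmat fun i j => if i = i₀ ∧ j = i₀ then c else 0
  map_smul' r c := by ext i j; simp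
  map_zero' := by ext i j; simp
  map_add' c d := by
    ext i j
    simp only [cmat_apply, CStarMatrix.add_apply]
    split_ifs <;> simp
  map_mul' c d := by
    ext i j
    by_cases hi : i = i₀ <;> by_cases hj : j = i₀ <;> simp [CStarMatrix.mul_apply, hi, hj]
  map_star' c := by
    ext i j
    simp only [cmat_apply, CStarMatrix.star_apply, and_comm (a := i = i₀)]
    split_ifs <;> simp

lemma norm_cornerHom (i₀ : ι) (c : 𝒜) : ‖cornerHom i₀ c‖ = ‖c‖ := by
  refine NonUnitalStarAlgHom.norm_map (cornerHom i₀) (fun c d h => ?_) c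
  have h1 : cornerHom i₀ c i₀ i₀ = cornerHom i₀ d i₀ i₀ := by rw [h]
  simpa [cornerHom] using h1

lemma norm_sum_star_mul_le_of_mul (X : CStarMatrix ι ι 𝒜) (v w : ι → 𝒜)
    (h : ∀ i, w i = ∑ j, X i j * v j) :
    ‖∑ i, star (w i) * w i‖ ≤ ‖X‖ ^ 2 * ‖∑ i, star (v i) * v i‖ := by
  rcases isEmpty_or_nonempty ι with hι | ⟨⟨i₀⟩⟩
  · simp
  let col : (ι → 𝒜) → CStarMatrix ι ι 𝒜 := fun v => cmat fun i j => if j = i₀ then v i else 0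
  have hcol : ∀ v, ‖col v‖ ^ 2 = ‖∑ i, star (v i) * v i‖ := fun v => by
    have e : star (col v) * col v = cornerHom i₀ (∑ i, star (v i) * v i) := by
      ext i j
      simp only [CStarMatrix.mul_apply, CStarMatrix.star_apply, col, cmat_apply]
      change _ = if i = i₀ ∧ j = i₀ then _ else _
      by_cases hi : i = i₀ <;> by_cases hj : j = i₀ <;> simp [hi, hj]
    rw [pow_two, ← CStarRing.norm_star_mul_self, e, norm_cornerHom]
  have hmul : col w = X * col v := by
    ext i j
    simp only [CStarMatrix.mul_apply, col, cmat_apply, h]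
    by_cases hj : j = i₀ <;> simp [hj]
  rw [← hcol, ← hcol, hmul, ← mul_pow]
  gcongr
  exact norm_mul_le _ _

variable {A : Type*} [NonUnitalCStarAlgebra A]

lemma norm_sum_star_mulVec_le (φ : A →⋆ₙₐ[ℂ] 𝒜) (hφ : Function.Injective φ)
    (x : Matrix ι ι A) (v : ι → A) :
    ‖∑ i, star (x.mulVec v i) * x.mulVec v i‖
      ≤ ‖(cmat fun i j => φ (x i j) : CStarMatrix ι ι 𝒜)‖ ^ 2 * ‖∑ i, star (v i) * v i‖ := by
  have := norm_sum_star_mul_le_of_mul (cmat fun i j => φ (x i j) : CStarMatrix ι ι 𝒜)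
    (fun i => φ (v i)) (fun i => φ (x.mulVec v i)) (fun i => by
      simp only [Matrix.mulVec, dotProduct, map_sum, map_mul, cmat_apply])
  simp only [← map_star, ← map_mul, ← map_sum] at this
  rwa [NonUnitalStarAlgHom.norm_map φ hφ, NonUnitalStarAlgHom.norm_map φ hφ] at this

end MatrixNorm

section MatCNorm

variable {A : Type*} [NonUnitalCStarAlgebra A]

lemma matCNorm_nonneg {n : Type*} [Fintype n] (x : Matrix n n A) : 0 ≤ matCNorm x :=
  Real.sSup_nonneg (by rintro _ ⟨v, -, rfl⟩; exact Real.sqrt_nonneg _)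

lemma exists_norm_sum_star_mulVec_le {n : Type} [Fintype n] (x : Matrix n n A) :
    ∃ C : ℝ, 0 ≤ C ∧ ∀ v : n → A,
      ‖∑ i, star (x.mulVec v i) * x.mulVec v i‖ ≤ C ^ 2 * ‖∑ i, star (v i) * v i‖ := by
  classical
  let _ := CStarAlgebra.spectralOrder (Unitization ℂ A)
  have _ := CStarAlgebra.spectralOrderedRing (Unitization ℂ A)
  exact ⟨_, norm_nonneg _, fun v => norm_sum_star_mulVec_le
    (Unitization.inrNonUnitalStarAlgHom ℂ A) Unitization.inr_injective x v⟩

lemma bddAbove_matCNorm {n : Type} [Fintype n] (x : Matrix n n A) :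
    BddAbove {r : ℝ | ∃ v : n → A, ‖∑ i, star (v i) * v i‖ ≤ 1 ∧
      r = Real.sqrt ‖∑ i, star (x.mulVec v i) * x.mulVec v i‖} := by
  obtain ⟨C, hC, h⟩ := exists_norm_sum_star_mulVec_le x
  refine ⟨C, ?_⟩
  rintro _ ⟨v, hv, rfl⟩
  refine Real.sqrt_le_iff.2 ⟨hC, (h v).trans ?_⟩
  exact mul_le_of_le_one_right (by positivity) hv

lemma matCNorm_le {n : Type*} [Fintype n] {x : Matrix n n A} {C : ℝ} (hC : 0 ≤ C)
    (h : ∀ v : n → A, ‖∑ i, star (v i) * v i‖ ≤ 1 →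
      ‖∑ i, star (x.mulVec v i) * x.mulVec v i‖ ≤ C ^ 2) : matCNorm x ≤ C :=
  Real.sSup_le (by rintro _ ⟨v, hv, rfl⟩; exact Real.sqrt_le_iff.2 ⟨hC, h v hv⟩) hC

/-- The matrix norm bounds the action on columns. -/
lemma norm_sum_star_mulVec_le_matCNorm {n : Type} [Fintype n] (x : Matrix n n A) (v : n → A) :
    ‖∑ i, star (x.mulVec v i) * x.mulVec v i‖ ≤ matCNorm x ^ 2 * ‖∑ i, star (v i) * v i‖ := by
  rcases (norm_nonneg (∑ i, star (v i) * v i)).eq_or_lt' with h0 | h0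
  · obtain ⟨C, hC, h⟩ := exists_norm_sum_star_mulVec_le x
    have := h v
    rw [h0, mul_zero] at this ⊢
    exact this
  set c := ‖∑ i, star (v i) * v i‖ with hc
  set ρ : ℂ := (((Real.sqrt c)⁻¹ : ℝ) : ℂ) with hρ
  have hρ2 : star ρ * ρ = (c : ℂ)⁻¹ := by
    rw [hρ, RCLike.star_def, Complex.conj_ofReal, ← Complex.ofReal_mul, ← mul_inv,
      Real.mul_self_sqrt h0.le, Complex.ofReal_inv]
  have hρn : ‖(c : ℂ)⁻¹‖ = c⁻¹ := by
    rw [norm_inv, Complex.norm_real, Real.norm_of_nonneg h0.le]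
  have hs : ∀ w : n → A, ‖∑ i, star (ρ • w i) * (ρ • w i)‖ = c⁻¹ * ‖∑ i, star (w i) * w i‖ :=
    fun w => by
      simp only [star_smul, smul_mul_smul_comm, hρ2, ← Finset.smul_sum, norm_smul, hρn]
  have h1 : Real.sqrt (c⁻¹ * ‖∑ i, star (x.mulVec v i) * x.mulVec v i‖) ≤ matCNorm x := by
    refine le_csSup (bddAbove_matCNorm x) ⟨fun i => ρ • v i, ?_, ?_⟩
    · rw [hs, ← hc, inv_mul_cancel₀ h0.ne']
    · rw [← hs]
      congr! 4 <;> simp [Matrix.mulVec, dotProduct, Finset.smul_sum, mul_smul_comm]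
  rw [Real.sqrt_le_left (matCNorm_nonneg x), inv_mul_le_iff₀ h0] at h1
  linarith

end MatCNorm

section JcbDiagonal

variable {A B : Type*} [NonUnitalCStarAlgebra A] [NonUnitalCStarAlgebra B]

lemma matCNorm_smul_le {n : Type} [Fintype n] (c : ℂ) (x : Matrix n n A) :
    matCNorm (c • x) ≤ ‖c‖ * matCNorm x := by
  refine matCNorm_le (mul_nonneg (norm_nonneg c) (matCNorm_nonneg x)) fun v hv => ?_
  simp only [Matrix.smul_mulVec, Pi.smul_apply, star_smul, smul_mul_smul_comm, ← Finset.smul_sum,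
    norm_smul, norm_mul, norm_star]
  have := norm_sum_star_mulVec_le_matCNorm x v
  rw [mul_pow, ← pow_two]
  gcongr
  exact this.trans (mul_le_of_le_one_right (by positivity) hv)

lemma matCNorm_submatrix_le {m n : Type} [Fintype m] [Fintype n] (e : m ≃ n) (x : Matrix n n A) :
    matCNorm (x.submatrix e e) ≤ matCNorm x := by
  refine matCNorm_le (matCNorm_nonneg x) fun v hv => ?_
  have h := norm_sum_star_mulVec_le_matCNorm x (v ∘ e.symm)
  have h1 : ∑ i, star ((v ∘ e.symm) i) * (v ∘ e.symm) i = ∑ i, star (v i) * v i :=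
    e.symm.sum_comp fun i => star (v i) * v i
  have h2 : ∀ i, (x.submatrix e e).mulVec v i = x.mulVec (v ∘ e.symm) (e i) := fun i => by
    simp only [Matrix.mulVec, dotProduct, Matrix.submatrix_apply, Function.comp]
    rw [← e.sum_comp]
    simp
  simp only [h2]
  rw [e.sum_comp fun i => star (x.mulVec (v ∘ e.symm) i) * x.mulVec (v ∘ e.symm) i]
  rw [h1] at h
  exact h.trans (mul_le_of_le_one_right (by positivity) hv)

lemma norm_dotProduct_mulVec_le {n : Type} [Fintype n] (M : Matrix n n ℂ) (ξ η : n → ℂ)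
    (hξ : ∑ i, ‖ξ i‖ ^ 2 ≤ 1) (hη : ∑ i, ‖η i‖ ^ 2 ≤ 1) :
    ‖∑ i, ξ i * M.mulVec η i‖ ≤ matCNorm M := by
  have hn : ∀ v : n → ℂ, ‖∑ i, star (v i) * v i‖ = ∑ i, ‖v i‖ ^ 2 := fun v => by
    have : ∑ i, star (v i) * v i = ((∑ i, ‖v i‖ ^ 2 : ℝ) : ℂ) := by
      push_cast
      exact Finset.sum_congr rfl fun i _ => Complex.conj_mul' (v i)
    rw [this, Complex.norm_real, Real.norm_of_nonneg (by positivity)]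
  have h := norm_sum_star_mulVec_le_matCNorm M η
  rw [hn, hn] at h
  refine abs_le_of_sq_le_sq' ?_ (matCNorm_nonneg M) |>.2
  calc ‖∑ i, ξ i * M.mulVec η i‖ ^ 2 ≤ (∑ i, ‖ξ i‖ * ‖M.mulVec η i‖) ^ 2 := by
        gcongr
        refine (norm_sum_le _ _).trans (le_of_eq ?_)
        simp only [norm_mul]
    _ ≤ (∑ i, ‖ξ i‖ ^ 2) * ∑ i, ‖M.mulVec η i‖ ^ 2 := Finset.sum_mul_sq_le_sq_mul_sq _ _ _
    _ ≤ 1 * (matCNorm M ^ 2 * 1) := by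
        gcongr
        exact h.trans (by gcongr)
    _ = _ := by ring

lemma jcbNorm_nonneg (u : A →ₗ[ℂ] B →ₗ[ℂ] ℂ) : 0 ≤ jcbNorm u :=
  Real.sSup_nonneg (by rintro _ ⟨n, x, y, -, -, rfl⟩; exact matCNorm_nonneg _)

lemma JointlyCompletelyBounded.norm_diagonal_le {u : A →ₗ[ℂ] B →ₗ[ℂ] ℂ}
    (hu : JointlyCompletelyBounded u) {ι : Type} [Fintype ι] {s : ι → ℝ} (hs : ∑ i, s i ^ 2 = 1)
    {x : Matrix ι ι A} {y : Matrix ι ι B} (hx : matCNorm x ≤ 1) (hy : matCNorm y ≤ 1) :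
    ‖∑ i, ∑ j, ((s i : ℂ) * (s j : ℂ)) * u (x i j) (y i j)‖ ≤ jcbNorm u := by
  classical
  let e := (Fintype.equivFin ι).symm
  set M := jcbAmp u (Fintype.card ι) (x.submatrix e e) (y.submatrix e e) with hM
  have h1 : matCNorm M ≤ jcbNorm u := le_csSup hu
    ⟨_, _, _, (matCNorm_submatrix_le e x).trans hx, (matCNorm_submatrix_le e y).trans hy, rfl⟩
  let ψ : Fin (Fintype.card ι) × Fin (Fintype.card ι) → ℂ :=
    fun p => if p.1 = p.2 then (s (e p.1) : ℂ) else 0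
  have hψ : ∑ p, ‖ψ p‖ ^ 2 ≤ 1 := by
    rw [← hs, ← e.sum_comp, Fintype.sum_prod_type]
    refine le_of_eq (Finset.sum_congr rfl fun i _ => ?_)
    rw [Finset.sum_eq_single i]
    · simp [ψ]
    · intro j _ hj; simp [ψ, hj.symm]
    · simp
  refine le_trans (le_of_eq ?_) ((norm_dotProduct_mulVec_le M ψ ψ hψ hψ).trans h1)
  congr 1
  rw [← e.sum_comp, Fintype.sum_prod_type]
  refine Finset.sum_congr rfl fun i _ => ?_
  rw [Finset.sum_eq_single (f := fun k => ψ (i, k) * M.mulVec ψ (i, k)) i]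
  · rw [← e.sum_comp]
    simp only [Matrix.mulVec, dotProduct, Fintype.sum_prod_type, ψ, mul_ite, mul_zero,
      Finset.sum_ite_eq, Finset.mem_univ, if_true, Finset.mul_sum]
    refine Finset.sum_congr rfl fun j _ => ?_
    simp only [hM, jcbAmp, Matrix.submatrix_apply]
    ring
  · intro j _ hj; simp [ψ, hj.symm]
  · simp

lemma JointlyCompletelyBounded.norm_diagonal_le_mul {u : A →ₗ[ℂ] B →ₗ[ℂ] ℂ}
    (hu : JointlyCompletelyBounded u) {ι : Type} [Fintype ι] {s : ι → ℝ} (hs : ∑ i, s i ^ 2 = 1)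
    {x : Matrix ι ι A} {y : Matrix ι ι B} {c d : ℝ} (hc : 0 < c) (hd : 0 < d)
    (hx : matCNorm x ≤ c) (hy : matCNorm y ≤ d) :
    ‖∑ i, ∑ j, ((s i : ℂ) * (s j : ℂ)) * u (x i j) (y i j)‖ ≤ jcbNorm u * c * d := by
  have hinv : ∀ {r : ℝ}, 0 < r → ‖(r : ℂ)⁻¹‖ = r⁻¹ := fun hr => by
    rw [norm_inv, Complex.norm_real, Real.norm_of_nonneg hr.le]
  have h := hu.norm_diagonal_le hs (x := (c : ℂ)⁻¹ • x) (y := (d : ℂ)⁻¹ • y)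
    ((matCNorm_smul_le _ _).trans (by rw [hinv hc, inv_mul_le_one₀ hc]; exact hx))
    ((matCNorm_smul_le _ _).trans (by rw [hinv hd, inv_mul_le_one₀ hd]; exact hy))
  have e : ∑ i, ∑ j, ((s i : ℂ) * (s j : ℂ)) * u (((c : ℂ)⁻¹ • x) i j) (((d : ℂ)⁻¹ • y) i j)
      = ((c : ℂ)⁻¹ * (d : ℂ)⁻¹) * ∑ i, ∑ j, ((s i : ℂ) * (s j : ℂ)) * u (x i j) (y i j) := by
    simp only [Finset.mul_sum, Matrix.smul_apply, map_smul, LinearMap.smul_apply, smul_eq_mul]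
    refine Finset.sum_congr rfl fun i _ => Finset.sum_congr rfl fun j _ => by ring
  rw [e, norm_mul, norm_mul, hinv hc, hinv hd, ← mul_inv, inv_mul_le_iff₀ (by positivity)] at h
  linarith

end JcbDiagonal

section Corner

variable {A B : Type*} [NonUnitalCStarAlgebra A] [NonUnitalCStarAlgebra B]
  {𝒜 ℬ : Type*} [CStarAlgebra 𝒜] [PartialOrder 𝒜] [StarOrderedRing 𝒜]
  [CStarAlgebra ℬ] [PartialOrder ℬ] [StarOrderedRing ℬ]

lemma matCNorm_corner_le {φ : A →⋆ₙₐ[ℂ] 𝒜} (hφ : Function.Injective φ) {m : 𝒜 →ₗ[ℂ] A} {e : A}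
    (he : ‖e‖ ≤ 1) (hm : ∀ z, φ (m z) = z * φ e) {ι : Type} [Fintype ι] [DecidableEq ι]
    (X : CStarMatrix ι ι 𝒜) : matCNorm (Matrix.of fun i j => m (X i j)) ≤ ‖X‖ := by
  refine matCNorm_le (norm_nonneg X) fun v hv => (norm_sum_star_mulVec_le φ hφ _ v).trans ?_
  have h1 : (cmat fun i j => φ ((Matrix.of fun i j => m (X i j)) i j) : CStarMatrix ι ι 𝒜)
      = X * ampD ι (φ e) := by
    ext i j
    simp only [cmat_apply, Matrix.of_apply, hm, mul_ampD_apply]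
  rw [h1]
  have h2 : ‖X * ampD ι (φ e)‖ ≤ ‖X‖ := by
    refine (norm_mul_le _ _).trans (mul_le_of_le_one_right (norm_nonneg _) ?_)
    exact (NonUnitalStarAlgHom.norm_apply_le _ _).trans
      ((NonUnitalStarAlgHom.norm_apply_le _ _).trans he)
  calc _ ≤ ‖X‖ ^ 2 * 1 := by gcongr
    _ = _ := mul_one _

lemma JointlyCompletelyBounded.wBound_corner {u : A →ₗ[ℂ] B →ₗ[ℂ] ℂ}
    (hu : JointlyCompletelyBounded u) {φ : A →⋆ₙₐ[ℂ] 𝒜} (hφ : Function.Injective φ)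
    {m : 𝒜 →ₗ[ℂ] A} {e : A} (he : ‖e‖ ≤ 1) (hm : ∀ z, φ (m z) = z * φ e)
    {ψ : B →⋆ₙₐ[ℂ] ℬ} (hψ : Function.Injective ψ)
    {m' : ℬ →ₗ[ℂ] B} {f : B} (hf : ‖f‖ ≤ 1) (hm' : ∀ z, ψ (m' z) = z * ψ f) :
    WBound (u.compl₁₂ m m') (jcbNorm u) := by
  intro ι _ _ s hs X Y
  rcases eq_or_ne X 0 with rfl | hX
  · simp
  rcases eq_or_ne Y 0 with rfl | hY
  · simp
  exact hu.norm_diagonal_le_mul hs (norm_pos_iff.2 hX) (norm_pos_iff.2 hY)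
    (matCNorm_corner_le hφ he hm X) (matCNorm_corner_le hψ hf hm' Y)

end Corner

section MixedBound

/-- The two-term Haagerup-type estimate with one-parameter weights. -/
def MixedBound {A B : Type*} [NonUnitalCStarAlgebra A] [NonUnitalCStarAlgebra B]
    (u : A →ₗ[ℂ] B →ₗ[ℂ] ℂ) (J : ℝ) : Prop :=
  ∀ (κ : Type) [Fintype κ] (a : κ → A) (b : κ → B) (t : κ → ℝ), (∀ k, 0 < t k) →
    ∀ α β γ δ : ℝ, 0 < α → 0 < β → 0 < γ → 0 < δ →
      ‖∑ k, a k * star (a k)‖ ≤ α ^ 2 → ‖∑ k, star (b k) * b k‖ ≤ β ^ 2 →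
      ‖∑ k, (t k : ℂ) • (star (a k) * a k)‖ ≤ γ ^ 2 →
      ‖∑ k, (t k : ℂ)⁻¹ • (b k * star (b k))‖ ≤ δ ^ 2 →
      ‖∑ k, u (a k) (b k)‖ ≤ J * (α * β + γ * δ)

lemma WBound.mixedBound {A B : Type*} [CStarAlgebra A] [PartialOrder A] [StarOrderedRing A]
    [CStarAlgebra B] [PartialOrder B] [StarOrderedRing B] {u : A →ₗ[ℂ] B →ₗ[ℂ] ℂ} {J : ℝ}
    (hJ0 : 0 ≤ J) (hJ : WBound u J) : MixedBound u J := by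
  intro κ _ a b t ht α β γ δ hα hβ hγ hδ h1 h2 h3 h4
  set S := α * β + γ * δ with hS
  have hS0 : 0 < S := by positivity
  set μ := Real.sqrt (β / (α * S)) with hμ
  set ν := Real.sqrt (α / (β * S)) with hν
  have hμ2 : μ * μ = β / (α * S) := Real.mul_self_sqrt (by positivity)
  have hν2 : ν * ν = α / (β * S) := Real.mul_self_sqrt (by positivity)
  have hμ0 : 0 < μ := Real.sqrt_pos.2 (by positivity)
  have hν0 : 0 < ν := Real.sqrt_pos.2 (by positivity)
  have hμν : μ * ν = S⁻¹ := by
    rw [hμ, hν, ← Real.sqrt_mul (by positivity), Real.sqrt_eq_iff_mul_self_eq (by positivity)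
      (by positivity)]
    field_simp
  set y := δ * α / (γ * β) with hy
  have hy0 : 0 < y := by positivity
  have hn : ∀ {r : ℝ}, 0 < r → ‖(r : ℂ)‖ = r := fun hr => by
    rw [Complex.norm_real, Real.norm_of_nonneg hr.le]
  have hyc : (y : ℂ) ≠ 0 := by exact_mod_cast hy0.ne'
  have hnt : IsNormalTuple (fun k => (μ : ℂ) • a k) (fun k => (ν : ℂ) • b k) (fun k => y * t k)
      (α * β / S) (γ * δ / S) := by
    refine ⟨fun k => mul_pos hy0 (ht k), by rw [← add_div, div_self hS0.ne'], ?_, ?_, ?_, ?_⟩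
    · simp only [star_smul, smul_mul_smul_comm, ← Finset.smul_sum, norm_smul, norm_mul, norm_star,
        hn hμ0, hμ2]
      calc _ ≤ β / (α * S) * α ^ 2 := by gcongr
        _ = _ := by field_simp
    · simp only [star_smul, smul_mul_smul_comm, ← Finset.smul_sum, norm_smul, norm_mul, norm_star,
        hn hν0, hν2]
      calc _ ≤ α / (β * S) * β ^ 2 := by gcongr
        _ = _ := by field_simp
    · have e : ∀ k, ((y * t k : ℝ) : ℂ) • (star ((μ : ℂ) • a k) * ((μ : ℂ) • a k))
          = (y * (star (μ : ℂ) * μ)) • ((t k : ℂ) • (star (a k) * a k)) := fun k => by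
        rw [star_smul, smul_mul_smul_comm, smul_smul, smul_smul]; push_cast; congr 1; ring
      simp only [e, ← Finset.smul_sum, norm_smul, norm_mul, norm_star, hn hμ0, hn hy0, hμ2]
      calc _ ≤ y * (β / (α * S)) * γ ^ 2 := by gcongr
        _ = _ := by rw [hy]; field_simp
    · have e : ∀ k, ((y * t k : ℝ) : ℂ)⁻¹ • (((ν : ℂ) • b k) * star ((ν : ℂ) • b k))
          = ((y : ℂ)⁻¹ * (ν * star (ν : ℂ))) • ((t k : ℂ)⁻¹ • (b k * star (b k))) := fun k => by
        rw [star_smul, smul_mul_smul_comm, smul_smul, smul_smul]; push_cast; congr 1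
        rw [mul_inv]; ring
      simp only [e, ← Finset.smul_sum, norm_smul, norm_mul, norm_star, norm_inv, hn hν0, hn hy0,
        hν2]
      calc _ ≤ y⁻¹ * (α / (β * S)) * δ ^ 2 := by gcongr
        _ = _ := by rw [hy]; field_simp
  have h := hJ.tupleBound_sharp hJ0 κ _ _ _ _ _ hnt
  simp only [map_smul, LinearMap.smul_apply, smul_smul, ← Finset.smul_sum, norm_smul, norm_mul,
    hn hμ0, hn hν0] at h
  rw [mul_comm ν μ, hμν, inv_mul_le_iff₀ hS0] at h
  linarith

end MixedBound

section NonUnital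

variable {A B : Type*} [NonUnitalCStarAlgebra A] [NonUnitalCStarAlgebra B]

lemma matCNorm_const_le (a : A) : matCNorm (fun _ _ => a : Matrix Unit Unit A) ≤ ‖a‖ := by
  refine matCNorm_le (norm_nonneg a) fun v hv => ?_
  simp only [Matrix.mulVec, dotProduct, Finset.univ_unique, Finset.sum_singleton,
    CStarRing.norm_star_mul_self] at hv ⊢
  rw [← pow_two] at hv ⊢
  gcongr
  have hv' : ‖v default‖ ≤ 1 := by nlinarith [norm_nonneg (v default)]
  exact (norm_mul_le _ _).trans (mul_le_of_le_one_right (norm_nonneg a) hv')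

lemma JointlyCompletelyBounded.norm_apply_le {u : A →ₗ[ℂ] B →ₗ[ℂ] ℂ}
    (hu : JointlyCompletelyBounded u) (a : A) (b : B) : ‖u a b‖ ≤ jcbNorm u * ‖a‖ * ‖b‖ := by
  rcases eq_or_ne a 0 with rfl | ha
  · simp
  rcases eq_or_ne b 0 with rfl | hb
  · simp
  have := hu.norm_diagonal_le_mul (ι := Unit) (s := fun _ => 1) (by simp) (norm_pos_iff.2 ha)
    (norm_pos_iff.2 hb) (matCNorm_const_le a) (matCNorm_const_le b)
  simpa using this

/-- Right multiplication `z ↦ z e` from the unitization into the algebra. -/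
noncomputable def unitizationMul (e : A) : Unitization ℂ A →ₗ[ℂ] A where
  toFun z := z.fst • e + z.snd * e
  map_add' z w := by simp [add_smul, add_mul]; abel
  map_smul' c z := by simp [smul_smul, smul_mul_assoc]

lemma inr_unitizationMul (e : A) (z : Unitization ℂ A) :
    Unitization.inrNonUnitalStarAlgHom ℂ A (unitizationMul e z)
      = z * Unitization.inrNonUnitalStarAlgHom ℂ A e := by
  refine Unitization.ext ?_ ?_ <;> simp [unitizationMul]

lemma JointlyCompletelyBounded.mixedBound {u : A →ₗ[ℂ] B →ₗ[ℂ] ℂ}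
    (hu : JointlyCompletelyBounded u) : MixedBound u (jcbNorm u) := by
  intro κ _ a b t ht α β γ δ hα hβ hγ hδ h1 h2 h3 h4
  let _ := CStarAlgebra.spectralOrder A
  have _ := CStarAlgebra.spectralOrderedRing A
  let _ := CStarAlgebra.spectralOrder B
  have _ := CStarAlgebra.spectralOrderedRing B
  have hef : ∀ e : A, ‖e‖ ≤ 1 → ∀ f : B, ‖f‖ ≤ 1 →
      ‖∑ k, u (a k * e) (b k * f)‖ ≤ jcbNorm u * (α * β + γ * δ) := fun e he f hf => by
    let _ := CStarAlgebra.spectralOrder (Unitization ℂ A)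
    have _ := CStarAlgebra.spectralOrderedRing (Unitization ℂ A)
    let _ := CStarAlgebra.spectralOrder (Unitization ℂ B)
    have _ := CStarAlgebra.spectralOrderedRing (Unitization ℂ B)
    set φ := Unitization.inrNonUnitalStarAlgHom ℂ A with hφ
    set ψ := Unitization.inrNonUnitalStarAlgHom ℂ B with hψ
    have hφn : ∀ x, ‖φ x‖ = ‖x‖ := NonUnitalStarAlgHom.norm_map φ Unitization.inr_injective
    have hψn : ∀ x, ‖ψ x‖ = ‖x‖ := NonUnitalStarAlgHom.norm_map ψ Unitization.inr_injective
    have h := (hu.wBound_corner (φ := φ) Unitization.inr_injective he (inr_unitizationMul e)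
      (ψ := ψ) Unitization.inr_injective hf (inr_unitizationMul f)).mixedBound (jcbNorm_nonneg u)
      κ (fun k => φ (a k)) (fun k => ψ (b k)) t ht α β γ δ hα hβ hγ hδ
    simp only [← map_star, ← map_mul, ← map_smul, ← map_sum, hφn, hψn] at h
    have h := h h1 h2 h3 h4
    simpa [unitizationMul, hφ, hψ] using h
  have hA := CStarAlgebra.increasingApproximateUnit A
  have hB := CStarAlgebra.increasingApproximateUnit B
  let Φ := LinearMap.mkContinuous₂ u (jcbNorm u) hu.norm_apply_le
  have hlim : Filter.Tendsto (fun p : A × B => ∑ k, Φ (a k * p.1) (b k * p.2))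
      (CStarAlgebra.approximateUnit A ×ˢ CStarAlgebra.approximateUnit B)
      (nhds (∑ k, Φ (a k) (b k))) := by
    refine tendsto_finsetSum _ fun k _ => ?_
    have h5 := (hA.tendsto_mul_left (a k)).comp
      (Filter.tendsto_fst (f := CStarAlgebra.approximateUnit A)
        (g := CStarAlgebra.approximateUnit B))
    have h6 := (hB.tendsto_mul_left (b k)).comp
      (Filter.tendsto_snd (f := CStarAlgebra.approximateUnit A)
        (g := CStarAlgebra.approximateUnit B))
    exact (Φ.continuous₂.tendsto (a k, b k)).comp (h5.prodMk_nhds h6)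
  refine le_of_tendsto hlim.norm ?_
  have h7 := hA.eventually_norm.prod_mk hB.eventually_norm
  filter_upwards [h7] with p hp
  exact hef p.1 hp.1 p.2 hp.2

end NonUnital

section SimultaneousDiagonalization

variable {ι : Type*} [Fintype ι] [DecidableEq ι]

open scoped MatrixOrder Matrix.Norms.L2Operator in
lemma Matrix.PosDef.exists_conjTranspose_mul_mul_eq_one {G : Matrix ι ι ℂ} (hG : G.PosDef) :
    ∃ S : Matrix ι ι ℂ, IsUnit S ∧ S.conjTranspose * G * S = 1 := by
  obtain ⟨B, rfl⟩ : ∃ B : Matrix ι ι ℂ, G = B.conjTranspose * B :=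
    CStarAlgebra.nonneg_iff_eq_star_mul_self.mp hG.posSemidef.nonneg
  have hB : IsUnit B.det := by
    have := (Matrix.isUnit_iff_isUnit_det _).1 hG.isUnit
    rw [Matrix.det_mul] at this
    exact isUnit_of_mul_isUnit_right this
  refine ⟨B⁻¹, (Matrix.isUnit_nonsing_inv_iff).2 ((Matrix.isUnit_iff_isUnit_det _).2 hB), ?_⟩
  rw [Matrix.mul_assoc, Matrix.mul_assoc, Matrix.mul_nonsing_inv _ hB, Matrix.mul_one,
    ← Matrix.conjTranspose_mul, Matrix.mul_nonsing_inv _ hB, Matrix.conjTranspose_one]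

lemma Matrix.PosDef.exists_simultaneous_diagonalization {G D : Matrix ι ι ℂ} (hG : G.PosDef)
    (hD : D.PosDef) : ∃ (S : Matrix ι ι ℂ) (τ : ι → ℝ), IsUnit S ∧ (∀ i, 0 < τ i) ∧
      S.conjTranspose * G * S = 1 ∧
      S.conjTranspose * D * S = Matrix.diagonal fun i => (τ i : ℂ) := by
  obtain ⟨S, hS, hSG⟩ := hG.exists_conjTranspose_mul_mul_eq_one
  have hD' : (S.conjTranspose * D * S).PosDef :=
    hD.conjTranspose_mul_mul_same (Matrix.mulVec_injective_of_isUnit hS)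
  set U := (hD'.isHermitian.eigenvectorUnitary : Matrix ι ι ℂ) with hU
  have hUU : U.conjTranspose * U = 1 :=
    (Matrix.mem_unitaryGroup_iff' (A := U)).1 hD'.isHermitian.eigenvectorUnitary.2
  have hUu : IsUnit U := (Matrix.isUnit_iff_isUnit_det _).2 (Matrix.isUnit_det_of_left_inverse hUU)
  refine ⟨S * U, hD'.isHermitian.eigenvalues, hS.mul hUu, hD'.eigenvalues_pos, ?_, ?_⟩
  · calc _ = U.conjTranspose * (S.conjTranspose * G * S) * U := by
          simp only [Matrix.conjTranspose_mul, Matrix.mul_assoc]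
      _ = 1 := by rw [hSG, Matrix.mul_one, hUU]
  · calc _ = U.conjTranspose * (S.conjTranspose * D * S) * U := by
          simp only [Matrix.conjTranspose_mul, Matrix.mul_assoc]
      _ = U.conjTranspose * (U * Matrix.diagonal (fun i => (hD'.isHermitian.eigenvalues i : ℂ))
            * U.conjTranspose) * U := by
          congr 2
          have := hD'.isHermitian.spectral_theorem
          rw [Unitary.conjStarAlgAut_apply] at this
          exact this
      _ = (U.conjTranspose * U) * Matrix.diagonal (fun i => (hD'.isHermitian.eigenvalues i : ℂ))
            * (U.conjTranspose * U) := by simp only [Matrix.mul_assoc]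
      _ = _ := by rw [hUU, Matrix.one_mul, Matrix.mul_one]

end SimultaneousDiagonalization

section Combination

variable {E : Type*} [AddCommGroup E] [Module ℂ E] {ι κ ν : Type*} [Fintype ι] [Fintype ν]

/-- The action of a scalar matrix on tuples of vectors. -/
def combination (M : Matrix κ ι ℂ) (z : ι → E) (k : κ) : E := ∑ j, M k j • z j

lemma combination_mul (M : Matrix κ ι ℂ) (N : Matrix ι ν ℂ) (z : ν → E) :
    combination (M * N) z = combination M (combination N z) := by
  ext k
  simp only [combination, Matrix.mul_apply, Finset.sum_smul, Finset.smul_sum, mul_smul]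
  exact Finset.sum_comm

end Combination

section Parseval

lemma conjTranspose_map_star_mul {ι κ : Type*} [Fintype κ] [DecidableEq ι] {V : Matrix κ ι ℂ}
    {τ : ι → ℝ} (hV : V.conjTranspose * V = Matrix.diagonal fun i => (τ i : ℂ)) :
    (V.map star).conjTranspose * V.map star = Matrix.diagonal fun i => (τ i : ℂ) := by
  have h : (V.map star).conjTranspose * V.map star = (V.conjTranspose * V).map star := by
    ext i j
    simp [Matrix.mul_apply, Matrix.conjTranspose_apply]
  rw [h, hV]
  ext i j
  by_cases hij : i = j <;> simp [hij]

variable {A : Type*} [NonUnitalCStarAlgebra A] {ι κ : Type*} [Fintype ι] [Fintype κ]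
  [DecidableEq ι]

lemma sum_star_combination_mul {V : Matrix κ ι ℂ} {c : ι → ℂ}
    (hV : V.conjTranspose * V = Matrix.diagonal c) (y : ι → A) :
    ∑ k, star (combination V y k) * combination V y k = ∑ m, c m • (star (y m) * y m) := by
  have h : ∀ m m', ∑ k, star (V k m) * V k m' = if m = m' then c m else 0 := fun m m' => by
    have := congrFun (congrFun hV m) m'
    rwa [Matrix.mul_apply, Matrix.diagonal_apply] at this
  simp only [combination, star_sum, star_smul, Finset.sum_mul, Finset.mul_sum, smul_mul_assoc,
    mul_smul_comm, smul_smul, Finset.smul_sum]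
  rw [Finset.sum_comm]
  refine Finset.sum_congr rfl fun m _ => ?_
  rw [Finset.sum_comm]
  simp only [← Finset.sum_smul, mul_comm (V _ _) (star _), h]
  simp

lemma sum_combination_mul_star {V : Matrix κ ι ℂ} {c : ι → ℂ}
    (hV : V.conjTranspose * V = Matrix.diagonal c) (y : ι → A) :
    ∑ k, combination V y k * star (combination V y k) = ∑ m, c m • (y m * star (y m)) := by
  have h : ∀ m m', ∑ k, star (V k m) * V k m' = if m = m' then c m else 0 := fun m m' => by
    have := congrFun (congrFun hV m) m'
    rwa [Matrix.mul_apply, Matrix.diagonal_apply] at this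
  simp only [combination, star_sum, star_smul, Finset.sum_mul, Finset.mul_sum, smul_mul_assoc,
    mul_smul_comm, smul_smul, Finset.smul_sum]
  rw [Finset.sum_comm]
  refine Finset.sum_congr rfl fun m _ => ?_
  rw [Finset.sum_comm]
  simp only [← Finset.sum_smul, h]
  simp

/-- Bessel's inequality for a tuple of combinations along orthogonal columns. -/
lemma norm_sum_combination_mul_star_le {V : Matrix κ ι ℂ} {τ : ι → ℝ} (hτ : ∀ i, 0 < τ i)
    (hV : V.conjTranspose * V = Matrix.diagonal fun i => (τ i : ℂ)) (a : κ → A) :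
    ‖∑ m, (τ m : ℂ)⁻¹ • (combination V.transpose a m * star (combination V.transpose a m))‖
      ≤ ‖∑ k, a k * star (a k)‖ := by
  let _ := CStarAlgebra.spectralOrder A
  have _ := CStarAlgebra.spectralOrderedRing A
  set e := combination V.transpose a with he
  set f : ι → A := fun m => (τ m : ℂ)⁻¹ • e m with hf
  set W : Matrix κ ι ℂ := V.map star with hW
  have hWW : W.conjTranspose * W = Matrix.diagonal fun i => (τ i : ℂ) :=
    conjTranspose_map_star_mul hV
  set Z := ∑ m, (τ m : ℂ)⁻¹ • (e m * star (e m)) with hZ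
  have hpp : ∑ k, combination W f k * star (combination W f k) = Z := by
    rw [sum_combination_mul_star hWW]
    refine Finset.sum_congr rfl fun m _ => ?_
    have : (τ m : ℂ) ≠ 0 := by exact_mod_cast (hτ m).ne'
    simp [hf, smul_mul_assoc, mul_smul_comm, smul_smul, this]
  have hpa : ∑ k, combination W f k * star (a k) = Z := by
    simp only [combination, hf, hZ, hW, he, Finset.sum_mul, star_sum, Finset.mul_sum,
      Finset.smul_sum]
    rw [Finset.sum_comm]
    refine Finset.sum_congr rfl fun m _ => Finset.sum_congr rfl fun k _ => ?_
    simp only [smul_mul_assoc, mul_smul_comm, star_smul, smul_smul]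
    refine Finset.sum_congr rfl fun l _ => ?_
    congr 1
    simp
    ring
  have hap : ∑ k, a k * star (combination W f k) = Z := by
    have hs : star Z = Z := by
      simp [hZ, star_sum, star_smul]
    rw [← hs, ← hpa, star_sum]
    simp
  have hn : 0 ≤ ∑ k, (a k - combination W f k) * star (a k - combination W f k) :=
    Finset.sum_nonneg fun k _ => mul_star_self_nonneg _
  simp only [star_sub, sub_mul, mul_sub, Finset.sum_sub_distrib, hpp, hpa, hap, sub_self,
    sub_zero] at hn
  refine CStarAlgebra.norm_le_norm_of_nonneg_of_le ?_ (sub_nonneg.1 hn)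
  rw [← hpp]
  exact Finset.sum_nonneg fun k _ => mul_star_self_nonneg _

lemma norm_sum_star_combination_mul_le {V : Matrix κ ι ℂ} {τ : ι → ℝ} (hτ : ∀ i, 0 < τ i)
    (hV : V.conjTranspose * V = Matrix.diagonal fun i => (τ i : ℂ)) (a : κ → A) :
    ‖∑ m, (τ m : ℂ)⁻¹ • (star (combination V.transpose a m) * combination V.transpose a m)‖
      ≤ ‖∑ k, star (a k) * a k‖ := by
  have h := norm_sum_combination_mul_star_le hτ (conjTranspose_map_star_mul hV) fun k => star (a k)
  have e : ∀ m, combination (V.map star).transpose (fun k => star (a k)) m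
      = star (combination V.transpose a m) := fun m => by
    simp [combination, star_sum]
  simp only [e, star_star] at h
  exact h

end Parseval

section TwoRepresentations

variable {A B : Type*} [NonUnitalCStarAlgebra A] [NonUnitalCStarAlgebra B]

lemma sum_apply_combination {κ ι : Type*} [Fintype κ] [Fintype ι] (u : A →ₗ[ℂ] B →ₗ[ℂ] ℂ)
    (V : Matrix κ ι ℂ) (a : κ → A) (y : ι → B) :
    ∑ k, u (a k) (combination V y k) = ∑ m, u (combination V.transpose a m) (y m) := by
  simp only [combination, map_sum, map_smul, LinearMap.sum_apply, LinearMap.smul_apply,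
    Matrix.transpose_apply]
  exact Finset.sum_comm

lemma MixedBound.norm_sum_le_of_posDef {u : A →ₗ[ℂ] B →ₗ[ℂ] ℂ} {J : ℝ} (hu : MixedBound u J)
    {κ ν : Type*} {ι : Type} [Fintype κ] [Fintype ν] [Fintype ι] [DecidableEq ι]
    {V : Matrix κ ι ℂ} {W : Matrix ν ι ℂ} (hV : (V.conjTranspose * V).PosDef)
    (hW : (W.conjTranspose * W).PosDef) {a : κ → A} {c : ν → A} (y : ι → B)
    (hac : combination V.transpose a = combination W.transpose c) {α β γ δ : ℝ}
    (hα : 0 < α) (hβ : 0 < β) (hγ : 0 < γ) (hδ : 0 < δ)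
    (h1 : ‖∑ k, a k * star (a k)‖ ≤ α ^ 2)
    (h2 : ‖∑ k, star (combination V y k) * combination V y k‖ ≤ β ^ 2)
    (h3 : ‖∑ l, star (c l) * c l‖ ≤ γ ^ 2)
    (h4 : ‖∑ l, combination W y l * star (combination W y l)‖ ≤ δ ^ 2) :
    ‖∑ k, u (a k) (combination V y k)‖ ≤ J * (α * β + γ * δ) := by
  obtain ⟨S, τ, hS, hτ, hSV, hSW⟩ := hV.exists_simultaneous_diagonalization hW
  obtain ⟨T, hST⟩ := hS.exists_right_inv
  have hV1 : (V * S).conjTranspose * (V * S)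
      = Matrix.diagonal fun i => (((fun _ => 1) i : ℝ) : ℂ) := by
    simp only [Matrix.conjTranspose_mul, Complex.ofReal_one, Matrix.diagonal_one]
    simpa only [Matrix.mul_assoc] using hSV
  have hW1 : (W * S).conjTranspose * (W * S) = Matrix.diagonal fun i => (τ i : ℂ) := by
    simp only [Matrix.conjTranspose_mul]
    simpa only [Matrix.mul_assoc] using hSW
  have hyV : combination V y = combination (V * S) (combination T y) := by
    rw [← combination_mul, Matrix.mul_assoc, hST, Matrix.mul_one]
  have hyW : combination W y = combination (W * S) (combination T y) := by
    rw [← combination_mul, Matrix.mul_assoc, hST, Matrix.mul_one]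
  have he : combination (V * S).transpose a = combination (W * S).transpose c := by
    rw [Matrix.transpose_mul, Matrix.transpose_mul, combination_mul, combination_mul, hac]
  rw [hyV] at h2 ⊢
  rw [hyW] at h4
  rw [sum_star_combination_mul hV1] at h2
  rw [sum_combination_mul_star hW1] at h4
  rw [sum_apply_combination]
  refine hu ι _ _ (fun i => (τ i)⁻¹) (fun i => inv_pos.2 (hτ i)) α β γ δ hα hβ hγ hδ ?_ ?_ ?_ ?_
  · refine le_trans ?_ h1
    simpa using norm_sum_combination_mul_star_le (fun _ => one_pos) hV1 a
  · simpa using h2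
  · rw [he]
    refine le_trans ?_ h3
    simpa using norm_sum_star_combination_mul_le hτ hW1 c
  · simpa using h4

lemma posDef_fromRows {κ ι : Type*} [Fintype κ] [Fintype ι] [DecidableEq ι] (V : Matrix κ ι ℂ)
    {ε : ℝ} (hε : 0 < ε) : ((Matrix.fromRows V ((ε : ℂ) • 1)).conjTranspose *
      Matrix.fromRows V ((ε : ℂ) • (1 : Matrix ι ι ℂ))).PosDef := by
  refine Matrix.PosDef.conjTranspose_mul_self _ fun x y h => ?_
  have hx : ∀ x, (ε : ℂ) • x = ((Matrix.fromRows V ((ε : ℂ) • (1 : Matrix ι ι ℂ))).mulVec x)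
      ∘ Sum.inr := fun x => by
    ext i
    simp [Matrix.fromRows_mulVec, Matrix.smul_mulVec]
  have h' := hx x
  rw [h, ← hx y] at h'
  exact smul_right_injective _ (by exact_mod_cast hε.ne' : (ε : ℂ) ≠ 0) h'

lemma combination_fromRows {κ ι : Type*} [Fintype ι] [DecidableEq ι] (V : Matrix κ ι ℂ)
    (ε : ℝ) (y : ι → B) : combination (Matrix.fromRows V ((ε : ℂ) • (1 : Matrix ι ι ℂ))) y
      = Sum.elim (combination V y) fun i => (ε : ℂ) • y i := by
  ext (k | k)
  · simp [combination]
  · simp [combination, Matrix.one_apply, ite_smul]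

lemma combination_transpose_fromRows {κ ι : Type*} [Fintype κ] [Fintype ι] [DecidableEq ι]
    (V : Matrix κ ι ℂ) (ε : ℝ) (a : κ → A) :
    combination (Matrix.fromRows V ((ε : ℂ) • (1 : Matrix ι ι ℂ))).transpose
      (Sum.elim a fun _ => 0) = combination V.transpose a := by
  ext k
  simp [combination]

lemma MixedBound.norm_sum_le_add_of_pos {u : A →ₗ[ℂ] B →ₗ[ℂ] ℂ} {J : ℝ} (hu : MixedBound u J)
    (hJ : 0 ≤ J) {κ ν : Type*} {ι : Type} [Fintype κ] [Fintype ν] [Fintype ι] [DecidableEq ι]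
    (V : Matrix κ ι ℂ) (W : Matrix ν ι ℂ) {a : κ → A} {c : ν → A} (y : ι → B)
    (hac : combination V.transpose a = combination W.transpose c) {ε : ℝ} (hε : 0 < ε) :
    ‖∑ k, u (a k) (combination V y k)‖ ≤ J * ((‖∑ k, a k * star (a k)‖
        + ‖∑ k, star (combination V y k) * combination V y k‖
        + (‖∑ l, combination W y l * star (combination W y l)‖ + ‖∑ l, star (c l) * c l‖)) / 2
        + ε ^ 2 * ((4 + ‖∑ i, star (y i) * y i‖ + ‖∑ i, y i * star (y i)‖) / 2)) := by
  have hpos : ∀ r : ℝ, 0 ≤ r → 0 < Real.sqrt (r + ε ^ 2) := fun r hr =>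
    Real.sqrt_pos.2 (by positivity)
  have hsq : ∀ r : ℝ, 0 ≤ r → Real.sqrt (r + ε ^ 2) ^ 2 = r + ε ^ 2 := fun r hr =>
    Real.sq_sqrt (by positivity)
  have hεc : star (ε : ℂ) * (ε : ℂ) = ((ε ^ 2 : ℝ) : ℂ) := by
    simp [pow_two]
  set P := ‖∑ k, a k * star (a k)‖
  set Q := ‖∑ k, star (combination V y k) * combination V y k‖
  set R := ‖∑ l, combination W y l * star (combination W y l)‖
  set S := ‖∑ l, star (c l) * c l‖
  set Y := ‖∑ i, star (y i) * y i‖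
  set Z := ‖∑ i, y i * star (y i)‖
  have hP : 0 ≤ P := norm_nonneg _
  have hQ : 0 ≤ Q := norm_nonneg _
  have hR : 0 ≤ R := norm_nonneg _
  have hS : 0 ≤ S := norm_nonneg _
  have hY : 0 ≤ Y := norm_nonneg _
  have hZ : 0 ≤ Z := norm_nonneg _
  have hn : ∀ b : B, ‖((ε ^ 2 : ℝ) : ℂ) • b‖ = ε ^ 2 * ‖b‖ := fun b => by
    rw [norm_smul, Complex.norm_real, Real.norm_of_nonneg (by positivity)]
  have h := hu.norm_sum_le_of_posDef (posDef_fromRows V hε) (posDef_fromRows W hε)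
    (a := Sum.elim a fun _ => 0) (c := Sum.elim c fun _ => 0) y
    (by rw [combination_transpose_fromRows, combination_transpose_fromRows, hac])
    (hpos P hP) (hpos (Q + ε ^ 2 * Y) (by positivity)) (hpos S hS)
    (hpos (R + ε ^ 2 * Z) (by positivity)) ?_ ?_ ?_ ?_
  · simp only [combination_fromRows, Fintype.sum_sum_type, Sum.elim_inl, Sum.elim_inr, map_zero,
      LinearMap.zero_apply, Finset.sum_const_zero, add_zero] at h
    refine h.trans (mul_le_mul_of_nonneg_left ?_ hJ)
    nlinarith [sq_nonneg (Real.sqrt (P + ε ^ 2) - Real.sqrt (Q + ε ^ 2 * Y + ε ^ 2)),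
      sq_nonneg (Real.sqrt (S + ε ^ 2) - Real.sqrt (R + ε ^ 2 * Z + ε ^ 2)),
      hsq P hP, hsq S hS, hsq (Q + ε ^ 2 * Y) (by positivity),
      hsq (R + ε ^ 2 * Z) (by positivity)]
  · rw [hsq P hP]
    simpa [P] using sq_nonneg ε
  · rw [hsq _ (by positivity)]
    simp only [combination_fromRows, Fintype.sum_sum_type, Sum.elim_inl, Sum.elim_inr, star_smul,
      smul_mul_assoc, mul_smul_comm, smul_smul, mul_comm (ε : ℂ), hεc, ← Finset.smul_sum]
    refine (norm_add_le _ _).trans ?_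
    rw [hn]
    nlinarith [sq_nonneg ε]
  · rw [hsq S hS]
    simpa [S] using sq_nonneg ε
  · rw [hsq _ (by positivity)]
    simp only [combination_fromRows, Fintype.sum_sum_type, Sum.elim_inl, Sum.elim_inr, star_smul,
      smul_mul_assoc, mul_smul_comm, smul_smul, hεc, ← Finset.smul_sum]
    refine (norm_add_le _ _).trans ?_
    rw [hn]
    nlinarith [sq_nonneg ε]

open TensorProduct in
/-- Two representations of the same tensor, one measured in rows and columns, the other one
in columns and rows. -/
lemma MixedBound.norm_sum_le {u : A →ₗ[ℂ] B →ₗ[ℂ] ℂ} {J : ℝ} (hu : MixedBound u J)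
    (hJ : 0 ≤ J) {κ ν : Type*} [Fintype κ] [Fintype ν] {a : κ → A} {b : κ → B} {c : ν → A}
    {d : ν → B} (h : ∑ k, a k ⊗ₜ[ℂ] b k = ∑ l, c l ⊗ₜ[ℂ] d l) :
    ‖∑ k, u (a k) (b k)‖ ≤ J * ((‖∑ k, a k * star (a k)‖ + ‖∑ k, star (b k) * b k‖
        + (‖∑ l, d l * star (d l)‖ + ‖∑ l, star (c l) * c l‖)) / 2) := by
  have hv : VanishesTrivially ℂ (Sum.elim a (-c)) (Sum.elim b d) := by
    refine vanishesTrivially_of_sum_tmul_eq_zero_of_rTensor_injective ℂ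
      (Module.Flat.rTensor_preserves_injective_linearMap _ (Submodule.injective_subtype _)) ?_
    simp [Fintype.sum_sum_type, h, TensorProduct.neg_tmul]
  obtain ⟨n, w, y, hy, hw⟩ := hv
  have hb : b = combination (Matrix.of fun k j => w (Sum.inl k) j) y :=
    funext fun k => hy (Sum.inl k)
  have hd : d = combination (Matrix.of fun k j => w (Sum.inr k) j) y :=
    funext fun k => hy (Sum.inr k)
  have hac : combination (Matrix.of fun k j => w (Sum.inl k) j).transpose a
      = combination (Matrix.of fun k j => w (Sum.inr k) j).transpose c := by
    ext j
    have := hw j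
    simp only [Fintype.sum_sum_type, Sum.elim_inl, Sum.elim_inr, Pi.neg_apply, smul_neg,
      Finset.sum_neg_distrib] at this
    exact sub_eq_zero.1 (by simpa [combination, sub_eq_add_neg] using this)
  have hε := fun (ε : ℝ) (h0 : 0 < ε) => hu.norm_sum_le_add_of_pos hJ _ _ y hac h0
  rw [← hb, ← hd] at hε
  have ht : Filter.Tendsto (fun ε : ℝ => J * ((‖∑ k, a k * star (a k)‖ + ‖∑ k, star (b k) * b k‖
        + (‖∑ l, d l * star (d l)‖ + ‖∑ l, star (c l) * c l‖)) / 2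
        + ε ^ 2 * ((4 + ‖∑ i, star (y i) * y i‖ + ‖∑ i, y i * star (y i)‖) / 2)))
      (nhdsWithin 0 (Set.Ioi 0)) (nhds (J * ((‖∑ k, a k * star (a k)‖ + ‖∑ k, star (b k) * b k‖
        + (‖∑ l, d l * star (d l)‖ + ‖∑ l, star (c l) * c l‖)) / 2
        + 0 ^ 2 * ((4 + ‖∑ i, star (y i) * y i‖ + ‖∑ i, y i * star (y i)‖) / 2)))) :=
    (Continuous.tendsto (by fun_prop) 0).mono_left nhdsWithin_le_nhds
  have := ge_of_tendsto ht (Filter.eventually_of_mem self_mem_nhdsWithin fun ε h0 => hε ε h0)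
  simpa using this

end TwoRepresentations

open TensorProduct

section TensorSeminorm

variable {A B : Type*} [NonUnitalCStarAlgebra A] [NonUnitalCStarAlgebra B]

/-- The values `(‖∑ q aₖ‖ + ‖∑ r bₖ‖) / 2` over all representations `t = ∑ aₖ ⊗ bₖ`. -/
def tensorValues (q : A → A) (r : B → B) (t : A ⊗[ℂ] B) : Set ℝ :=
  {x : ℝ | ∃ (n : ℕ) (a : Fin n → A) (b : Fin n → B), t = ∑ k, a k ⊗ₜ[ℂ] b k ∧
    x = (‖∑ k, q (a k)‖ + ‖∑ k, r (b k)‖) / 2}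

variable {q : A → A} {r : B → B}

lemma mem_tensorValues (q : A → A) (r : B → B) {κ : Type*} [Fintype κ] (a : κ → A) (b : κ → B) :
    (‖∑ k, q (a k)‖ + ‖∑ k, r (b k)‖) / 2 ∈ tensorValues q r (∑ k, a k ⊗ₜ[ℂ] b k) := by
  let e := (Fintype.equivFin κ).symm
  refine ⟨Fintype.card κ, a ∘ e, b ∘ e, ?_, ?_⟩
  · exact (e.sum_comp fun k => a k ⊗ₜ[ℂ] b k).symm
  · rw [← e.sum_comp fun k => q (a k), ← e.sum_comp fun k => r (b k)]
    rfl

lemma tensorValues_nonempty (q : A → A) (r : B → B) (t : A ⊗[ℂ] B) :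
    (tensorValues q r t).Nonempty := by
  obtain ⟨s, rfl⟩ := TensorProduct.exists_finset t
  rw [← Finset.sum_coe_sort s fun i => i.1 ⊗ₜ[ℂ] i.2]
  exact ⟨_, mem_tensorValues q r _ _⟩

lemma nonneg_of_mem_tensorValues {t : A ⊗[ℂ] B} {x : ℝ} (hx : x ∈ tensorValues q r t) :
    0 ≤ x := by
  obtain ⟨n, a, b, -, rfl⟩ := hx
  positivity

lemma bddBelow_tensorValues (q : A → A) (r : B → B) (t : A ⊗[ℂ] B) :
    BddBelow (tensorValues q r t) :=
  ⟨0, fun _ hx => nonneg_of_mem_tensorValues hx⟩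

lemma sInf_tensorValues_add_le (t s : A ⊗[ℂ] B) :
    sInf (tensorValues q r (t + s)) ≤ sInf (tensorValues q r t) + sInf (tensorValues q r s) := by
  have h : ∀ x ∈ tensorValues q r t, ∀ y ∈ tensorValues q r s,
      sInf (tensorValues q r (t + s)) ≤ x + y := by
    rintro _ ⟨n, a, b, rfl, rfl⟩ _ ⟨m, c, d, rfl, rfl⟩
    have hm := mem_tensorValues q r (Sum.elim a c) (Sum.elim b d)
    simp only [Fintype.sum_sum_type, Sum.elim_inl, Sum.elim_inr] at hm
    refine (csInf_le (bddBelow_tensorValues q r _) hm).trans ?_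
    linarith [norm_add_le (∑ k, q (a k)) (∑ k, q (c k)),
      norm_add_le (∑ k, r (b k)) (∑ k, r (d k))]
  have h1 : ∀ x ∈ tensorValues q r t,
      sInf (tensorValues q r (t + s)) - x ≤ sInf (tensorValues q r s) := fun x hx =>
    le_csInf (tensorValues_nonempty q r s) fun y hy => by linarith [h x hx y hy]
  have h2 : sInf (tensorValues q r (t + s)) - sInf (tensorValues q r s)
      ≤ sInf (tensorValues q r t) :=
    le_csInf (tensorValues_nonempty q r t) fun x hx => by linarith [h1 x hx]
  linarith

lemma sInf_tensorValues_smul_le (hq : ∀ (z : ℂ) a, q (z • a) = ((‖z‖ ^ 2 : ℝ) : ℂ) • q a)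
    (hr : ∀ (z : ℂ) b, r (z • b) = ((‖z‖ ^ 2 : ℝ) : ℂ) • r b) {z : ℂ} (hz : z ≠ 0)
    (t : A ⊗[ℂ] B) : sInf (tensorValues q r (z • t)) ≤ ‖z‖ * sInf (tensorValues q r t) := by
  have hz' : 0 < ‖z‖ := norm_pos_iff.2 hz
  rw [mul_comm, ← div_le_iff₀ hz']
  refine le_csInf (tensorValues_nonempty q r t) ?_
  rintro _ ⟨n, a, b, rfl, rfl⟩
  rw [div_le_iff₀ hz']
  set s := Real.sqrt ‖z‖ with hs
  have hs0 : 0 < s := Real.sqrt_pos.2 hz'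
  have hs2 : s ^ 2 = ‖z‖ := Real.sq_sqrt hz'.le
  have hsn : ‖(s : ℂ)‖ = s := by rw [Complex.norm_real, Real.norm_of_nonneg hs0.le]
  have hm := mem_tensorValues q r (fun k => (z / s) • a k) (fun k => (s : ℂ) • b k)
  have e : ∑ k, ((z / s) • a k) ⊗ₜ[ℂ] ((s : ℂ) • b k) = z • ∑ k, a k ⊗ₜ[ℂ] b k := by
    rw [Finset.smul_sum]
    refine Finset.sum_congr rfl fun k _ => ?_
    rw [TensorProduct.smul_tmul_smul, div_mul_cancel₀]
    exact_mod_cast hs0.ne'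
  have h1 : ‖z / (s : ℂ)‖ ^ 2 = ‖z‖ := by
    rw [norm_div, hsn, div_pow, hs2, pow_two]
    field_simp
  simp only [hq, hr, h1, hsn, hs2, ← Finset.smul_sum] at hm
  rw [e] at hm
  refine (csInf_le (bddBelow_tensorValues q r _) hm).trans (le_of_eq ?_)
  rw [norm_smul, norm_smul, Complex.norm_real, norm_norm]
  ring

/-- The seminorm on `A ⊗ B` given by the infimum of `tensorValues`. -/
noncomputable def tensorSeminorm (q : A → A) (r : B → B)
    (hq : ∀ (z : ℂ) a, q (z • a) = ((‖z‖ ^ 2 : ℝ) : ℂ) • q a)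
    (hr : ∀ (z : ℂ) b, r (z • b) = ((‖z‖ ^ 2 : ℝ) : ℂ) • r b) : Seminorm ℂ (A ⊗[ℂ] B) :=
  have h0 : sInf (tensorValues q r 0) = 0 := by
    refine le_antisymm ?_ (le_csInf (tensorValues_nonempty q r 0) fun _ =>
      nonneg_of_mem_tensorValues)
    refine csInf_le (bddBelow_tensorValues q r _) ?_
    simpa using mem_tensorValues q r (fun _ : Empty => 0) (fun _ => 0)
  Seminorm.ofSMulLE (fun t => sInf (tensorValues q r t)) h0 sInf_tensorValues_add_le fun z t => by
    rcases eq_or_ne z 0 with rfl | hz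
    · simp [h0]
    · exact sInf_tensorValues_smul_le hq hr hz t

lemma tensorSeminorm_apply (hq : ∀ (z : ℂ) a, q (z • a) = ((‖z‖ ^ 2 : ℝ) : ℂ) • q a)
    (hr : ∀ (z : ℂ) b, r (z • b) = ((‖z‖ ^ 2 : ℝ) : ℂ) • r b) (t : A ⊗[ℂ] B) :
    tensorSeminorm q r hq hr t = sInf (tensorValues q r t) := rfl

lemma mul_star_self_smul (z : ℂ) (a : A) :
    (z • a) * star (z • a) = ((‖z‖ ^ 2 : ℝ) : ℂ) • (a * star a) := by
  rw [star_smul, smul_mul_smul_comm, RCLike.star_def, Complex.mul_conj, Complex.normSq_eq_norm_sq]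

lemma star_mul_self_smul (z : ℂ) (a : A) :
    star (z • a) * (z • a) = ((‖z‖ ^ 2 : ℝ) : ℂ) • (star a * a) := by
  rw [star_smul, smul_mul_smul_comm, RCLike.star_def, mul_comm, Complex.mul_conj,
    Complex.normSq_eq_norm_sq]

end TensorSeminorm

section Decomposition

variable {A B : Type*} [NonUnitalCStarAlgebra A] [NonUnitalCStarAlgebra B]

/-- Domination of a bilinear form by row norms on the left and column norms on the right. -/
def RowColumnBound (u : A →ₗ[ℂ] B →ₗ[ℂ] ℂ) (J : ℝ) : Prop :=
  ∀ (n : ℕ) (a : Fin n → A) (b : Fin n → B), ‖∑ k, u (a k) (b k)‖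
    ≤ J * ((‖∑ k, a k * star (a k)‖ + ‖∑ k, star (b k) * b k‖) / 2)

lemma MixedBound.exists_decomposition {u : A →ₗ[ℂ] B →ₗ[ℂ] ℂ} {J : ℝ} (hu : MixedBound u J)
    (hJ : 0 ≤ J) : ∃ u₁ u₂ : A →ₗ[ℂ] B →ₗ[ℂ] ℂ, u = u₁ + u₂ ∧ RowColumnBound u₁ J ∧
      RowColumnBound u₂.flip J := by
  set p := tensorSeminorm (fun a : A => a * star a) (fun b : B => star b * b)
    mul_star_self_smul star_mul_self_smul with hp
  set p' := tensorSeminorm (fun a : A => star a * a) (fun b : B => b * star b)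
    star_mul_self_smul mul_star_self_smul with hp'
  have key : ∀ t : A ⊗[ℂ] B, ‖TensorProduct.lift u t‖ ≤ J * p t + J * p' t := fun t => by
    have h : ∀ x ∈ tensorValues (fun a : A => a * star a) (fun b : B => star b * b) t,
        ∀ y ∈ tensorValues (fun a : A => star a * a) (fun b : B => b * star b) t,
        ‖TensorProduct.lift u t‖ ≤ J * (x + y) := by
      rintro _ ⟨n, a, b, h, rfl⟩ _ ⟨m, c, d, h', rfl⟩
      have := hu.norm_sum_le hJ (h.symm.trans h')
      rw [h]
      simp only [map_sum, TensorProduct.lift.tmul]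
      refine this.trans (le_of_eq ?_)
      ring
    rw [hp, hp', tensorSeminorm_apply, tensorSeminorm_apply, ← mul_add]
    rcases hJ.eq_or_lt with rfl | hJ
    · obtain ⟨x, hx⟩ := tensorValues_nonempty (fun a : A => a * star a) (fun b : B => star b * b) t
      obtain ⟨y, hy⟩ := tensorValues_nonempty (fun a : A => star a * a) (fun b : B => b * star b) t
      simpa using h x hx y hy
    rw [← div_le_iff₀' hJ]
    rw [← sub_le_iff_le_add]
    refine le_csInf (tensorValues_nonempty _ _ t) fun x hx => ?_
    rw [sub_le_comm]
    refine le_csInf (tensorValues_nonempty _ _ t) fun y hy => ?_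
    rw [sub_le_iff_le_add', div_le_iff₀' hJ]
    exact h x hx y hy
  obtain ⟨g, hg, hgp⟩ := Module.Dual.exists_extension_of_le_seminorm
    (𝕜 := ℂ) (E := (A ⊗[ℂ] B) × (A ⊗[ℂ] B))
    (LinearMap.range (LinearMap.prod (LinearMap.id (R := ℂ) (M := A ⊗[ℂ] B)) LinearMap.id))
    ((TensorProduct.lift u ∘ₗ LinearMap.fst ℂ (A ⊗[ℂ] B) (A ⊗[ℂ] B)) ∘ₗ Submodule.subtype _)
    (p := J.toNNReal • p.comp (LinearMap.fst ℂ (A ⊗[ℂ] B) (A ⊗[ℂ] B))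
      + J.toNNReal • p'.comp (LinearMap.snd ℂ (A ⊗[ℂ] B) (A ⊗[ℂ] B))) (by
      rintro ⟨_, t, rfl⟩
      exact (key t).trans (le_of_eq (by simp [NNReal.smul_def, hJ])))
  have hg' : ∀ t : A ⊗[ℂ] B, g (t, t) = TensorProduct.lift u t := fun t => hg ⟨(t, t), t, rfl⟩
  have hgp' : ∀ t s : A ⊗[ℂ] B, ‖g (t, s)‖ ≤ J * p t + J * p' s := fun t s =>
    (hgp (t, s)).trans (le_of_eq (by simp [NNReal.smul_def, hJ]))
  refine ⟨TensorProduct.curry (g ∘ₗ LinearMap.inl ℂ _ _),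
    TensorProduct.curry (g ∘ₗ LinearMap.inr ℂ _ _), ?_, ?_, ?_⟩
  · ext a b
    have := hg' (a ⊗ₜ b)
    rw [TensorProduct.lift.tmul] at this
    simp [← this, ← map_add]
  · intro n a b
    have h := hgp' (∑ k, a k ⊗ₜ[ℂ] b k) 0
    rw [map_zero p', mul_zero, add_zero] at h
    have e : g (∑ k, a k ⊗ₜ[ℂ] b k, 0) = ∑ k, g (a k ⊗ₜ[ℂ] b k, 0) := by
      rw [← map_sum]
      congr 1
      ext <;> simp [Prod.fst_sum, Prod.snd_sum]
    rw [e] at h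
    refine le_trans (le_of_eq ?_) (h.trans (mul_le_mul_of_nonneg_left
      (csInf_le (bddBelow_tensorValues _ _ _) (mem_tensorValues _ _ a b)) hJ))
    simp
  · intro n b a
    have h := hgp' 0 (∑ k, a k ⊗ₜ[ℂ] b k)
    rw [map_zero p, mul_zero, zero_add] at h
    have e : g (0, ∑ k, a k ⊗ₜ[ℂ] b k) = ∑ k, g (0, a k ⊗ₜ[ℂ] b k) := by
      rw [← map_sum]
      congr 1
      ext <;> simp [Prod.fst_sum, Prod.snd_sum]
    rw [e] at h
    have h := h.trans (mul_le_mul_of_nonneg_left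
      (csInf_le (bddBelow_tensorValues _ _ _) (mem_tensorValues _ _ a b)) hJ)
    rw [add_comm] at h
    refine le_trans (le_of_eq ?_) h
    simp

end Decomposition

section ScalarVectors

variable {A : Type*} [NonUnitalCStarAlgebra A] {n : Type} [Fintype n]

lemma IsSelfAdjoint.norm_pow_three_le {z : A} (hz : IsSelfAdjoint z) :
    ‖z‖ ^ 3 ≤ ‖z * z * z‖ := by
  rcases eq_or_ne z 0 with rfl | h0
  · simp
  have h2 : ‖z * z‖ = ‖z‖ * ‖z‖ := by
    have := CStarRing.norm_star_mul_self (x := z)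
    rwa [hz.star_eq] at this
  have h4 : ‖(z * z) * (z * z)‖ = ‖z * z‖ * ‖z * z‖ := by
    have := CStarRing.norm_star_mul_self (x := z * z)
    rwa [star_mul, hz.star_eq] at this
  have h5 := norm_mul_le (z * z * z) z
  rw [mul_assoc (z * z), h4, h2] at h5
  have hp : 0 < ‖z‖ := norm_pos_iff.2 h0
  nlinarith

lemma norm_sum_star_mul_self_le_of_scalar {y : Matrix n n A} (hy : matCNorm y ≤ 1) {η : n → ℂ}
    (hη : ∑ j, ‖η j‖ ^ 2 ≤ 1) :
    ‖∑ k, star (∑ j, η j • y k j) * ∑ j, η j • y k j‖ ≤ 1 := by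
  set b : n → A := fun k => ∑ j, η j • y k j with hb
  set z := ∑ k, star (b k) * b k with hz
  have hzs : IsSelfAdjoint z := by simp [IsSelfAdjoint, hz, star_sum]
  have hv : y.mulVec (fun j => η j • z) = fun k => b k * z := by
    ext k
    simp [Matrix.mulVec, dotProduct, hb, Finset.sum_mul, mul_smul_comm, smul_mul_assoc]
  have h := norm_sum_star_mulVec_le_matCNorm y fun j => η j • z
  have h1 : ∀ w : A, IsSelfAdjoint w → ∑ k, star (b k * w) * (b k * w) = w * z * w :=
    fun w hw => by
      simp only [hz, star_mul, hw.star_eq, Finset.mul_sum, Finset.sum_mul, mul_assoc]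
  have h2 : ‖∑ j, star (η j • z) * (η j • z)‖ ≤ ‖z‖ ^ 2 := by
    simp only [star_mul_self_smul, ← Finset.sum_smul, ← Complex.ofReal_sum, norm_smul,
      Complex.norm_real, CStarRing.norm_star_mul_self, ← pow_two]
    rw [Real.norm_of_nonneg (by positivity)]
    exact mul_le_of_le_one_left (by positivity) hη
  rw [hv, h1 z hzs] at h
  have h3 := (hzs.norm_pow_three_le.trans h).trans
    (mul_le_of_le_one_left (norm_nonneg _) (pow_le_one₀ (matCNorm_nonneg y) hy))
  by_contra! hlt
  nlinarith [h3.trans h2, mul_pos (pow_pos (one_pos.trans hlt) 2) (sub_pos.2 hlt)]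

lemma norm_sum_smul_sq_le {ξ : n → ℂ} (hξ : ∑ j, ‖ξ j‖ ^ 2 ≤ 1) (w : n → A) :
    ‖∑ i, ξ i • w i‖ ^ 2 ≤ ‖∑ i, star (w i) * w i‖ := by
  rcases (Finset.sum_nonneg fun j _ => sq_nonneg ‖ξ j‖ : 0 ≤ ∑ j, ‖ξ j‖ ^ 2).eq_or_lt with h0 | h0
  · have : ∀ i, ξ i = 0 := fun i => by
      have := (Finset.sum_eq_zero_iff_of_nonneg fun j _ => sq_nonneg ‖ξ j‖).1 h0.symm i
        (Finset.mem_univ i)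
      simpa using this
    simp [this]
  have hV : (Matrix.of fun (k : n) (_ : Unit) => ξ k).conjTranspose
      * (Matrix.of fun (k : n) (_ : Unit) => ξ k)
      = Matrix.diagonal fun _ => ((∑ j, ‖ξ j‖ ^ 2 : ℝ) : ℂ) := by
    ext i j
    simp [Matrix.mul_apply, Complex.conj_mul']
  have h := norm_sum_star_combination_mul_le (fun _ => h0) hV w
  simp only [Finset.univ_unique, Finset.sum_singleton, norm_smul, norm_inv, Complex.norm_real,
    CStarRing.norm_star_mul_self, combination, Matrix.transpose_apply, Matrix.of_apply,
    Real.norm_of_nonneg h0.le] at h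
  refine le_trans ?_ h
  rw [← pow_two]
  exact le_mul_of_one_le_left (by positivity) ((one_le_inv₀ h0).2 hξ)

lemma norm_sum_mul_star_self_le_of_scalar {x : Matrix n n A} (hx : matCNorm x ≤ 1) {ξ : n → ℂ}
    (hξ : ∑ j, ‖ξ j‖ ^ 2 ≤ 1) :
    ‖∑ k, (∑ i, ξ i • x i k) * star (∑ i, ξ i • x i k)‖ ≤ 1 := by
  set a : n → A := fun k => ∑ i, ξ i • x i k with ha
  set z := ∑ k, a k * star (a k) with hz
  have h := norm_sum_star_mulVec_le_matCNorm x fun k => star (a k)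
  have h1 := norm_sum_smul_sq_le hξ (x.mulVec fun k => star (a k))
  have h2 : ∑ i, ξ i • x.mulVec (fun k => star (a k)) i = z := by
    simp only [Matrix.mulVec, dotProduct, Finset.smul_sum]
    rw [Finset.sum_comm]
    refine Finset.sum_congr rfl fun k _ => ?_
    conv_rhs => rw [ha, Finset.sum_mul]
    simp only [smul_mul_assoc, ha]
  simp only [star_star] at h
  rw [h2] at h1
  have h3 := (h1.trans h).trans
    (mul_le_of_le_one_left (norm_nonneg _) (pow_le_one₀ (matCNorm_nonneg x) hx))
  by_contra! hlt
  nlinarith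

lemma matCNorm_le_of_norm_dotProduct_le {M : Matrix n n ℂ} {J : ℝ} (hJ : 0 ≤ J)
    (h : ∀ ξ η : n → ℂ, ∑ i, ‖ξ i‖ ^ 2 ≤ 1 → ∑ i, ‖η i‖ ^ 2 ≤ 1 →
      ‖∑ i, ξ i * M.mulVec η i‖ ≤ J) : matCNorm M ≤ J := by
  have hs : ∀ v : n → ℂ, ‖∑ i, star (v i) * v i‖ = ∑ i, ‖v i‖ ^ 2 := fun v => by
    have e : ∑ i, star (v i) * v i = ((∑ i, ‖v i‖ ^ 2 : ℝ) : ℂ) := by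
      simp [Complex.conj_mul']
    rw [e, Complex.norm_real, Real.norm_of_nonneg (by positivity)]
  refine matCNorm_le hJ fun v hv => ?_
  rw [hs] at hv ⊢
  set N := M.mulVec v with hN
  set s := ∑ i, ‖N i‖ ^ 2 with hs'
  rcases (by positivity : 0 ≤ s).eq_or_lt with h0 | h0
  · rw [← h0]; positivity
  set r := Real.sqrt s with hr
  have hr0 : 0 < r := Real.sqrt_pos.2 h0
  have hr2 : r ^ 2 = s := Real.sq_sqrt h0.le
  have h1 := h (fun i => (r : ℂ)⁻¹ * star (N i)) v (le_of_eq ?_) hv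
  · rw [← hN] at h1
    have e : ∑ i, (r : ℂ)⁻¹ * star (N i) * N i = ((r⁻¹ * s : ℝ) : ℂ) := by
      simp [hs', mul_assoc, Complex.conj_mul', Finset.mul_sum]
    rw [e, Complex.norm_real, Real.norm_of_nonneg (by positivity), ← hr2] at h1
    rw [← hr2]
    have : r⁻¹ * r ^ 2 = r := by field_simp
    rw [this] at h1
    gcongr
  · simp only [norm_mul, norm_inv, Complex.norm_real, norm_star, mul_pow, ← Finset.mul_sum,
      Real.norm_of_nonneg hr0.le, inv_pow, hr2]
    exact inv_mul_cancel₀ h0.ne'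

end ScalarVectors

section CompletelyBounded

variable {A B : Type*} [NonUnitalCStarAlgebra A] [NonUnitalCStarAlgebra B]

lemma RowColumnBound.matCNorm_cbAmp_le {u : A →ₗ[ℂ] B →ₗ[ℂ] ℂ} {J : ℝ} (hu : RowColumnBound u J)
    (hJ : 0 ≤ J) {n : ℕ} {x : Matrix (Fin n) (Fin n) A} {y : Matrix (Fin n) (Fin n) B}
    (hx : matCNorm x ≤ 1) (hy : matCNorm y ≤ 1) : matCNorm (cbAmp u n x y) ≤ J := by
  refine matCNorm_le_of_norm_dotProduct_le hJ fun ξ η hξ hη => ?_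
  have e : ∑ i, ξ i * (cbAmp u n x y).mulVec η i
      = ∑ k, u (∑ i, ξ i • x i k) (∑ j, η j • y k j) := by
    simp only [cbAmp, Matrix.mulVec, dotProduct, map_sum, LinearMap.sum_apply, map_smul,
      LinearMap.smul_apply, smul_eq_mul, Finset.mul_sum, Finset.sum_mul]
    calc _ = ∑ i, ∑ k, ∑ j, ξ i * (u (x i k) (y k j) * η j) :=
          Finset.sum_congr rfl fun i _ => Finset.sum_comm
      _ = ∑ k, ∑ i, ∑ j, ξ i * (u (x i k) (y k j) * η j) := Finset.sum_comm
      _ = ∑ k, ∑ j, ∑ i, ξ i * (u (x i k) (y k j) * η j) :=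
          Finset.sum_congr rfl fun k _ => Finset.sum_comm
      _ = _ := by
          simp only [mul_comm, mul_left_comm]
  rw [e]
  refine (hu n _ _).trans (mul_le_of_le_one_right hJ ?_)
  linarith [norm_sum_mul_star_self_le_of_scalar hx hξ, norm_sum_star_mul_self_le_of_scalar hy hη]

lemma RowColumnBound.completelyBounded {u : A →ₗ[ℂ] B →ₗ[ℂ] ℂ} {J : ℝ}
    (hu : RowColumnBound u J) (hJ : 0 ≤ J) : CompletelyBounded u := by
  refine ⟨J, ?_⟩
  rintro _ ⟨n, x, y, hx, hy, rfl⟩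
  exact hu.matCNorm_cbAmp_le hJ hx hy

lemma RowColumnBound.cbNorm_le {u : A →ₗ[ℂ] B →ₗ[ℂ] ℂ} {J : ℝ}
    (hu : RowColumnBound u J) (hJ : 0 ≤ J) : cbNorm u ≤ J := by
  refine Real.sSup_le ?_ hJ
  rintro _ ⟨n, x, y, hx, hy, rfl⟩
  exact hu.matCNorm_cbAmp_le hJ hx hy

end CompletelyBounded

/-- **Blecher's inequality with constant `K = 2`** (Haagerup–Musat): every jointly completely
bounded bilinear form `u` on a pair of C*-algebras decomposes as `u = u₁ + u₂` with
`‖u₁‖_cb + ‖u₂ᵗ‖_cb ≤ 2 ‖u‖_jcb`, where `u₂ᵗ(b,a) = u₂(a,b)` is the transposed form. -/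
theorem blecher_inequality {A B : Type*} [NonUnitalCStarAlgebra A] [NonUnitalCStarAlgebra B]
    (u : A →ₗ[ℂ] B →ₗ[ℂ] ℂ) (hu : JointlyCompletelyBounded u) :
    ∃ u₁ u₂ : A →ₗ[ℂ] B →ₗ[ℂ] ℂ,
      u = u₁ + u₂ ∧ CompletelyBounded u₁ ∧ CompletelyBounded u₂.flip ∧
      cbNorm u₁ + cbNorm u₂.flip ≤ 2 * jcbNorm u := by
  have hJ := jcbNorm_nonneg u
  obtain ⟨u₁, u₂, h, h₁, h₂⟩ := hu.mixedBound.exists_decomposition hJ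
  exact ⟨u₁, u₂, h, h₁.completelyBounded hJ, h₂.completelyBounded hJ,
    by linarith [h₁.cbNorm_le hJ, h₂.cbNorm_le hJ]⟩
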